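/- Fix Λ < 0, r_+ > 0 and α ∈ (−9/4, 0), set Δ := √(9/4+α), M_{e=0} := (r_+/2)(1+(−Λ/3)r_+²), M_0 := r_+(1+2(−Λ/3)r_+²), e(M) := √(2Mr_+ − r_+² − (−Λ/3)r_+⁴), and let M_b ∈ (M_{e=0}, M_0). Then there exists q^max = q^max(M_b, r_+, Λ, α) > 0 such that for every q₀ with |q₀| > q^max there exist ε₀ > 0 and, for each ε ∈ [0, ε₀), a mass M_c(ε) ∈ (M_{e=0}, M_b) and functions (κ_ε, Ω²_ε, ϖ_ε, Q_ε, A_ε, φ_ε), C² on (r_+, ∞), solving the static system (i)–(vi) on all of (r_+, ∞), attaining the horizon data with M = M_c(ε), e = e(M_c(ε)), φ_ε(r_+) = ε, and satisfying the Dirichlet boundary condition lim_{r→∞} r^{3/2−Δ}φ_ε(r) = 0 (so φ_ε ≢ 0 when ε > 0). Moreover there is C > 0 such that for all ε ∈ [0, ε₀) and all r > r_+: |Ω²_εκ_ε⁻²(r) − Ω_RN²(r)| ≤ Cε² and |(d/dr)(Ω²_εκ_ε⁻²)(r) − (d/dr)Ω_RN²(r)| ≤ Cε², where Ω_RN² is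 the Reissner–Nordström–AdS potential with parameters (M_c(0), e(M_c(0)), Λ); and ε⁻¹φ_ε converges pointwise on (r_+,∞), as ε → 0⁺, to a nonzero solution φ̂ of the linear charged Klein–Gordon equation (r²Ω_RN²φ̂')' = ((−Λ/3)α − q₀²A_RN²/Ω_RN²)·r²·φ̂ satisfying the Dirichlet boundary condition, where A_RN(r) = e(M_c(0))(1/r_+ − 1/r). -/

import Mathlib

open Real Set Filter

noncomputable section

/-- The Reissner–Nordström–AdS potential `Ω_RN²(r) = 1 − 2M/r + e²/r² + (−Λ/3)r²`. -/
noncomputable def RNpot (Λ M e r : ℝ) : ℝ := 1 - 2*M/r + e^2/r^2 + (-Λ/3)*r^2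

/-- `(M, e, Λ)` are sub-extremal parameters with largest horizon radius `rp`. -/
def IsSubExtremal (Λ M e rp : ℝ) : Prop :=
  0 < rp ∧ RNpot Λ M e rp = 0 ∧
  (∃ r0, 0 < r0 ∧ r0 ≠ rp ∧ RNpot Λ M e r0 = 0) ∧
  ∀ r, 0 < r → RNpot Λ M e r = 0 → r ≤ rp

/-- The static spherically symmetric Einstein–Maxwell–(charged) Klein–Gordon system
(i)–(vi) on `(r_+, ∞)` for the unknowns `(κ, Ω², ϖ, Q, A, φ)`. -/
def StaticSystem (Λ α q0 rp : ℝ) (κ Ω2 ϖ Q A φ : ℝ → ℝ) : Prop :=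
  ContDiffOn ℝ 2 κ (Set.Ioi rp) ∧ ContDiffOn ℝ 2 Ω2 (Set.Ioi rp) ∧
  ContDiffOn ℝ 2 ϖ (Set.Ioi rp) ∧ ContDiffOn ℝ 2 Q (Set.Ioi rp) ∧
  ContDiffOn ℝ 2 A (Set.Ioi rp) ∧ ContDiffOn ℝ 2 φ (Set.Ioi rp) ∧
  (∀ r ∈ Set.Ioi rp, 0 < κ r) ∧ (∀ r ∈ Set.Ioi rp, 0 < Ω2 r) ∧
  -- (i) Raychaudhuri
  (∀ r ∈ Set.Ioi rp, deriv κ r / κ r =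
      r*(deriv φ r)^2 + q0^2*r*(κ r)^2*(A r/Ω2 r)^2*(φ r)^2) ∧
  -- (ii) constraint
  (∀ r ∈ Set.Ioi rp, Ω2 r/(κ r)^2 = 1 - 2*ϖ r/r + (Q r)^2/r^2 + (-Λ/3)*r^2) ∧
  -- (iii) Vaidya mass transport
  (∀ r ∈ Set.Ioi rp, deriv ϖ r =
      (-Λ/3)*α*r^2*(φ r)^2/2 + (r^2*(deriv φ r)^2/2)*(Ω2 r/(κ r)^2)
      + q0^2*(A r)^2*r^2*(φ r)^2/(2*Ω2 r)
      + q0^2*(Q r)*r*(A r/Ω2 r)*(κ r)*(φ r)^2) ∧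
  -- (iv) charge
  (∀ r ∈ Set.Ioi rp, deriv Q r = q0^2*r^2*(κ r)*(A r/Ω2 r)*(φ r)^2) ∧
  -- (v) potential
  (∀ r ∈ Set.Ioi rp, deriv A r = Q r * κ r / r^2) ∧
  -- (vi) charged Klein–Gordon
  (∀ r ∈ Set.Ioi rp,
      deriv (fun s => s^2*(Ω2 s/(κ s)^2)*deriv φ s) r
        + r^2*(deriv κ r/κ r)*(Ω2 r/(κ r)^2)*deriv φ r
      = (-Λ/3)*α*r^2*φ r - q0^2*(A r)^2*r^2/(Ω2 r)*φ r)

/-- The horizon data at `r = r_+` with mass `M`, charge `e` and scalar field value `ε`,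
attained as limits from the black hole exterior `(r_+, ∞)`. -/
def HorizonData (Λ α rp M e ε : ℝ) (κ Ω2 ϖ Q A φ : ℝ → ℝ) : Prop :=
  ∃ Kp κp : ℝ,
    Kp = M/rp^2 - e^2/rp^3 + (-Λ/3)*rp ∧ 0 < Kp ∧
    κp = (1 - (-Λ/3)*α*rp*ε^2/(2*Kp))⁻¹ ∧
    Filter.Tendsto ϖ (nhdsWithin rp (Set.Ioi rp)) (nhds M) ∧
    Filter.Tendsto Q (nhdsWithin rp (Set.Ioi rp)) (nhds e) ∧
    Filter.Tendsto φ (nhdsWithin rp (Set.Ioi rp)) (nhds ε) ∧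
    Filter.Tendsto κ (nhdsWithin rp (Set.Ioi rp)) (nhds κp) ∧
    Filter.Tendsto (deriv φ) (nhdsWithin rp (Set.Ioi rp))
      (nhds ((-Λ/3)*α*ε*κp/(2*Kp))) ∧
    Filter.Tendsto (fun r => A r / Ω2 r) (nhdsWithin rp (Set.Ioi rp))
      (nhds (e/(2*Kp*rp^2))) ∧
    Filter.Tendsto (deriv Ω2) (nhdsWithin rp (Set.Ioi rp)) (nhds (2*Kp*κp))

/-- Continuous real functions on the compactified radial interval `[0,1]`. -/
abbrev UC : Type := C(Set.Icc (0:ℝ) 1, ℝ)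

namespace UC

/-- Evaluation at a real number, clamped to `[0,1]`. -/
def ev (f : UC) (x : ℝ) : ℝ := f (Set.projIcc 0 1 zero_le_one x)

@[simp] lemma ev_add (f g : UC) (x : ℝ) : ev (f + g) x = ev f x + ev g x := rfl
@[simp] lemma ev_sub (f g : UC) (x : ℝ) : ev (f - g) x = ev f x - ev g x := rfl
@[simp] lemma ev_mul (f g : UC) (x : ℝ) : ev (f * g) x = ev f x * ev g x := rfl
@[simp] lemma ev_neg (f : UC) (x : ℝ) : ev (-f) x = -ev f x := rfl
@[simp] lemma ev_smul (c : ℝ) (f : UC) (x : ℝ) : ev (c • f) x = c * ev f x := rfl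
@[simp] lemma ev_one (x : ℝ) : ev 1 x = 1 := rfl
@[simp] lemma ev_zero (x : ℝ) : ev 0 x = 0 := rfl
@[simp] lemma ev_pow (f : UC) (n : ℕ) (x : ℝ) : ev (f ^ n) x = ev f x ^ n := rfl

lemma continuous_ev (f : UC) : Continuous (ev f) := f.continuous.comp continuous_projIcc

lemma ev_of_mem (f : UC) {x : ℝ} (hx : x ∈ Icc (0:ℝ) 1) : ev f x = f ⟨x, hx⟩ := by
  simp [ev, projIcc_of_mem zero_le_one hx]

lemma abs_ev_le (f : UC) (x : ℝ) : |ev f x| ≤ ‖f‖ := f.norm_coe_le_norm _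

lemma norm_le_of_ev {f : UC} {C : ℝ} (hC : 0 ≤ C) (h : ∀ x ∈ Icc (0:ℝ) 1, |ev f x| ≤ C) :
    ‖f‖ ≤ C := by
  rw [ContinuousMap.norm_le _ hC]
  rintro ⟨x, hx⟩
  have := h x hx
  rwa [ev_of_mem f hx] at this

lemma ext_ev {f g : UC} (h : ∀ x ∈ Icc (0:ℝ) 1, ev f x = ev g x) : f = g := by
  ext ⟨x, hx⟩
  have := h x hx
  rwa [ev_of_mem f hx, ev_of_mem g hx] at this

/-- The element of `UC` given by a real function continuous on `[0,1]`. -/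
def mk (g : ℝ → ℝ) (hg : ContinuousOn g (Icc 0 1)) : UC :=
  ⟨(Icc (0:ℝ) 1).domRestrict g, hg.domRestrict⟩

lemma ev_mk {g : ℝ → ℝ} (hg : ContinuousOn g (Icc 0 1)) {x : ℝ} (hx : x ∈ Icc (0:ℝ) 1) :
    ev (mk g hg) x = g x := by
  rw [ev_of_mem _ hx]; rfl

lemma isUnit_of_ev {f : UC} (h : ∀ x ∈ Icc (0:ℝ) 1, ev f x ≠ 0) : IsUnit f := by
  rw [ContinuousMap.isUnit_iff_forall_ne_zero]
  rintro ⟨x, hx⟩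
  have := h x hx
  rwa [ev_of_mem f hx] at this

lemma ev_inverse {f : UC} (h : IsUnit f) (x : ℝ) : ev (Ring.inverse f) x = (ev f x)⁻¹ := by
  have h1 : ev (f * Ring.inverse f) x = 1 := by rw [Ring.mul_inverse_cancel f h]; rfl
  rw [ev_mul] at h1
  exact eq_inv_of_mul_eq_one_right h1

lemma exists_clm (op : UC → ℝ → ℝ) (hc : ∀ f, ContinuousOn (op f) (Icc 0 1))
    (hadd : ∀ f g, ∀ x ∈ Icc (0:ℝ) 1, op (f + g) x = op f x + op g x)
    (hsmul : ∀ (c : ℝ) f, ∀ x ∈ Icc (0:ℝ) 1, op (c • f) x = c * op f x)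
    (C : ℝ) (hb : ∀ f, ∀ x ∈ Icc (0:ℝ) 1, |op f x| ≤ C * ‖f‖) :
    ∃ T : UC →L[ℝ] UC, ∀ f, ∀ x ∈ Icc (0:ℝ) 1, ev (T f) x = op f x := by
  let T₀ : UC →ₗ[ℝ] UC :=
    { toFun := fun f => mk (op f) (hc f)
      map_add' := fun f g => ext_ev fun x hx => by
        rw [ev_add, ev_mk _ hx, ev_mk _ hx, ev_mk _ hx, hadd f g x hx]
      map_smul' := fun c f => ext_ev fun x hx => by
        rw [RingHom.id_apply, ev_smul, ev_mk _ hx, ev_mk _ hx, hsmul c f x hx] }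
  refine ⟨T₀.mkContinuous |C| fun f => ?_, fun f x hx => ev_mk (hc f) hx⟩
  refine norm_le_of_ev (by positivity) fun x hx => ?_
  have h1 : ev (T₀ f) x = op f x := ev_mk (hc f) hx
  rw [h1]
  exact (hb f x hx).trans (mul_le_mul_of_nonneg_right (le_abs_self C) (norm_nonneg f))

lemma continuousOn_tail_quot {g : ℝ → ℝ} (hi : IntervalIntegrable g MeasureTheory.volume 0 1)
    (hg : ContinuousOn g (Ioc 0 1)) :
    ContinuousOn (fun x => if x = 1 then g 1 else (∫ y in x..1, g y) / (1 - x)) (Icc 0 1) := by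
  intro x hx
  rcases eq_or_ne x 1 with rfl | hx1
  · have hsm : StronglyMeasurableAtFilter g (nhdsWithin 1 (Iic 1)) MeasureTheory.volume := by
      refine ⟨Ioc 0 1, Ioc_mem_nhdsLE (by norm_num), ?_⟩
      exact hg.aestronglyMeasurable measurableSet_Ioc
    have hcw : ContinuousWithinAt g (Iic 1) 1 := by
      have := hg 1 (by norm_num)
      exact this.mono_of_mem_nhdsWithin (Ioc_mem_nhdsLE (by norm_num))
    have hd : HasDerivWithinAt (fun u => ∫ y in (1:ℝ)..u, g y) (g 1) (Iic 1) 1 :=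
      intervalIntegral.integral_hasDerivWithinAt_right (by simp) hsm hcw
    have hs := hasDerivWithinAt_iff_tendsto_slope.mp hd
    simp only [ContinuousWithinAt, if_true]
    have hsplit : Icc (0:ℝ) 1 = insert 1 (Ico 0 1) := by
      exact (Set.Ico_insert_right (zero_le_one)).symm
    rw [hsplit, nhdsWithin_insert, tendsto_sup]
    constructor
    · rw [tendsto_pure_left]; intro s hs; simpa using mem_of_mem_nhds hs
    · have h2 : Tendsto (slope (fun u => ∫ y in (1:ℝ)..u, g y) 1) (nhdsWithin 1 (Ico 0 1)) (nhds (g 1)) :=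
        hs.mono_left (nhdsWithin_mono _ (fun y hy => ⟨le_of_lt hy.2, ne_of_lt hy.2⟩))
      refine h2.congr' ?_
      filter_upwards [self_mem_nhdsWithin] with y hy
      have : y ≠ 1 := ne_of_lt hy.2
      rw [if_neg this, slope_def_field, intervalIntegral.integral_same, sub_zero,
        intervalIntegral.integral_symm, ← neg_sub 1 y, neg_div_neg_eq]
  · have hlt : x < 1 := lt_of_le_of_ne hx.2 hx1
    have hc : ContinuousOn (fun x => ∫ y in x..1, g y) (Icc 0 1) := by
      have := intervalIntegral.continuousOn_primitive_interval' (a := 1) hi (by simp)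
      rw [uIcc_of_le zero_le_one] at this
      refine this.neg.congr fun y _ => ?_
      rw [Pi.neg_apply, intervalIntegral.integral_symm]
    have h3 : ContinuousWithinAt (fun x => (∫ y in x..1, g y) / (1 - x)) (Icc 0 1) x :=
      (hc x hx).div (by fun_prop) (by linarith)
    refine h3.congr_of_eventuallyEq ?_ (by simp [hx1])
    have : ∀ᶠ y in nhdsWithin x (Icc 0 1), y < 1 := nhdsWithin_le_nhds (Iio_mem_nhds hlt)
    filter_upwards [this] with y hy
    rw [if_neg (ne_of_lt hy)]

/-- The operator averaging over `[x,1]` against a weight. -/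
lemma exists_tailAvg {w : ℝ → ℝ} (hi : IntervalIntegrable w MeasureTheory.volume 0 1)
    (hw : ContinuousOn w (Ioc 0 1)) :
    ∃ T : UC →L[ℝ] UC, (∀ f, ∀ x ∈ Icc (0:ℝ) 1, (1 - x) * ev (T f) x = ∫ y in x..1, w y * ev f y) ∧
      ∀ f, ev (T f) 1 = w 1 * ev f 1 := by
  have hif : ∀ f : UC, IntervalIntegrable (fun y => w y * ev f y) MeasureTheory.volume 0 1 :=
    fun f => hi.mul_continuousOn (continuous_ev f).continuousOn
  have hsub : ∀ {x : ℝ}, x ∈ Icc (0:ℝ) 1 →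
      ∀ {g : ℝ → ℝ}, IntervalIntegrable g MeasureTheory.volume 0 1 →
      IntervalIntegrable g MeasureTheory.volume x 1 := fun {x} hx {g} hg =>
    hg.mono_set (by rw [uIcc_of_le hx.2, uIcc_of_le zero_le_one]; exact Icc_subset_Icc_left hx.1)
  obtain ⟨C, hC⟩ := isCompact_Icc.exists_bound_of_continuousOn
    (continuousOn_tail_quot (g := fun y => |w y|) hi.abs hw.abs)
  obtain ⟨T, hT⟩ := exists_clm
    (fun f x => if x = 1 then w 1 * ev f 1 else (∫ y in x..1, w y * ev f y) / (1 - x))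
    (fun f => continuousOn_tail_quot (hif f) (hw.mul (continuous_ev f).continuousOn))
    (fun f g x hx => by
      split_ifs with h
      · rw [ev_add]; ring
      · rw [← add_div, ← intervalIntegral.integral_add (hsub hx (hif f)) (hsub hx (hif g))]
        congr 2; ext y; rw [ev_add]; ring)
    (fun c f x hx => by
      split_ifs with h
      · rw [ev_smul]; ring
      · rw [← mul_div_assoc, ← intervalIntegral.integral_const_mul]
        congr 2; ext y; rw [ev_smul]; ring)
    C (fun f x hx => by
      have h0 := hC x hx
      split_ifs at h0 ⊢ with h
      · rw [abs_mul]
        rw [Real.norm_eq_abs, abs_abs] at h0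
        exact mul_le_mul h0 (abs_ev_le f 1) (abs_nonneg _) ((abs_nonneg _).trans h0)
      · have hlt : x < 1 := lt_of_le_of_ne hx.2 h
        have hp : 0 < 1 - x := by linarith
        rw [Real.norm_eq_abs, abs_div, abs_of_pos hp] at h0
        rw [abs_div, abs_of_pos hp]
        have h1 : |∫ y in x..1, w y * ev f y| ≤ (∫ y in x..1, |w y|) * ‖f‖ := by
          rw [← Real.norm_eq_abs, ← intervalIntegral.integral_mul_const]
          refine intervalIntegral.norm_integral_le_of_norm_le hx.2 ?_ ((hsub hx hi.abs).mul_const _)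
          refine Eventually.of_forall fun y _ => ?_
          rw [norm_mul, Real.norm_eq_abs]
          exact mul_le_mul_of_nonneg_left (abs_ev_le f y) (abs_nonneg _)
        calc |∫ y in x..1, w y * ev f y| / (1 - x) ≤ ((∫ y in x..1, |w y|) * ‖f‖) / (1 - x) := by gcongr
          _ = (∫ y in x..1, |w y|) / (1 - x) * ‖f‖ := by ring
          _ ≤ C * ‖f‖ := by
            refine mul_le_mul_of_nonneg_right ?_ (norm_nonneg f)
            refine le_trans ?_ h0
            gcongr
            exact le_abs_self _)
  refine ⟨T, fun f x hx => ?_, fun f => ?_⟩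
  · rw [hT f x hx]
    split_ifs with h
    · simp [h]
    · have : 1 - x ≠ 0 := fun h' => h (by linarith)
      field_simp
  · rw [hT f 1 (by norm_num)]; simp

/-- Evaluation at a point as a continuous linear functional. -/
def evL (x : ℝ) : UC →L[ℝ] ℝ := ContinuousMap.evalCLM ℝ (Set.projIcc 0 1 zero_le_one x)

@[simp] lemma evL_apply (x : ℝ) (f : UC) : evL x f = ev f x := rfl

/-- Solution operator `f ↦ (ρ(1-y))⁻¹ ∫₀^y ρ (f - c f)` of the Neumann problem with weight `ρ`. -/
lemma exists_neumann {ρ : ℝ → ℝ} (hρ : ContinuousOn ρ (Icc 0 1)) (hpos : ∀ y ∈ Ioc (0:ℝ) 1, 0 < ρ y)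
    {K : ℝ} (hK : ∀ y ∈ Ioc (0:ℝ) 1, ∀ z ∈ Icc 0 y, ρ z ≤ K * ρ y) :
    ∃ c : UC →L[ℝ] ℝ, ∃ H : UC →L[ℝ] UC,
      (∀ f, c f * (∫ y in (0:ℝ)..1, ρ y) = ∫ y in (0:ℝ)..1, ρ y * ev f y) ∧
      ∀ f, ∀ y ∈ Icc (0:ℝ) 1, ρ y * (1 - y) * ev (H f) y =
          ∫ z in (0:ℝ)..y, ρ z * (ev f z - c f) := by
  have hρi : IntervalIntegrable ρ MeasureTheory.volume 0 1 :=
    ContinuousOn.intervalIntegrable (by rwa [uIcc_of_le zero_le_one])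
  obtain ⟨T, hT, -⟩ := exists_tailAvg hρi (hρ.mono Ioc_subset_Icc_self)
  have hT0 : ∀ f, ev (T f) 0 = ∫ y in (0:ℝ)..1, ρ y * ev f y := fun f => by
    have := hT f 0 (by norm_num); simpa using this
  have hIpos : 0 < ∫ y in (0:ℝ)..1, ρ y :=
    intervalIntegral.intervalIntegral_pos_of_pos_on
        hρi (fun y hy => hpos y (Ioo_subset_Ioc_self hy)) (by norm_num)
  set I : ℝ := ∫ y in (0:ℝ)..1, ρ y with hI
  let c : UC →L[ℝ] ℝ := I⁻¹ • (evL 0).comp T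
  have hc : ∀ f, c f = I⁻¹ * ev (T f) 0 := fun f => rfl
  have hif : ∀ f : UC, ContinuousOn (fun y => ρ y * ev f y) (Icc 0 1) :=
    fun f => hρ.mul (continuous_ev f).continuousOn
  have hii : ∀ g : ℝ → ℝ, ContinuousOn g (Icc 0 1) → ∀ a ∈ Icc (0:ℝ) 1, ∀ b ∈ Icc (0:ℝ) 1,
      IntervalIntegrable g MeasureTheory.volume a b := fun g hg a ha b hb =>
    (hg.mono (uIcc_subset_Icc ha hb)).intervalIntegrable
  have hmean : ∀ f, ev (T (f - c f • 1)) 0 = 0 := fun f => by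
    have h1 : ev (T 1) 0 = I := by rw [hT0]; simp [hI]
    rw [map_sub, map_smul, ev_sub, ev_smul, h1, hc]
    field_simp; ring
  have hkey : ∀ f, ∀ y ∈ Icc (0:ℝ) 1, (1 - y) * -ev (T (f - c f • 1)) y
      = ∫ z in (0:ℝ)..y, ρ z * (ev f z - c f) := fun f y hy => by
    have h1 := hT (f - c f • 1) y hy
    have h2 := hT0 (f - c f • 1)
    rw [hmean] at h2
    have h3 := intervalIntegral.integral_add_adjacent_intervals
      (hii _ (hif (f - c f • 1))
          0 (by norm_num) y hy) (hii _ (hif (f - c f • 1)) y hy 1 (by norm_num))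
    have h4 : (∫ z in (0:ℝ)..y, ρ z * (ev f z - c f)) =
        ∫ z in (0:ℝ)..y, ρ z * ev (f - c f • 1) z := by
      congr 1; ext z; simp
    rw [h4]; linarith
  have hKnn : 0 ≤ K := by
    have h1 := hK 1 (by norm_num) 1 (by norm_num)
    have h2 := hpos 1 (by norm_num)
    by_contra h
    have : K * ρ 1 < 0 := mul_neg_of_neg_of_pos (not_le.mp h) h2
    linarith
  have hfc : ∀ f, ‖f - c f • (1:UC)‖ ≤ (1 + ‖c‖) * ‖f‖ := fun f => by
    calc ‖f - c f • (1:UC)‖ ≤ ‖f‖ + ‖c f • (1:UC)‖ := norm_sub_le _ _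
      _ ≤ ‖f‖ + ‖c‖ * ‖f‖ := by
        gcongr
        rw [norm_smul, norm_one, mul_one]
        exact c.le_opNorm f
      _ = _ := by ring
  have hsmall : ∀ f, ∀ y ∈ Ioc (0:ℝ) 1, y ≤ 1 / 2 →
      |-ev (T (f - c f • 1)) y / ρ y| ≤ 2 * K * ((1 + ‖c‖) * ‖f‖) * y := fun f y hy hy2 => by
    have h1 := hkey f y ⟨hy.1.le, hy.2⟩
    have hρy := hpos y hy
    have h2 : |∫ z in (0:ℝ)..y, ρ z * (ev f z - c f)| ≤ K * ρ y * ((1 + ‖c‖) * ‖f‖) * |y - 0| := by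
      rw [← Real.norm_eq_abs]
      refine intervalIntegral.norm_integral_le_of_norm_le_const fun z hz => ?_
      rw [uIoc_of_le hy.1.le] at hz
      rw [norm_mul]
      have hz1 : 0 < ρ z := hpos z ⟨hz.1, hz.2.trans hy.2⟩
      rw [Real.norm_of_nonneg hz1.le]
      have h5 : ‖ev f z - c f‖ ≤ (1 + ‖c‖) * ‖f‖ := by
        have h6 := (abs_ev_le (f - c f • 1) z).trans (hfc f)
        simpa using h6
      exact mul_le_mul (hK y hy z ⟨hz.1.le, hz.2⟩) h5 (norm_nonneg _) (by positivity)
    rw [← h1, sub_zero, abs_mul, abs_of_pos hy.1, abs_of_nonneg (by linarith : (0:ℝ) ≤ 1 - y)] at h2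
    rw [abs_div, abs_of_pos hρy, div_le_iff₀ hρy]
    nlinarith [abs_nonneg (-ev (T (f - c f • 1)) y)]
  obtain ⟨H, hH⟩ := exists_clm (fun f y => if y = 0 then 0 else -ev (T (f - c f • 1)) y / ρ y)
    (fun f => by
      intro y hy
      rcases eq_or_ne y 0 with rfl | hy0
      · rw [ContinuousWithinAt]
        simp only [if_true]
        have hb : ∀ᶠ y in nhdsWithin (0:ℝ) (Icc 0 1),
            |if y = 0 then 0 else -ev (T (f - c f • 1)) y / ρ y| ≤
                2 * K * ((1 + ‖c‖) * ‖f‖) * y := by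
          have : ∀ᶠ y in nhdsWithin (0:ℝ) (Icc 0 1), y < 1 / 2 :=
            nhdsWithin_le_nhds (Iio_mem_nhds (by norm_num))
          filter_upwards [this, self_mem_nhdsWithin] with y h1 h2
          split_ifs with h
          · simp [h]
          · exact hsmall f y ⟨lt_of_le_of_ne h2.1 (Ne.symm h), h2.2⟩ h1.le
        refine squeeze_zero_norm' hb ?_
        have : Tendsto (fun y : ℝ => 2 * K * ((1 + ‖c‖) * ‖f‖) * y) (nhds 0)
            (nhds (2 * K * ((1 + ‖c‖) * ‖f‖) * 0)) :=
          (continuous_const.mul continuous_id).tendsto 0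
        rw [mul_zero] at this
        exact this.mono_left nhdsWithin_le_nhds
      · have hy1 : 0 < y := lt_of_le_of_ne hy.1 (Ne.symm hy0)
        have h3 : ContinuousWithinAt (fun y => -ev (T (f - c f • 1)) y / ρ y) (Icc 0 1) y :=
          (continuous_ev _).neg.continuousWithinAt.div (hρ y hy) (hpos y ⟨hy1, hy.2⟩).ne'
        refine h3.congr_of_eventuallyEq ?_ (by simp [hy0])
        have : ∀ᶠ z in nhdsWithin y (Icc 0 1), 0 < z := nhdsWithin_le_nhds (Ioi_mem_nhds hy1)
        filter_upwards [this] with z hz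
        rw [if_neg hz.ne'])
    (fun f g y hy => by
      split_ifs with h
      · simp
      · have : f + g - c (f + g) • (1:UC) = (f - c f • 1) + (g - c g • 1) := by
          rw [map_add, add_smul]; abel
        rw [this, map_add, ev_add]; ring)
    (fun a f y hy => by
      split_ifs with h
      · simp
      · have : a • f - c (a • f) • (1:UC) = a • (f - c f • 1) := by
          rw [map_smul, smul_sub, smul_smul]; rfl
        rw [this, map_smul, ev_smul]; ring)
    (2 * K * (1 + ‖c‖) + ‖T‖ * (1 + ‖c‖) * (K / ρ (1/2)))
    (fun f y hy => by
      have hp2 := hpos (1/2) (by norm_num)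
      split_ifs with h
      · rw [abs_zero]; positivity
      · have hy1 : 0 < y := lt_of_le_of_ne hy.1 (Ne.symm h)
        rcases le_total y (1/2) with h2 | h2
        · refine (hsmall f y ⟨hy1, hy.2⟩ h2).trans ?_
          calc 2 * K * ((1 + ‖c‖) * ‖f‖) * y ≤ 2 * K * ((1 + ‖c‖) * ‖f‖) * 1 := by
                gcongr; exact hy.2
            _ = 2 * K * (1 + ‖c‖) * ‖f‖ := by ring
            _ ≤ _ := by
              gcongr
              exact le_add_of_nonneg_right (by positivity)
        · have hρy := hpos y ⟨hy1, hy.2⟩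
          have h5 : ρ (1/2) ≤ K * ρ y := hK y ⟨hy1, hy.2⟩ (1/2) ⟨by norm_num, h2⟩
          have h6 : (ρ y)⁻¹ ≤ K / ρ (1/2) := by
            rw [inv_eq_one_div, div_le_div_iff₀ hρy hp2]; linarith
          rw [abs_div, abs_of_pos hρy, abs_neg, div_eq_mul_inv]
          calc |ev (T (f - c f • 1)) y| * (ρ y)⁻¹ ≤ (‖T‖ * ((1 + ‖c‖) * ‖f‖)) * (K / ρ (1/2)) := by
                gcongr
                exact (abs_ev_le _ _).trans ((T.le_opNorm _).trans
                  (mul_le_mul_of_nonneg_left (hfc f) (norm_nonneg T)))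
            _ = ‖T‖ * (1 + ‖c‖) * (K / ρ (1/2)) * ‖f‖ := by ring
            _ ≤ _ := by
              gcongr
              exact le_add_of_nonneg_left (by positivity))
  refine ⟨c, H, fun f => ?_, fun f y hy => ?_⟩
  · rw [hc, hT0]; field_simp
  · rw [← hkey f y hy, hH f y hy]
    split_ifs with h
    · subst h; rw [hmean]; simp
    · have := (hpos y ⟨lt_of_le_of_ne hy.1 (Ne.symm h), hy.2⟩).ne'
      field_simp

end UC

namespace UC

/-- Primitive from the left endpoint. -/
lemma exists_primitive : ∃ J : UC →L[ℝ] UC, ∀ f, ∀ x ∈ Icc (0:ℝ) 1,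
    ev (J f) x = ∫ y in (0:ℝ)..x, ev f y := by
  have hii : ∀ (f : UC) (a b : ℝ), IntervalIntegrable (ev f) MeasureTheory.volume a b :=
    fun f a b => (continuous_ev f).intervalIntegrable a b
  refine exists_clm (fun f x => ∫ y in (0:ℝ)..x, ev f y)
    (fun f => (intervalIntegral.continuous_primitive (hii f) 0).continuousOn)
    (fun f g x hx => ?_) (fun c f x hx => ?_) 1 (fun f x hx => ?_)
  · rw [← intervalIntegral.integral_add (hii _ _ _) (hii _ _ _)]; rfl
  · rw [← intervalIntegral.integral_const_mul]; rfl
  · have := intervalIntegral.norm_integral_le_of_norm_le_const (a := 0) (b := x) (f := ev f) (C := ‖f‖)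
      fun y _ => abs_ev_le f y
    rw [Real.norm_eq_abs, sub_zero, abs_of_nonneg hx.1] at this
    nlinarith [norm_nonneg f, hx.2]

/-- The averaging operator `f ↦ (t ↦ ∫₀¹ w(τ) f(τt) dτ)`. -/
lemma exists_headAvg {w : ℝ → ℝ} (hw : Continuous w) (hw1 : ∀ τ ∈ Icc (0:ℝ) 1, |w τ| ≤ 1) :
    ∃ A : UC →L[ℝ] UC, ∀ f, ∀ t ∈ Icc (0:ℝ) 1, ev (A f) t =
        ∫ τ in (0:ℝ)..1, w τ * ev f (τ * t) := by
  have hcont : ∀ (f : UC) (t : ℝ), Continuous fun τ => w τ * ev f (τ * t) := fun f t =>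
    hw.mul ((continuous_ev f).comp (by fun_prop))
  refine exists_clm (fun f t => ∫ τ in (0:ℝ)..1, w τ * ev f (τ * t)) (fun f => ?_)
    (fun f g x hx => ?_) (fun c f x hx => ?_) 1 (fun f x hx => ?_)
  · refine (intervalIntegral.continuous_parametric_intervalIntegral_of_continuous' ?_ 0 1).continuousOn
    exact (hw.comp continuous_snd).mul ((continuous_ev f).comp (by fun_prop))
  · rw [← intervalIntegral.integral_add ((hcont f x).intervalIntegrable _ _) ((hcont g x).intervalIntegrable _ _)]
    congr 1; ext τ; rw [ev_add]; ring
  · rw [← intervalIntegral.integral_const_mul]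
    congr 1; ext τ; rw [ev_smul]; ring
  · have := intervalIntegral.norm_integral_le_of_norm_le_const (a := 0) (b := 1)
      (f := fun τ => w τ * ev f (τ * x)) (C := ‖f‖) fun y hy => by
        rw [uIoc_of_le zero_le_one] at hy
        rw [norm_mul]
        have h1 := hw1 y ⟨hy.1.le, hy.2⟩
        have h2 := abs_ev_le f (y * x)
        calc ‖w y‖ * ‖ev f (y * x)‖ ≤ 1 * ‖f‖ := by gcongr <;> assumption
          _ = ‖f‖ := one_mul _
    simpa using this

lemma isUnit_one_sub_of_norm_pow_lt_one {R : Type*} [NormedRing R] [HasSummableGeomSeries R] {T : R}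
    {n : ℕ} (h : ‖T ^ n‖ < 1) :
    IsUnit (1 - T) := by
  have h1 : IsUnit (1 - T ^ n) := isUnit_one_sub_of_norm_lt_one h
  rw [← mul_neg_geom_sum] at h1
  refine ((Commute.isUnit_mul_iff ?_).mp h1).1
  refine Commute.sum_right _ _ _ fun i _ => ?_
  exact ((Commute.one_left _).sub_left (Commute.refl T)).pow_right i
lemma continuous_inverse_of_isUnit {X R : Type*} [TopologicalSpace X] [NormedRing R]
    [HasSummableGeomSeries R] {f : X → R}
  (hf : Continuous f) (hu : ∀ x, IsUnit (f x)) : Continuous fun x => Ring.inverse (f x) := by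
  rw [continuous_iff_continuousAt]
  intro e
  obtain ⟨u, hu⟩ := hu e
  have h1 : ContinuousAt Ring.inverse (f e) := by
    rw [← hu]; exact NormedRing.inverse_continuousAt u
  exact h1.comp hf.continuousAt

/-- Volterra equations `u = 1 + ∫₀ˣ g A(ω u)` have solutions depending continuously on the
coefficients. -/
lemma exists_volterra {w : ℝ → ℝ} (hw : Continuous w) (hw1 : ∀ τ ∈ Icc (0:ℝ) 1, |w τ| ≤ 1)
    {g ω : ℝ → UC} (hg : Continuous g) (hω : Continuous ω) :
    ∃ U V : ℝ → UC, Continuous U ∧ Continuous V ∧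
      (∀ e, ∀ x ∈ Icc (0:ℝ) 1, ev (U e) x = 1 + ∫ y in (0:ℝ)..x, ev (V e) y) ∧
      ∀ e, ∀ x ∈ Icc (0:ℝ) 1, ev (V e) x =
          ev (g e) x * ∫ τ in (0:ℝ)..1, w τ * (ev (ω e) (τ * x) * ev (U e) (τ * x)) := by
  obtain ⟨J, hJ⟩ := exists_primitive
  obtain ⟨A, hA⟩ := exists_headAvg hw hw1
  let m : UC →L[ℝ] UC →L[ℝ] UC := ContinuousLinearMap.mul ℝ UC
  let T : ℝ → (UC →L[ℝ] UC) := fun e => J.comp ((m (g e)).comp (A.comp (m (ω e))))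
  have hTc : Continuous T := by
    have h1 : Continuous fun e => m (g e) := m.continuous.comp hg
    have h2 : Continuous fun e => m (ω e) := m.continuous.comp hω
    exact continuous_const.clm_comp (h1.clm_comp (continuous_const.clm_comp h2))
  have hT : ∀ e f, T e f = J (g e * A (ω e * f)) := fun e f => rfl
  have hbound : ∀ e (n : ℕ) (f : UC), ∀ x ∈ Icc (0:ℝ) 1,
      |ev ((T e ^ n) f) x| ≤ (‖g e‖ * ‖ω e‖) ^ n * x ^ n / n.factorial * ‖f‖ := by
    intro e n f
    induction n with
    | zero => intro x hx; simpa using abs_ev_le f x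
    | succ n ih =>
      intro x hx
      rw [pow_succ', mul_apply_eq_comp, hT, hJ _ x hx]
      set C := ‖g e‖ * ‖ω e‖
      have hb : ∀ y ∈ Icc (0:ℝ) 1, |ev (g e * A (ω e * (T e ^ n) f)) y|
          ≤ C * (C ^ n * y ^ n / n.factorial * ‖f‖) := fun y hy => by
        rw [ev_mul, abs_mul, hA _ y hy]
        have h3 : |∫ τ in (0:ℝ)..1, w τ * ev (ω e * (T e ^ n) f) (τ * y)| ≤
            (‖ω e‖ * (C ^ n * y ^ n / n.factorial * ‖f‖)) * |1 - 0| := by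
          rw [← Real.norm_eq_abs]
          refine intervalIntegral.norm_integral_le_of_norm_le_const fun τ hτ => ?_
          rw [uIoc_of_le zero_le_one] at hτ
          have hm : τ * y ∈ Icc (0:ℝ) 1 := ⟨mul_nonneg hτ.1.le hy.1, mul_le_one₀ hτ.2 hy.1 hy.2⟩
          have h4 := ih (τ * y) hm
          have h5 : τ * y ≤ y := mul_le_of_le_one_left hy.1 hτ.2
          have h6 : |ev ((T e ^ n) f) (τ * y)| ≤ C ^ n * y ^ n / n.factorial * ‖f‖ := by
            refine h4.trans ?_
            have := hm.1
            gcongr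
          rw [ev_mul, norm_mul, norm_mul]
          have h7 := hw1 τ ⟨hτ.1.le, hτ.2⟩
          have h8 := abs_ev_le (ω e) (τ * y)
          calc ‖w τ‖ * (‖ev (ω e) (τ * y)‖ * ‖ev ((T e ^ n) f) (τ * y)‖)
              ≤ 1 * (‖ω e‖ * (C ^ n * y ^ n / n.factorial * ‖f‖)) := by gcongr <;> assumption
            _ = _ := one_mul _
        rw [sub_zero, abs_one, mul_one] at h3
        calc _ ≤ ‖g e‖ * (‖ω e‖ * (C ^ n * y ^ n / n.factorial * ‖f‖)) := by
              gcongr; exact abs_ev_le _ _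
          _ = _ := by ring
      have hival : (∫ y in (0:ℝ)..x, C * (C ^ n * y ^ n / n.factorial * ‖f‖))
          = C ^ (n + 1) * x ^ (n + 1) / (n + 1).factorial * ‖f‖ := by
        have : ∀ y : ℝ, C * (C ^ n * y ^ n / n.factorial * ‖f‖) =
            (C ^ (n + 1) / n.factorial * ‖f‖) * y ^ n :=
          fun y => by ring
        simp_rw [this]
        rw [intervalIntegral.integral_const_mul, integral_pow, Nat.factorial_succ]
        push_cast
        have h9 : (n.factorial : ℝ) ≠ 0 := by positivity
        have h10 : (n : ℝ) + 1 ≠ 0 := by positivity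
        field_simp
        ring
      rw [← hival, ← Real.norm_eq_abs]
      refine intervalIntegral.norm_integral_le_of_norm_le hx.1 ?_ ?_
      · refine Eventually.of_forall fun y hy => hb y ⟨hy.1.le, hy.2.trans hx.2⟩
      · exact Continuous.intervalIntegrable (by fun_prop) _ _
  have hunit : ∀ e, IsUnit (1 - T e) := fun e => by
    have ht := FloorSemiring.tendsto_pow_div_factorial_atTop (‖g e‖ * ‖ω e‖)
    obtain ⟨n, hn⟩ := (ht.eventually (gt_mem_nhds (by norm_num : (0:ℝ) < 1))).exists
    refine isUnit_one_sub_of_norm_pow_lt_one (R := UC →L[ℝ] UC) (n := n) (lt_of_le_of_lt ?_ hn)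
    refine ContinuousLinearMap.opNorm_le_bound _ (by positivity) fun f => ?_
    refine norm_le_of_ev (by positivity) fun x hx => (hbound e n f x hx).trans ?_
    gcongr
    calc (‖g e‖ * ‖ω e‖) ^ n * x ^ n ≤ (‖g e‖ * ‖ω e‖) ^ n * 1 := by
          gcongr; exact pow_le_one₀ hx.1 hx.2
      _ = _ := mul_one _
  let U : ℝ → UC := fun e => Ring.inverse (1 - T e) 1
  have hUc : Continuous U :=
    (continuous_inverse_of_isUnit (f := fun e => 1 - T e)
        (continuous_const.sub hTc) hunit).clm_apply
      continuous_const
  have hUeq : ∀ e, U e = 1 + T e (U e) := fun e => by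
    have h1 : ((1 - T e) * Ring.inverse (1 - T e)) 1 = (1 : UC) := by
      rw [Ring.mul_inverse_cancel _ (hunit e)]; rfl
    have h2 : U e - T e (U e) = 1 := h1
    rw [← h2]; abel
  refine ⟨U, fun e => g e * A (ω e * U e), hUc, hg.mul (A.continuous.comp (hω.mul hUc)),
    fun e x hx => ?_, fun e x hx => ?_⟩
  · conv_lhs => rw [hUeq e]
    rw [ev_add, ev_one, hT, hJ _ x hx]
  · rw [ev_mul, hA _ x hx]; rfl

end UC

/-- A `C¹` family of maps which is constant at parameter zero has fixed points nearby. -/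
lemma exists_fixedPoint_branch {Z : Type*} [NormedAddCommGroup Z] [NormedSpace ℝ Z]
    [CompleteSpace Z]
    {Φ : ℝ × Z → Z} {z₀ : Z} (hΦ : ContDiffAt ℝ 1 Φ (0, z₀)) (h0 : ∀ z, Φ (0, z) = z₀) :
    ∃ ζ : ℝ → Z, Tendsto ζ (nhds 0) (nhds z₀) ∧ ∀ᶠ δ in nhds (0:ℝ), Φ (δ, ζ δ) = ζ δ := by
  have hs := hΦ.hasStrictFDerivAt one_ne_zero
  set Φ' := fderiv ℝ Φ (0, z₀)
  have hz : ∀ dz : Z, Φ' (0, dz) = 0 := fun dz => by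
    have h1 : HasFDerivAt (fun z : Z => Φ (0, z)) (Φ'.comp (ContinuousLinearMap.inr ℝ ℝ Z)) z₀ :=
      hs.hasFDerivAt.comp z₀ (hasFDerivAt_prodMk_right (0:ℝ) z₀)
    have h2 : HasFDerivAt (fun z : Z => Φ (0, z)) (0 : Z →L[ℝ] Z) z₀ := by
      simp_rw [h0]; exact hasFDerivAt_const _ _
    have h3 := h1.unique h2
    have := congrArg (fun T : Z →L[ℝ] Z => T dz) h3
    simpa using this
  let G' : (ℝ × Z) ≃L[ℝ] (ℝ × Z) := ContinuousLinearEquiv.equivOfInverse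
    ((ContinuousLinearMap.fst ℝ ℝ Z).prod (ContinuousLinearMap.snd ℝ ℝ Z - Φ'))
    ((ContinuousLinearMap.fst ℝ ℝ Z).prod (ContinuousLinearMap.snd ℝ ℝ Z + Φ'))
    (fun p => by
      obtain ⟨d, y⟩ := p
      have : Φ' (d, y - Φ' (d, y)) = Φ' (d, y) := by
        have h : (d, y - Φ' (d, y)) = (d, y) - ((0:ℝ), Φ' (d, y)) := by simp
        rw [h, map_sub, hz, sub_zero]
      simp [this])
    (fun p => by
      obtain ⟨d, y⟩ := p
      have : Φ' (d, y + Φ' (d, y)) = Φ' (d, y) := by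
        have h : (d, y + Φ' (d, y)) = (d, y) + ((0:ℝ), Φ' (d, y)) := by simp
        rw [h, map_add, hz, add_zero]
      simp [this])
  have hG : HasStrictFDerivAt (fun p : ℝ × Z => (p.1, p.2 - Φ p)) (G' : (ℝ × Z) →L[ℝ] (ℝ × Z))
      (0, z₀) :=
    hasStrictFDerivAt_fst.prodMk (hasStrictFDerivAt_snd.sub hs)
  have hpt : ((0:ℝ), z₀ - Φ (0, z₀)) = (0, 0) := by rw [h0, sub_self]
  have hc : Tendsto (fun δ : ℝ => (δ, (0:Z))) (nhds 0) (nhds (0, z₀ - Φ (0, z₀))) := by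
    rw [hpt]; exact (continuous_id.prodMk continuous_const).tendsto' _ _ rfl
  have hcont := hG.localInverse_continuousAt.tendsto.comp hc
  rw [hG.localInverse_apply_image] at hcont
  refine ⟨fun δ => (hG.localInverse _ _ _ (δ, 0)).2, (continuous_snd.tendsto _).comp hcont, ?_⟩
  filter_upwards [hc.eventually hG.eventually_right_inverse] with δ hδ
  simp only [Prod.mk.injEq] at hδ
  have h2 := sub_eq_zero.mp hδ.2
  rw [Prod.mk.eta.symm.trans (congrArg (·, _) hδ.1)] at h2
  exact h2.symm

namespace UC

lemma exists_family {F : ℝ → ℝ → ℝ} (hF : Continuous fun p : ℝ × Icc (0:ℝ) 1 => F p.1 p.2) :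
    ∃ G : ℝ → UC, Continuous G ∧ ∀ e, ∀ x ∈ Icc (0:ℝ) 1, ev (G e) x = F e x :=
  ⟨fun e => ContinuousMap.curry ⟨fun p : ℝ × Icc (0:ℝ) 1 => F p.1 p.2, hF⟩ e,
    ContinuousMap.continuous _, fun e x hx => by rw [ev_of_mem _ hx]; rfl⟩

/-- Solutions of a singular linear equation regular at the left endpoint. -/
lemma exists_branch {a : ℝ} (ha : 0 ≤ a) {g c : ℝ → UC} (hg : Continuous g) (hc : Continuous c) :
    ∃ U V : ℝ → UC, ∃ P : ℝ → ℝ → ℝ, Continuous U ∧ Continuous V ∧ (∀ e, ev (U e) 0 = 1) ∧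
      (∀ e, ∀ t ∈ Ioo (0:ℝ) 1, HasDerivAt (ev (U e)) (ev (V e) t) t) ∧
      (∀ e, ∀ t ∈ Ioo (0:ℝ) 1, HasDerivAt (P e) (t ^ a * ev (c e) t * ev (U e) t) t) ∧
      ∀ e, ∀ t ∈ Ioo (0:ℝ) 1, t ^ (a + 1) * ev (V e) t = ev (g e) t * P e t := by
  have hw : Continuous fun τ : ℝ => τ ^ a := Real.continuous_rpow_const ha
  obtain ⟨U, V, hU, hV, h1, h2⟩ := exists_volterra hw (fun τ hτ => by
    rw [abs_of_nonneg (rpow_nonneg hτ.1 _)]; exact rpow_le_one hτ.1 hτ.2 ha) hg hc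
  have hcont : ∀ e, Continuous fun s : ℝ => s ^ a * ev (c e) s * ev (U e) s := fun e =>
    (hw.mul (continuous_ev _)).mul (continuous_ev _)
  refine ⟨U, V, fun e t => ∫ s in (0:ℝ)..t, s ^ a * ev (c e) s * ev (U e) s, hU, hV,
    fun e => ?_, fun e t ht => ?_, fun e t ht => ?_, fun e t ht => ?_⟩
  · rw [h1 e 0 (by simp)]; simp
  · have hd : HasDerivAt (fun x => 1 + ∫ y in (0:ℝ)..x, ev (V e) y) (ev (V e) t) t :=
      (intervalIntegral.integral_hasDerivAt_right ((continuous_ev _).intervalIntegrable _ _)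
        ((continuous_ev _).stronglyMeasurableAtFilter _ _)
            (continuous_ev _).continuousAt).const_add _
    refine hd.congr_of_eventuallyEq ?_
    filter_upwards [Ioo_mem_nhds ht.1 ht.2] with x hx
    exact h1 e x ⟨hx.1.le, hx.2.le⟩
  · exact intervalIntegral.integral_hasDerivAt_right ((hcont e).intervalIntegrable _ _)
        ((hcont e).stronglyMeasurableAtFilter _ _) (hcont e).continuousAt
  · rw [h2 e t ⟨ht.1.le, ht.2.le⟩]
    have h3 := intervalIntegral.mul_integral_comp_mul_right (a := 0) (b := 1)
        (f := fun s => s ^ a * ev (c e) s * ev (U e) s) t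
    rw [zero_mul, one_mul] at h3
    beta_reduce
    rw [← h3, rpow_add_one ht.1.ne']
    have h4 : (∫ τ in (0:ℝ)..1, (τ * t) ^ a * ev (c e) (τ * t) * ev (U e) (τ * t))
        = t ^ a * ∫ τ in (0:ℝ)..1, τ ^ a * (ev (c e) (τ * t) * ev (U e) (τ * t)) := by
      rw [← intervalIntegral.integral_const_mul]
      refine intervalIntegral.integral_congr fun τ hτ => ?_
      rw [uIcc_of_le zero_le_one] at hτ
      rw [mul_rpow hτ.1 ht.1.le]; ring
    rw [h4]; ring

lemma no_double_zero {a : ℝ} (ha : 0 ≤ a) {g c U V : UC} {P : ℝ → ℝ} (h0 : ev U 0 = 1)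
    (hU : ∀ t ∈ Ioo (0:ℝ) 1, HasDerivAt (ev U) (ev V t) t)
    (hP : ∀ t ∈ Ioo (0:ℝ) 1, HasDerivAt P (t ^ a * ev c t * ev U t) t)
    (hVP : ∀ t ∈ Ioo (0:ℝ) 1, t ^ (a + 1) * ev V t = ev g t * P t)
    {t₀ : ℝ} (ht₀ : t₀ ∈ Ioo (0:ℝ) 1) (hg : ev g t₀ ≠ 0) (hU0 : ev U t₀ = 0) : ev V t₀ ≠ 0 := by
  intro hV0
  have hP0 : P t₀ = 0 := by
    have := hVP t₀ ht₀
    rw [hV0, mul_zero] at this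
    exact (mul_eq_zero.mp this.symm).resolve_left hg
  have key : ∀ η ∈ Ioo (0:ℝ) t₀, ev U η = 0 := by
    intro η hη
    set K : ℝ := ‖g‖ / η ^ (a + 1) + ‖c‖
    have hmono : MonotoneOn (fun t => (ev U t ^ 2 + P t ^ 2) * exp (K * t)) (Icc η t₀) := by
      have hsub : ∀ t ∈ Icc η t₀, t ∈ Ioo (0:ℝ) 1 := fun t ht =>
        ⟨hη.1.trans_le ht.1, ht.2.trans_lt ht₀.2⟩
      have hd : ∀ t ∈ Icc η t₀, HasDerivAt (fun t => (ev U t ^ 2 + P t ^ 2) * exp (K * t))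
          ((2 * ev U t * ev V t + 2 * P t * (t ^ a * ev c t * ev U t)) * exp (K * t)
            + (ev U t ^ 2 + P t ^ 2) * (exp (K * t) * K)) t := fun t ht => by
        have h1 := ((hU t (hsub t ht)).pow 2).add ((hP t (hsub t ht)).pow 2)
        have h2 : HasDerivAt (fun t => exp (K * t)) (exp (K * t) * K) t := by
          simpa using ((hasDerivAt_id t).const_mul K).exp
        refine (h1.mul h2).congr_deriv ?_
        simp
      refine monotoneOn_of_deriv_nonneg
          (convex_Icc _ _) (fun t ht => (hd t ht).continuousAt.continuousWithinAt)
        (fun t ht => (hd t (interior_subset ht)).differentiableAt.differentiableWithinAt) fun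
            t ht => ?_
      have ht := interior_subset ht
      rw [(hd t ht).deriv]
      have hmem := hsub t ht
      have hpow : 0 < t ^ (a + 1) := rpow_pos_of_pos hmem.1 _
      have hη' : 0 < η ^ (a + 1) := rpow_pos_of_pos hη.1 _
      have hV : ev V t = ev g t / t ^ (a + 1) * P t := by
        have := hVP t hmem
        field_simp; linarith
      set A := ev g t / t ^ (a + 1)
      set B := t ^ a * ev c t
      have hA : |A| ≤ ‖g‖ / η ^ (a + 1) := by
        rw [abs_div, abs_of_pos hpow]
        have h1 : η ^ (a + 1) ≤ t ^ (a + 1) := rpow_le_rpow hη.1.le ht.1 (by linarith)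
        have := abs_ev_le g t
        gcongr
      have hB : |B| ≤ ‖c‖ := by
        rw [abs_mul, abs_of_nonneg (rpow_nonneg hmem.1.le _)]
        calc t ^ a * |ev c t| ≤ 1 * ‖c‖ := by
              gcongr
              · exact rpow_le_one hmem.1.le hmem.2.le ha
              · exact abs_ev_le _ _
          _ = _ := one_mul _
      have hAB : |A + B| ≤ K := (abs_add_le _ _).trans (add_le_add hA hB)
      have hAB' := abs_le.mp hAB
      rw [hV]
      have : 0 ≤ ((A + B) * (2 * ev U t * P t) + (ev U t ^ 2 + P t ^ 2) * K) := by
        nlinarith [mul_nonneg (by linarith : 0 ≤ K - (A + B)) (sq_nonneg (ev U t - P t)),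
          mul_nonneg (by linarith : 0 ≤ K + (A + B)) (sq_nonneg (ev U t + P t))]
      calc 0 ≤ ((A + B) * (2 * ev U t * P t) + (ev U t ^ 2 + P t ^ 2) * K) * exp (K * t) := by positivity
        _ = _ := by ring
    have h1 := hmono (left_mem_Icc.mpr hη.2.le) (right_mem_Icc.mpr hη.2.le) hη.2.le
    simp only [hU0, hP0] at h1
    have h2 : ev U η ^ 2 + P η ^ 2 ≤ 0 := by
      by_contra h; push Not at h
      have := mul_pos h (exp_pos (K * η))
      norm_num at h1; linarith
    nlinarith [sq_nonneg (ev U η), sq_nonneg (P η)]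
  have hlim : Tendsto (ev U) (nhdsWithin 0 (Ioi 0)) (nhds 1) := by
    rw [← h0]; exact (continuous_ev U).continuousAt.continuousWithinAt
  have hlim0 : Tendsto (ev U) (nhdsWithin 0 (Ioi 0)) (nhds 0) := by
    refine tendsto_const_nhds.congr' ?_
    filter_upwards [Ioo_mem_nhdsGT ht₀.1] with η hη using (key η hη).symm
  exact one_ne_zero (tendsto_nhds_unique hlim hlim0)

lemma pos_or_zero_end {U V : UC} (h0 : ev U 0 = 1)
    (hU : ∀ t ∈ Ioo (0:ℝ) 1, HasDerivAt (ev U) (ev V t) t)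
    (hnd : ∀ t ∈ Ioc (0:ℝ) (1/2), ev U t = 0 → ev V t ≠ 0)
        (hnn : ∀ t ∈ Icc (0:ℝ) (1/2), 0 ≤ ev U t) :
    (∀ t ∈ Icc (0:ℝ) (1/2), 0 < ev U t) ∨ (ev U (1/2) = 0 ∧ ev V (1/2) < 0) := by
  by_cases hpos : ∀ t ∈ Icc (0:ℝ) (1/2), 0 < ev U t
  · exact Or.inl hpos
  right
  push Not at hpos
  obtain ⟨t, ht, htle⟩ := hpos
  have hz : ev U t = 0 := le_antisymm htle (hnn t ht)
  have ht0 : 0 < t := by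
    rcases ht.1.eq_or_lt with h | h
    · rw [← h, h0] at hz; norm_num at hz
    · exact h
  rcases ht.2.lt_or_eq with hlt | rfl
  · exfalso
    have hmin : IsLocalMin (ev U) t := by
      filter_upwards [Ioo_mem_nhds ht0 hlt] with s hs
      rw [hz]; exact hnn s ⟨hs.1.le, hs.2.le⟩
    exact hnd t ⟨ht0, hlt.le⟩ hz (hmin.hasDerivAt_eq_zero (hU t ⟨ht0, by linarith⟩))
  · refine ⟨hz, lt_of_le_of_ne ?_ (hnd _ ⟨ht0, le_rfl⟩ hz)⟩
    have h1 := (hasDerivAt_iff_tendsto_slope.mp (hU (1/2) (by norm_num))).mono_left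
      (nhdsWithin_mono _ (fun y (hy : y ∈ Iio (1/2:ℝ)) => ne_of_lt hy))
    refine le_of_tendsto h1 ?_
    filter_upwards [Ioo_mem_nhdsLT (a := 0) (b := (1/2:ℝ)) (by norm_num)] with s hs
    rw [slope_def_field, hz, sub_zero]
    exact div_nonpos_of_nonneg_of_nonpos (hnn s ⟨hs.1.le, hs.2.le⟩) (by linarith [hs.2])

lemma isOpen_pos {U : ℝ → UC} (hU : Continuous U) :
    IsOpen {e | ∀ t ∈ Icc (0:ℝ) (1/2), 0 < ev (U e) t} := by
  have hK : IsCompact {z : Icc (0:ℝ) 1 | (z:ℝ) ≤ 1/2} :=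
    (isClosed_le continuous_subtype_val continuous_const).isCompact
  have h := (ContinuousMap.isOpen_setOfPred_mapsTo (Y := ℝ) hK
      (isOpen_Ioi (a := (0:ℝ)))).preimage hU
  convert h using 1
  ext e
  constructor
  · intro h z hz
    have := h z ⟨z.2.1, hz⟩
    rwa [ev_of_mem _ z.2] at this
  · intro h t ht
    have hm : t ∈ Icc (0:ℝ) 1 := ⟨ht.1, ht.2.trans (by norm_num)⟩
    rw [ev_of_mem _ hm]
    exact h (x := ⟨t, hm⟩) ht.2

/-- Two-sided shooting: two families of solutions can be matched at the midpoint while staying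
positive. -/
lemma exists_matching {U V U' V' : ℝ → UC} (hU : Continuous U) (hV : Continuous V)
    (hU' : Continuous U') (hV' : Continuous V')
    (h0 : ∀ e, ev (U e) 0 = 1) (h0' : ∀ e, ev (U' e) 0 = 1)
    (hd : ∀ e, ∀ t ∈ Ioo (0:ℝ) 1, HasDerivAt (ev (U e)) (ev (V e) t) t)
    (hd' : ∀ e, ∀ t ∈ Ioo (0:ℝ) 1, HasDerivAt (ev (U' e)) (ev (V' e) t) t)
    (hnd : ∀ e, ∀ t ∈ Ioc (0:ℝ) (1/2), ev (U e) t = 0 → ev (V e) t ≠ 0)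
    (hnd' : ∀ e, ∀ t ∈ Ioc (0:ℝ) (1/2), ev (U' e) t = 0 → ev (V' e) t ≠ 0)
    {b : ℝ} (hb : 0 < b)
    (hg : ∀ t ∈ Icc (0:ℝ) (1/2), 0 < ev (U 0) t) (hg' : ∀ t ∈ Icc (0:ℝ) (1/2), 0 < ev (U' 0) t)
    (hw : 0 < ev (V 0) (1/2) * ev (U' 0) (1/2) + ev (V' 0) (1/2) * ev (U 0) (1/2))
    (hbad : ¬ ∀ t ∈ Icc (0:ℝ) (1/2), 0 < ev (U b) t) :
    ∃ s ∈ Ioc 0 b, (∀ t ∈ Icc (0:ℝ) (1/2), 0 < ev (U s) t) ∧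
        (∀ t ∈ Icc (0:ℝ) (1/2), 0 < ev (U' s) t) ∧
      ev (V s) (1/2) * ev (U' s) (1/2) + ev (V' s) (1/2) * ev (U s) (1/2) = 0 := by
  have hev : ∀ {F : ℝ → UC}, Continuous F → ∀ t, Continuous fun e => ev (F e) t := fun hF t =>
    (evL t).continuous.comp hF
  set w : ℝ → ℝ := fun e => ev (V e) (1/2) * ev (U' e) (1/2) + ev (V' e) (1/2) * ev (U e) (1/2)
  have hwc : Continuous w := ((hev hV _).mul (hev hU' _)).add ((hev hV' _).mul (hev hU _))
  set G : Set ℝ := {e | ∀ t ∈ Icc (0:ℝ) (1/2), 0 < ev (U e) t} ∩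
    ({e | ∀ t ∈ Icc (0:ℝ) (1/2), 0 < ev (U' e) t} ∩ {e | 0 < w e})
  have hG : IsOpen G :=
    (isOpen_pos hU).inter ((isOpen_pos hU').inter (isOpen_lt continuous_const hwc))
  set S := Icc 0 b ∩ Gᶜ
  have hS : IsClosed S := isClosed_Icc.inter hG.isClosed_compl
  have hbS : b ∈ S := ⟨⟨hb.le, le_rfl⟩, fun h => hbad h.1⟩
  have hbdd : BddBelow S := ⟨0, fun e he => he.1.1⟩
  have hsS := hS.csInf_mem ⟨b, hbS⟩ hbdd
  set s := sInf S
  have hs0 : 0 < s := by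
    rcases hsS.1.1.eq_or_lt with h | h
    · exact absurd ⟨hg, hg', hw⟩ (h ▸ hsS.2)
    · exact h
  have hlt : ∀ e ∈ Ico 0 s, e ∈ G := fun e he => by
    by_contra h
    exact absurd (csInf_le hbdd ⟨⟨he.1, (he.2.trans_le hsS.1.2).le⟩, h⟩) (not_le.mpr he.2)
  have hev' : ∀ᶠ e in nhdsWithin s (Iio s), e ∈ G := by
    filter_upwards [Ico_mem_nhdsLT hs0] with e he using hlt e he
  have hlim : ∀ {F : ℝ → ℝ}, Continuous F → (∀ e ∈ G, 0 ≤ F e) → 0 ≤ F s := fun hF h =>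
    ge_of_tendsto (hF.continuousAt.continuousWithinAt (s := Iio s)) (hev'.mono h)
  have hUn : ∀ t ∈ Icc (0:ℝ) (1/2), 0 ≤ ev (U s) t := fun t ht => hlim (hev hU t) fun e he =>
    (he.1 t ht).le
  have hUn' : ∀ t ∈ Icc (0:ℝ) (1/2), 0 ≤ ev (U' s) t := fun t ht =>
    hlim (hev hU' t) fun e he => (he.2.1 t ht).le
  have hwn : 0 ≤ w s := hlim hwc fun e he => le_of_lt he.2.2
  have hhalf : (1/2:ℝ) ∈ Icc (0:ℝ) (1/2) := by norm_num
  rcases pos_or_zero_end (h0 s) (hd s) (hnd s) hUn with hp | ⟨hz, hv⟩ <;>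
  rcases pos_or_zero_end (h0' s) (hd' s) (hnd' s) hUn' with hp' | ⟨hz', hv'⟩
  · refine ⟨s, ⟨hs0, hsS.1.2⟩, hp, hp', le_antisymm ?_ hwn⟩
    by_contra h
    exact hsS.2 ⟨hp, hp', not_le.mp h⟩
  · have h1 := hp _ hhalf
    simp only [w, hz', mul_zero, zero_add] at hwn
    nlinarith
  · have h1 := hp' _ hhalf
    simp only [w, hz, mul_zero, add_zero] at hwn
    nlinarith
  · exfalso
    have e1 : ∀ᶠ e in nhdsWithin s (Iio s), ev (V e) (1/2) < 0 :=
      ((hev hV _).continuousAt.eventually (gt_mem_nhds hv)).filter_mono nhdsWithin_le_nhds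
    have e2 : ∀ᶠ e in nhdsWithin s (Iio s), ev (V' e) (1/2) < 0 :=
      ((hev hV' _).continuousAt.eventually (gt_mem_nhds hv')).filter_mono nhdsWithin_le_nhds
    obtain ⟨e, he, h1, h2⟩ := (hev'.and (e1.and e2)).exists
    have h3 := he.1 _ hhalf
    have h4 := he.2.1 _ hhalf
    have h5 : 0 < w e := he.2.2
    simp only [w] at h5
    nlinarith

end UC

/-- The Reissner–Nordström–AdS horizon polynomial: in the variable `x = r_+/r`, the metric
function is `x⁻² (1 - x) hPoly L e x`. -/
def hPoly (L e x : ℝ) : ℝ := L + L * x + (1 + L) * x ^ 2 - e ^ 2 * x ^ 3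

lemma hPoly_pos {L e x : ℝ} (hL : 0 < L) (he : e ^ 2 < 1 + 3 * L) (hx : x ∈ Icc (0:ℝ) 1) :
    0 < hPoly L e x := by
  obtain ⟨h0, h1⟩ := hx
  have h2 : x ^ 2 ≤ 1 := pow_le_one₀ h0 h1
  have h3 : x ^ 3 ≤ x ^ 2 := pow_le_pow_of_le_one h0 h1 (by norm_num)
  have h4 : x ^ 3 ≤ x := by nlinarith [pow_nonneg h0 3]
  have h5 : 0 ≤ x ^ 3 := by positivity
  unfold hPoly
  rcases h5.eq_or_lt with h | h
  · rw [← h]; nlinarith [mul_nonneg hL.le h0, mul_nonneg hL.le (sq_nonneg x), sq_nonneg x]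
  · nlinarith [mul_pos (sub_pos.mpr he) h, mul_nonneg hL.le (sub_nonneg.mpr h3),
      mul_nonneg hL.le (sub_nonneg.mpr h4), mul_nonneg hL.le (by linarith : 0 ≤ 1 - x ^ 3)]

lemma hPoly_le {L e x : ℝ} (hL : 0 < L) (hx : x ∈ Icc (0:ℝ) 1) : hPoly L e x ≤ 1 + 3 * L := by
  obtain ⟨h0, h1⟩ := hx
  have h2 : x ^ 2 ≤ 1 := pow_le_one₀ h0 h1
  have h5 : 0 ≤ e ^ 2 * x ^ 3 := by positivity
  unfold hPoly
  nlinarith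

/-- Zeroth-order coefficient of the linear Klein–Gordon equation after removing the factor `x ^ σ`. -/
def kgCoeff (L α σ q e x : ℝ) : ℝ :=
  -α * (1 - (1 + L + e ^ 2) * x + e ^ 2 * x ^ 2) - q * (1 - x) * e ^ 2 / hPoly L e x
    - σ * (2 - 3 * (1 + L + e ^ 2) * x + 4 * e ^ 2 * x ^ 2)

/-- `x ^ σ * h` solves the linear charged Klein–Gordon equation on `I`, with weighted derivative
`p` of `h`. -/
def IsBranch (L α D σ q e : ℝ) (h hx p : ℝ → ℝ) (I : Set ℝ) : Prop :=
  ∀ x ∈ I, HasDerivAt h (hx x) x ∧ HasDerivAt p (x ^ (1 + D) * kgCoeff L α σ q e x * h x) x ∧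
    p x = x ^ (1 + D) * ((1 - x) * hPoly L e x) * hx x

/-- The pair (field, flux) solves the linear charged Klein–Gordon equation at `x`. -/
def IsWave (L α q e : ℝ) (W P : ℝ → ℝ) (x : ℝ) : Prop :=
  HasDerivAt W (x ^ 2 * P x / ((1 - x) * hPoly L e x)) x ∧
  HasDerivAt P ((L * α - q * x ^ 2 * (1 - x) * e ^ 2 / hPoly L e x) / x ^ 4 * W x) x

section
variable {L α D σ q e : ℝ} {h hx p : ℝ → ℝ} {I : Set ℝ}

lemma IsBranch.mono (hB : IsBranch L α D σ q e h hx p I) {J : Set ℝ} (hJ : J ⊆ I) :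
    IsBranch L α D σ q e h hx p J := fun x hx' => hB x (hJ hx')

lemma IsBranch.isWave (hL : 0 < L) (he : e ^ 2 < 1 + 3 * L) (hσ : 2 * σ = 3 + D)
    (hσα : σ * (σ - 3) = α)
    (hI : I ⊆ Ioo 0 1) (hB : IsBranch L α D σ q e h hx p I) {x : ℝ} (hxI : x ∈ I) :
    IsWave L α q e (fun x => x ^ σ * h x)
      (fun x => σ * x ^ (σ - 3) * ((1 - x) * hPoly L e x) * h x + x ^ (-σ) * p x) x := by
  obtain ⟨hx0, hx1⟩ := hI hxI
  obtain ⟨h1, h2, h3⟩ := hB x hxI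
  have hn := hPoly_pos hL he ⟨hx0.le, hx1.le⟩
  have hn0 := hn.ne'
  have hx0' := hx0.ne'
  have hx1' : 1 - x ≠ 0 := by linarith
  have e1 : x ^ (1 + D) = x ^ σ * x ^ σ / x ^ 2 := by
    rw [← rpow_add hx0, ← rpow_natCast x 2, ← rpow_sub hx0]; congr 1; push_cast; linarith
  have e2 : x ^ (-σ) = (x ^ σ)⁻¹ := rpow_neg hx0.le _
  have e3 : x ^ (σ - 3) = x ^ σ / x ^ 3 := by
    rw [← rpow_natCast x 3, ← rpow_sub hx0]; norm_num
  have e4 : x ^ (σ - 1) = x ^ σ / x := by rw [rpow_sub_one hx0']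
  have e5 : x ^ (σ - 3 - 1) = x ^ σ / x ^ 4 := by
    rw [← rpow_natCast x 4, ← rpow_sub hx0]; norm_num; congr 1; ring
  have e6 : x ^ (-σ - 1) = (x ^ σ)⁻¹ / x := by rw [rpow_sub_one hx0', e2]
  have hy : x ^ σ ≠ 0 := (rpow_pos_of_pos hx0 _).ne'
  have hf : HasDerivAt (fun x => (1 - x) * hPoly L e x)
      (2 * x - 3 * (1 + L + e ^ 2) * x ^ 2 + 4 * e ^ 2 * x ^ 3) x := by
    have h0 : (fun x => (1 - x) * hPoly L e x) =
        fun x => L + x ^ 2 - (1 + L + e ^ 2) * x ^ 3 + e ^ 2 * x ^ 4 := by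
      ext x; unfold hPoly; ring
    rw [h0]
    have := ((((hasDerivAt_id x).pow 2).const_add L).sub
      (((hasDerivAt_id x).pow 3).const_mul (1 + L + e ^ 2))).add
          (((hasDerivAt_id x).pow 4).const_mul (e ^ 2))
    refine this.congr_deriv ?_
    simp; ring
  have d1 : HasDerivAt (fun x : ℝ => x ^ σ) (σ * x ^ (σ - 1)) x :=
    Real.hasDerivAt_rpow_const (Or.inl hx0')
  have d2 : HasDerivAt (fun x : ℝ => x ^ (σ - 3)) ((σ - 3) * x ^ (σ - 3 - 1)) x :=
    Real.hasDerivAt_rpow_const (Or.inl hx0')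
  have d3 : HasDerivAt (fun x : ℝ => x ^ (-σ)) (-σ * x ^ (-σ - 1)) x :=
    Real.hasDerivAt_rpow_const (Or.inl hx0')
  constructor
  · refine (d1.mul h1).congr_deriv ?_
    simp only [h3, e1, e2, e3, e4]
    field_simp
  · refine ((((d2.const_mul σ).mul hf).mul h1).add (d3.mul h2)).congr_deriv ?_
    simp only [Pi.mul_apply, h3, e1, e2, e3, e5, e6, kgCoeff]
    set y := x ^ σ
    have hq : q * (1 - x) * e ^ 2 / hPoly L e x =
        (q * x ^ 2 * (1 - x) * e ^ 2 / hPoly L e x) / x ^ 2 := by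
      field_simp
    rw [hq]
    set z := q * x ^ 2 * (1 - x) * e ^ 2 / hPoly L e x
    rw [← hσα]
    unfold hPoly
    field_simp
    ring

end

section
variable {L α D σ q e : ℝ} {h hx p W P : ℝ → ℝ}

/-- Monotone quantity encoding the Hardy inequality at zero charge. -/
lemma hardy_strictMonoOn {l r : ℝ} (hL : 0 < L) (hα : -(9/4) < α) (hl : 0 ≤ l) (hr : r ≤ 1)
    (hw : ∀ x ∈ Ioo l r, IsWave L α q 0 W P x) (hz : ∀ x ∈ Ioo l r, W x = 0 → P x ≠ 0) :
    StrictMonoOn (fun x => W x * P x - 3 / 2 * L * ((x ^ 3)⁻¹ - 1) * W x ^ 2) (Ioo l r) := by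
  have hd : ∀ x ∈ Ioo l r, HasDerivAt (fun x => W x * P x - 3 / 2 * L * ((x ^ 3)⁻¹ - 1) * W x ^ 2)
      (x ^ 2 / ((1 - x) * hPoly L 0 x) * (P x - 3 / 2 * L * ((x ^ 3)⁻¹ - 1) * W x) ^ 2
        + W x ^ 2 * (L * (α + 9 / 2) / x ^ 4 -
          x ^ 2 / ((1 - x) * hPoly L 0 x) * (9 / 4 * L ^ 2 * ((x ^ 3)⁻¹ - 1) ^ 2))) x :=
            fun x hx => by
    obtain ⟨h1, h2⟩ := hw x hx
    have hx0 : 0 < x := hl.trans_lt hx.1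
    have hx1 : x < 1 := hx.2.trans_le hr
    have hn := (hPoly_pos (e := 0) hL (by nlinarith) ⟨hx0.le, hx1.le⟩).ne'
    have h3 : HasDerivAt (fun x : ℝ => (x ^ 3)⁻¹) (-(3 * x ^ 2) / (x ^ 3) ^ 2) x := by
      have := (hasDerivAt_pow 3 x).fun_inv (pow_ne_zero 3 hx0.ne')
      norm_num at this ⊢
      exact this
    refine ((h1.mul h2).sub
        (((h3.sub_const 1).const_mul (3 / 2 * L)).mul (h1.pow 2))).congr_deriv ?_
    have hx1' : 1 - x ≠ 0 := by linarith
    have hx0' := hx0.ne'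
    simp
    field_simp
    ring
  refine strictMonoOn_of_deriv_pos
      (convex_Ioo _ _) (fun x hx => (hd x hx).continuousAt.continuousWithinAt)
    fun x hx => ?_
  have hx := interior_subset hx
  have hx0 : 0 < x := hl.trans_lt hx.1
  have hx1 : x < 1 := hx.2.trans_le hr
  have hn := hPoly_pos (e := 0) hL (by nlinarith) ⟨hx0.le, hx1.le⟩
  rw [(hd x hx).deriv]
  have h1x : 0 < 1 - x := by linarith
  have hx3 : 0 < 1 - x ^ 3 := by nlinarith [pow_lt_one₀ hx0.le hx1 (by norm_num : (3:ℕ) ≠ 0)]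
  have hf : L * (1 - x ^ 3) ≤ (1 - x) * hPoly L 0 x := by
    have : (1 - x) * hPoly L 0 x - L * (1 - x ^ 3) = x ^ 2 * (1 - x) := by unfold hPoly; ring
    nlinarith [mul_pos (pow_pos hx0 2) h1x]
  have hc : 0 < L * (α + 9 / 2) / x ^ 4 -
      x ^ 2 / ((1 - x) * hPoly L 0 x) * (9 / 4 * L ^ 2 * ((x ^ 3)⁻¹ - 1) ^ 2) := by
    have e1 : L * (α + 9 / 2) / x ^ 4 - x ^ 2 / ((1 - x) * hPoly L 0 x) *
        (9 / 4 * L ^ 2 * ((x ^ 3)⁻¹ - 1) ^ 2)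
        = L / (x ^ 4 * ((1 - x) * hPoly L 0 x)) * ((α + 9 / 2) * ((1 - x) * hPoly L 0 x)
          - 9 / 4 * L * (1 - x ^ 3) ^ 2) := by field_simp
    rw [e1]
    have h2 : 0 < L * (1 - x ^ 3) := by positivity
    have h3 : 9 / 4 * L * (1 - x ^ 3) ^ 2 ≤ 9 / 4 * (L * (1 - x ^ 3)) := by
      nlinarith [pow_pos hx0 3]
    have h4 : 9 / 4 * (L * (1 - x ^ 3)) < (α + 9 / 2) * ((1 - x) * hPoly L 0 x) := by nlinarith
    have : 0 < (α + 9 / 2) * ((1 - x) * hPoly L 0 x) - 9 / 4 * L * (1 - x ^ 3) ^ 2 := by linarith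
    positivity
  by_cases hW : W x = 0
  · have := hz x hx hW
    rw [hW]
    have : 0 < x ^ 2 / ((1 - x) * hPoly L 0 x) * (P x) ^ 2 := by positivity
    simpa using this
  · have h5 : 0 < W x ^ 2 := by positivity
    have h6 : 0 ≤ x ^ 2 / ((1 - x) * hPoly L 0 x) * (P x - 3 / 2 * L * ((x ^ 3)⁻¹ - 1) * W x) ^ 2 :=
      by positivity
    linarith [mul_pos h5 hc]

/-- A positive solution on the outer region obstructs large scalar charge. -/
lemma charge_bound_of_pos (hL : 0 < L) (hα : α < 0) (he : e ^ 2 < 1 + 3 * L) (hq : 0 ≤ q)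
    (hw : ∀ x ∈ Icc (1/4:ℝ) (1/2), IsWave L α q e W P x) (hpos : ∀ x ∈ Icc (1/4:ℝ) (1/2), 0 < W x) :
    q * e ^ 2 ≤ 3840 * (1 + 3 * L) ^ 2 := by
  set B : ℝ := 1 + 3 * L
  have hB : 0 < B := by positivity
  set k : ℝ := 2 * q * e ^ 2 / B
  have hd : ∀ x ∈ Icc (1/4:ℝ) (1/2),
      HasDerivAt (fun x : ℝ => ((x - 1/4) * (1/2 - x)) ^ 2 * (P x / W x) - B * x
      + k * ((x - 1/4) ^ 3 / 48 - (x - 1/4) ^ 4 / 8 + (x - 1/4) ^ 5 / 5))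
      (2 * ((x - 1/4) * (1/2 - x)) * (3/4 - 2 * x) * (P x / W x) + ((x - 1/4) * (1/2 - x)) ^ 2 *
        ((L * α - q * x ^ 2 * (1 - x) * e ^ 2 / hPoly L e x) / x ^ 4
          - x ^ 2 / ((1 - x) * hPoly L e x) * (P x / W x) ^ 2) - B
        + k * ((x - 1/4) * (1/2 - x)) ^ 2) x := fun x hx => by
    obtain ⟨h1, h2⟩ := hw x hx
    have hW := (hpos x hx).ne'
    have hn := (hPoly_pos hL he ⟨by linarith [hx.1], by linarith [hx.2]⟩ : 0 < hPoly L e x).ne'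
    have hy : HasDerivAt (fun x : ℝ => x - 1/4) 1 x := (hasDerivAt_id x).sub_const _
    have hy' : HasDerivAt (fun x : ℝ => 1/2 - x) (-1) x := (hasDerivAt_id x).const_sub _
    refine (((((hy.mul hy').pow 2).mul (h2.div h1 hW)).sub ((hasDerivAt_id x).const_mul B)).add
      (((((hy.pow 3).div_const 48).sub ((hy.pow 4).div_const 8)).add
          ((hy.pow 5).div_const 5)).const_mul k)).congr_deriv ?_
    have hx1' : 1 - x ≠ 0 := by linarith [hx.2]
    have hx0' : x ≠ 0 := by linarith [hx.1]
    simp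
    field_simp
    ring
  have hanti : AntitoneOn (fun x : ℝ => ((x - 1/4) * (1/2 - x)) ^ 2 * (P x / W x) - B * x
      + k * ((x - 1/4) ^ 3 / 48 - (x - 1/4) ^ 4 / 8 + (x - 1/4) ^ 5 / 5)) (Icc (1/4) (1/2)) := by
    refine antitoneOn_of_deriv_nonpos
        (convex_Icc _ _) (fun x hx => (hd x hx).continuousAt.continuousWithinAt)
      (fun x hx => (hd x (interior_subset hx)).differentiableAt.differentiableWithinAt) fun
          x hx => ?_
    have hx := interior_subset hx
    rw [(hd x hx).deriv]
    obtain ⟨hxa, hxb⟩ := hx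
    have hx0 : 0 < x := by linarith
    have h1x : 0 < 1 - x := by linarith
    have hn := hPoly_pos hL he ⟨hx0.le, by linarith⟩
    have hnB := hPoly_le (e := e) hL ⟨hx0.le, (by linarith : x ≤ 1)⟩
    set n := hPoly L e x
    set χ := (x - 1/4) * (1/2 - x)
    set y := P x / W x
    set f := (1 - x) * n
    have hf : 0 < f := by positivity
    have hfB : f ≤ B := by nlinarith
    have h1 : 2 * χ * (3/4 - 2 * x) * y ≤
        (3/4 - 2 * x) ^ 2 * (f / x ^ 2) + χ ^ 2 * (x ^ 2 / f * y ^ 2) := by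
      have e1 : (3/4 - 2 * x) ^ 2 * (f / x ^ 2) + χ ^ 2 * (x ^ 2 / f * y ^ 2) - 2 * χ *
          (3/4 - 2 * x) * y
          = f / x ^ 2 * ((3/4 - 2 * x) - χ * y * x ^ 2 / f) ^ 2 := by field_simp; ring
      have : 0 ≤ f / x ^ 2 * ((3/4 - 2 * x) - χ * y * x ^ 2 / f) ^ 2 := by positivity
      linarith
    have h2 : (3/4 - 2 * x) ^ 2 * (f / x ^ 2) ≤ B := by
      have h3 : (3/4 - 2 * x) ^ 2 ≤ x ^ 2 := by nlinarith
      calc (3/4 - 2 * x) ^ 2 * (f / x ^ 2) ≤ x ^ 2 * (f / x ^ 2) := by gcongr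
        _ = f := by field_simp
        _ ≤ B := hfB
    have h4 : (L * α - q * x ^ 2 * (1 - x) * e ^ 2 / n) / x ^ 4 ≤ -k := by
      have h5 : k ≤ q * x ^ 2 * (1 - x) * e ^ 2 / n / x ^ 4 := by
        have h6 : q * x ^ 2 * (1 - x) * e ^ 2 / n / x ^ 4 = q * e ^ 2 * ((1 - x) / x ^ 2) / n := by
          field_simp
        have h7 : 2 ≤ (1 - x) / x ^ 2 := by rw [le_div_iff₀ (by positivity)]; nlinarith
        rw [h6]
        calc k = q * e ^ 2 * 2 / B := by simp only [k]; ring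
          _ ≤ q * e ^ 2 * ((1 - x) / x ^ 2) / n := by gcongr
      have h8 : L * α / x ^ 4 ≤ 0 := div_nonpos_of_nonpos_of_nonneg (by nlinarith) (by positivity)
      rw [sub_div]; linarith
    nlinarith [mul_le_mul_of_nonneg_left h4 (sq_nonneg χ)]
  have h1 := hanti (left_mem_Icc.mpr
      (by norm_num)) (right_mem_Icc.mpr (by norm_num)) (by norm_num : (1/4:ℝ) ≤ 1/2)
  norm_num at h1
  have h2 : k ≤ 7680 * B := by linarith
  simp only [k] at h2
  rw [div_le_iff₀ hB] at h2
  nlinarith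
end

lemma hasDerivAt_ite {A B A' B' : ℝ → ℝ} {c x : ℝ} (hA : x ≤ c → HasDerivAt A (A' x) x)
    (hB : c ≤ x → HasDerivAt B (B' x) x) (h : A c = B c) (h' : A' c = B' c) :
    HasDerivAt (fun y => if y ≤ c then A y else B y) (if x ≤ c then A' x else B' x) x := by
  rcases lt_trichotomy x c with hlt | rfl | hgt
  · rw [if_pos hlt.le]
    refine (hA hlt.le).congr_of_eventuallyEq ?_
    filter_upwards [Iio_mem_nhds hlt] with y hy
    rw [if_pos (le_of_lt hy)]
  · rw [if_pos le_rfl, ← hasDerivWithinAt_univ, ← Iic_union_Ici (a := x)]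
    refine HasDerivWithinAt.union ?_ ?_
    · refine (hA le_rfl).hasDerivWithinAt.congr (fun y hy => ?_) ?_
      · rw [if_pos (mem_Iic.mp hy)]
      · rw [if_pos le_rfl]
    · rw [h']
      refine (hB le_rfl).hasDerivWithinAt.congr (fun y hy => ?_) ?_
      · split_ifs with h1
        · rw [le_antisymm h1 hy, h]
        · rfl
      · rw [if_pos le_rfl, h]
  · rw [if_neg (not_le.mpr hgt)]
    refine (hB hgt.le).congr_of_eventuallyEq ?_
    filter_upwards [Ioi_mem_nhds hgt] with y hy
    rw [if_neg (not_le.mpr hy)]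

section
variable {L α D σ q : ℝ}

lemma continuous_rpow_one_sub (hD : 0 < D) : Continuous fun t : ℝ => (1 - t) ^ (1 + D) :=
  (continuous_const.sub continuous_id).rpow_const fun _ => Or.inr (by linarith)

lemma exists_left_branch {b : ℝ} (hL : 0 < L) (hD : 0 < D) (hb : 0 ≤ b) (hb2 : b ^ 2 < 1 + 3 * L) :
    ∃ U V : ℝ → UC, ∃ P : ℝ → ℝ → ℝ, Continuous U ∧ Continuous V ∧ (∀ e, UC.ev (U e) 0 = 1) ∧
      (∀ e, ∀ t ∈ Ioo (0:ℝ) 1, HasDerivAt (UC.ev (U e)) (UC.ev (V e) t) t) ∧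
      (∀ e, ∀ t ∈ Ioo (0:ℝ) 1, UC.ev (U e) t = 0 → UC.ev (V e) t ≠ 0) ∧
      ∀ e ∈ Icc 0 b, IsBranch L α D σ q e (UC.ev (U e)) (UC.ev (V e)) (P e) (Ioo 0 (3/4)) := by
  set ec : ℝ → ℝ := fun e => max 0 (min e b)
  have hec : Continuous ec := continuous_const.max (continuous_id.min continuous_const)
  have hecm : ∀ e, ec e ∈ Icc 0 b := fun e => ⟨le_max_left _ _, max_le hb (min_le_right _ _)⟩
  have hece : ∀ e ∈ Icc 0 b, ec e = e := fun e he => by simp [ec, he.1, he.2]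
  have hn : ∀ e, ∀ x ∈ Icc (0:ℝ) 1, 0 < hPoly L (ec e) x := fun e x hx =>
    hPoly_pos hL (lt_of_le_of_lt (pow_le_pow_left₀ (hecm e).1 (hecm e).2 2) hb2) hx
  have hnc : Continuous fun p : ℝ × Icc (0:ℝ) 1 => hPoly L (ec p.1) p.2 := by unfold hPoly; fun_prop
  have hm : ∀ t : ℝ, 0 < 1 - min t (3/4) := fun t => by linarith [min_le_right t (3/4)]
  obtain ⟨g, hg, hge⟩ :=
    UC.exists_family (F := fun e x => x / ((1 - min x (3/4)) * hPoly L (ec e) x)) (by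
    refine Continuous.div (by fun_prop) (Continuous.mul (by fun_prop) hnc) fun p => ?_
    exact (mul_pos (hm _) (hn _ _ p.2.2)).ne')
  obtain ⟨c, hc, hce⟩ := UC.exists_family (F := fun e x => kgCoeff L α σ q (ec e) x) (by
    unfold kgCoeff
    refine Continuous.sub
        (Continuous.sub (by fun_prop) (Continuous.div (by fun_prop) hnc fun p => ?_)) (by fun_prop)
    exact (hn _ _ p.2.2).ne')
  obtain ⟨U, V, P, hU, hV, h0, hd, hP, hVP⟩ := UC.exists_branch (a := 1 + D) (by linarith) hg hc
  refine ⟨U, V, P, hU, hV, h0, hd, fun e t ht1 => ?_, fun e he x hx => ?_⟩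
  · refine UC.no_double_zero (a := 1 + D) (by linarith) (h0 e) (hd e) (hP e) (hVP e) ht1 ?_
    rw [hge e t ⟨ht1.1.le, ht1.2.le⟩]
    exact (div_pos ht1.1 (mul_pos (hm _) (hn _ _ ⟨ht1.1.le, ht1.2.le⟩))).ne'
  · have hx1 : x ∈ Ioo (0:ℝ) 1 := ⟨hx.1, by linarith [hx.2]⟩
    have hx1' : x ∈ Icc (0:ℝ) 1 := ⟨hx1.1.le, hx1.2.le⟩
    have hc1 := hce e x hx1'
    have hg1 := hge e x hx1'
    have hn1 := hn e x hx1'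
    rw [hece e he] at hc1 hg1 hn1
    refine ⟨hd e x hx1, ?_, ?_⟩
    · have := hP e x hx1
      rwa [hc1] at this
    · have := hVP e x hx1
      rw [hg1, min_eq_left hx.2.le, rpow_add_one hx.1.ne'] at this
      have h1 : (1:ℝ) - x ≠ 0 := by linarith [hx1.2]
      have h2 := hx.1.ne'
      field_simp at this
      linarith

lemma exists_right_branch {b : ℝ} (hL : 0 < L) (hD : 0 < D) (hb : 0 ≤ b) (hb2 : b ^ 2 < 1 + 3 * L) :
    ∃ U V : ℝ → UC, ∃ P : ℝ → ℝ → ℝ, Continuous U ∧ Continuous V ∧ (∀ e, UC.ev (U e) 0 = 1) ∧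
      (∀ e, ∀ t ∈ Ioo (0:ℝ) 1, HasDerivAt (UC.ev (U e)) (UC.ev (V e) t) t) ∧
      (∀ e, ∀ t ∈ Ioo (0:ℝ) 1, UC.ev (U e) t = 0 → UC.ev (V e) t ≠ 0) ∧
      ∀ e ∈ Icc 0 b, IsBranch L α D σ q
          e (fun x => UC.ev (U e) (1 - x)) (fun x => -UC.ev (V e) (1 - x))
        (fun x => -P e (1 - x)) (Ioo (1/4) 1) := by
  set ec : ℝ → ℝ := fun e => max 0 (min e b)
  have hec : Continuous ec := continuous_const.max (continuous_id.min continuous_const)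
  have hecm : ∀ e, ec e ∈ Icc 0 b := fun e => ⟨le_max_left _ _, max_le hb (min_le_right _ _)⟩
  have hece : ∀ e ∈ Icc 0 b, ec e = e := fun e he => by simp [ec, he.1, he.2]
  have hn : ∀ e, ∀ x ∈ Icc (0:ℝ) 1, 0 < hPoly L (ec e) (1 - x) := fun e x hx =>
    hPoly_pos hL (lt_of_le_of_lt (pow_le_pow_left₀ (hecm e).1 (hecm e).2 2) hb2)
      ⟨by linarith [hx.2], by linarith [hx.1]⟩
  have hnc : Continuous fun p : ℝ × Icc (0:ℝ) 1 => hPoly L (ec p.1) (1 - p.2) := by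
    unfold hPoly; fun_prop
  have hm : ∀ t : ℝ, 0 < 1 - min t (3/4) := fun t => by linarith [min_le_right t (3/4)]
  have hz := continuous_rpow_one_sub hD
  have hz1 : Continuous fun p : ℝ × Icc (0:ℝ) 1 => (1 - min (p.2:ℝ) (3/4)) ^ (1 + D) :=
    hz.comp (f := fun p : ℝ × Icc (0:ℝ) 1 => min (p.2:ℝ) (3/4)) (by fun_prop)
  have hz2 : Continuous fun p : ℝ × Icc (0:ℝ) 1 => (1 - (p.2:ℝ)) ^ (1 + D) :=
    hz.comp (f := fun p : ℝ × Icc (0:ℝ) 1 => (p.2:ℝ)) (by fun_prop)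
  obtain ⟨g, hg, hge⟩ := UC.exists_family
      (F := fun e x => 1 / (hPoly L (ec e) (1 - x) * (1 - min x (3/4)) ^ (1 + D))) (by
    refine Continuous.div (by fun_prop) (Continuous.mul hnc hz1) fun p => ?_
    exact (mul_pos (hn _ _ p.2.2) (rpow_pos_of_pos (hm _) _)).ne')
  obtain ⟨c, hc, hce⟩ :=
    UC.exists_family (F := fun e x => (1 - x) ^ (1 + D) * kgCoeff L α σ q (ec e) (1 - x)) (by
    unfold kgCoeff
    refine hz2.mul (Continuous.sub
        (Continuous.sub (by fun_prop) (Continuous.div (by fun_prop) hnc fun p => ?_)) (by fun_prop))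
    exact (hn _ _ p.2.2).ne')
  obtain ⟨U, V, P, hU, hV, h0, hd, hP, hVP⟩ := UC.exists_branch (a := 0) le_rfl hg hc
  refine ⟨U, V, P, hU, hV, h0, hd, fun e t ht1 => ?_, fun e he x hx => ?_⟩
  · refine UC.no_double_zero (a := 0) le_rfl (h0 e) (hd e) (hP e) (hVP e) ht1 ?_
    rw [hge e t ⟨ht1.1.le, ht1.2.le⟩]
    exact (div_pos one_pos (mul_pos (hn _ _ ⟨ht1.1.le, ht1.2.le⟩) (rpow_pos_of_pos (hm _) _))).ne'
  · have hx1 : 1 - x ∈ Ioo (0:ℝ) 1 := ⟨by linarith [hx.2], by linarith [hx.1]⟩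
    have hx1' : 1 - x ∈ Icc (0:ℝ) 1 := ⟨hx1.1.le, hx1.2.le⟩
    have hc1 := hce e (1 - x) hx1'
    have hg1 := hge e (1 - x) hx1'
    have hn1 := hn e (1 - x) hx1'
    have hs : (1:ℝ) - (1 - x) = x := by ring
    rw [hece e he, hs] at hc1 hg1 hn1
    have hr : HasDerivAt (fun x : ℝ => 1 - x) (-1) x := (hasDerivAt_id x).const_sub 1
    refine ⟨?_, ?_, ?_⟩
    · exact ((hd e (1 - x) hx1).comp x hr).congr_deriv (by ring)
    · have := hP e (1 - x) hx1
      rw [hc1] at this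
      refine (this.comp x hr).neg.congr_deriv ?_
      simp
    · have := hVP e (1 - x) hx1
      rw [hg1, min_eq_left (by linarith [hx.1]), zero_add, rpow_one, hs] at this
      have h2 : x ^ (1 + D) ≠ 0 := (rpow_pos_of_pos (by linarith [hx.1]) _).ne'
      field_simp at this
      linarith
end

lemma pos_of_ne_zero_on {F : ℝ → ℝ} {c : ℝ} (hF : ContinuousOn F (Icc 0 c)) (h0 : 0 < F 0)
    (hne : ∀ t ∈ Icc 0 c, F t ≠ 0) : ∀ t ∈ Icc 0 c, 0 < F t := by
  intro t ht
  by_contra h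
  have h1 := intermediate_value_Icc' ht.1 (hF.mono (Icc_subset_Icc_right ht.2)) ⟨not_lt.mp h, h0.le⟩
  obtain ⟨s, hs, hs0⟩ := h1
  exact hne s ⟨hs.1, hs.2.trans ht.2⟩ hs0

section
variable {L α D σ q : ℝ} {h hx p : ℝ → ℝ}

lemma IsBranch.hardy_strictMonoOn {l r : ℝ} (hL : 0 < L) (hα : -(9/4) < α) (hσ : 2 * σ = 3 + D)
    (hσα : σ * (σ - 3) = α) (hl : 0 ≤ l) (hr : r ≤ 1)
    (hB : IsBranch L α D σ q 0 h hx p (Ioo l r)) (hz : ∀ x ∈ Ioo l r, h x = 0 → hx x ≠ 0) :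
    StrictMonoOn (fun x => x ^ D * ((1 - x) * hPoly L 0 x * h x * (σ * h x + x * hx x)
      - 3 / 2 * L * (1 - x ^ 3) * h x ^ 2)) (Ioo l r) := by
  have he : (0:ℝ) ^ 2 < 1 + 3 * L := by nlinarith
  have hI : Ioo l r ⊆ Ioo 0 1 := Ioo_subset_Ioo hl hr
  refine (_root_.hardy_strictMonoOn hL hα hl hr (fun x hx => hB.isWave hL he hσ hσα hI hx)
    fun x hxI hW hP => ?_).congr fun x hxI => ?_
  · have hx0 := (hI hxI).1
    have h1 : h x = 0 := (mul_eq_zero.mp hW).resolve_left (rpow_pos_of_pos hx0 _).ne'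
    have h2 := (hB x hxI).2.2
    simp only [h1, mul_zero, zero_add] at hP
    have h3 := (mul_eq_zero.mp hP).resolve_left (rpow_pos_of_pos hx0 _).ne'
    rw [h3] at h2
    have hn := hPoly_pos hL he ⟨hx0.le, (hI hxI).2.le⟩
    have h4 : x ^ (1 + D) * ((1 - x) * hPoly L 0 x) ≠ 0 :=
      (mul_pos (rpow_pos_of_pos hx0 _) (mul_pos (by linarith [(hI hxI).2]) hn)).ne'
    exact hz x hxI h1 ((mul_eq_zero.mp h2.symm).resolve_left h4)
  · have hx0 := (hI hxI).1
    have h2 := (hB x hxI).2.2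
    have hx0' := hx0.ne'
    have hy : x ^ σ ≠ 0 := (rpow_pos_of_pos hx0 _).ne'
    have e1 : x ^ D = x ^ σ * x ^ σ / x ^ 3 := by
      rw [← rpow_add hx0, ← rpow_natCast x 3, ← rpow_sub hx0]; congr 1; push_cast; linarith
    have e1' : x ^ (1 + D) = x ^ σ * x ^ σ / x ^ 2 := by
      rw [← rpow_add hx0, ← rpow_natCast x 2, ← rpow_sub hx0]; congr 1; push_cast; linarith
    have e2 : x ^ (-σ) = (x ^ σ)⁻¹ := rpow_neg hx0.le _
    have e3 : x ^ (σ - 3) = x ^ σ / x ^ 3 := by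
      rw [← rpow_natCast x 3, ← rpow_sub hx0]; norm_num
    simp only [h2, e1, e1', e2, e3]
    field_simp

lemma exists_ground_state {b : ℝ} (hL : 0 < L) (hα : -(9/4) < α) (hα0 : α < 0) (hD : 0 < D)
    (hσ : 2 * σ = 3 + D)
    (hσα : σ * (σ - 3) = α) (hb : 0 < b) (hb2 : b ^ 2 < 1 + 3 * L) (hq : 0 ≤ q)
    (hqb : 3840 * (1 + 3 * L) ^ 2 < q * b ^ 2) :
    ∃ a ∈ Ioc 0 b, ∃ h hx : UC, ∃ p : ℝ → ℝ, IsBranch L α D σ q a (UC.ev h) (UC.ev hx) p (Ioo 0 1) ∧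
      (∀ x ∈ Icc (0:ℝ) 1, 0 < UC.ev h x) ∧ UC.ev h 1 = 1 := by
  obtain ⟨U, V, P, hU, hV, h0, hd, hnd, hB⟩ :=
    exists_left_branch (α := α) (σ := σ) (q := q) hL hD hb.le hb2
  obtain ⟨U', V', P', hU', hV', h0', hd', hnd', hB'⟩ :=
    exists_right_branch (α := α) (σ := σ) (q := q) hL hD hb.le hb2
  have hsub : ∀ {t : ℝ}, t ∈ Ioc (0:ℝ) (1/2) → t ∈ Ioo (0:ℝ) 1 := fun ht =>
    ⟨ht.1, by linarith [ht.2]⟩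
  have h00 : (0:ℝ) ∈ Icc 0 b := ⟨le_rfl, hb.le⟩
  have hbb : b ∈ Icc 0 b := ⟨hb.le, le_rfl⟩
  have hD0 : (0:ℝ) ^ D = 0 := zero_rpow hD.ne'
  have hDc : Continuous fun x : ℝ => x ^ D := Real.continuous_rpow_const hD.le
  have hnc : Continuous (hPoly L 0) := by unfold hPoly; fun_prop
  have hGL : ∀ x ∈ Ioo (0:ℝ) (3/4), 0 <
      x ^ D * ((1 - x) * hPoly L 0 x * UC.ev (U 0) x * (σ * UC.ev (U 0) x + x * UC.ev (V 0) x)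
      - 3 / 2 * L * (1 - x ^ 3) * UC.ev (U 0) x ^ 2) := by
    have hmono := (hB 0 h00).hardy_strictMonoOn hL hα hσ hσα le_rfl (by norm_num) fun x hx =>
      hnd 0 x ⟨hx.1, by linarith [hx.2]⟩
    intro x hx
    have hc : Continuous fun x =>
      x ^ D * ((1 - x) * hPoly L 0 x * UC.ev (U 0) x * (σ * UC.ev (U 0) x + x * UC.ev (V 0) x)
      - 3 / 2 * L * (1 - x ^ 3) * UC.ev (U 0) x ^ 2) := by
      have := UC.continuous_ev (U 0)
      have := UC.continuous_ev (V 0)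
      fun_prop
    have hlim := hc.continuousAt.continuousWithinAt (s := Ioi 0) (x := 0)
    have hx2 : x / 2 ∈ Ioo (0:ℝ) (3/4) := ⟨by linarith [hx.1], by linarith [hx.1, hx.2]⟩
    refine lt_of_le_of_lt (ge_of_tendsto' (x := nhdsWithin (0:ℝ) (Ioi 0))
        (f := fun y => (0:ℝ)) tendsto_const_nhds fun _ => le_rfl) ?_
    refine lt_of_le_of_lt (?_ : (0:ℝ) ≤ _) (hmono hx2 hx (by linarith [hx.1]))
    have h1 := le_of_tendsto hlim (b := _) (by
      filter_upwards [Ioo_mem_nhdsGT hx2.1] with y hy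
      exact (hmono ⟨hy.1, hy.2.trans hx2.2⟩ hx2 hy.2).le)
    simpa [hD0] using h1
  have hGR : ∀ x ∈ Ioo (1/4:ℝ) 1, x ^ D * ((1 - x) * hPoly L 0 x * UC.ev (U' 0) (1 - x) *
      (σ * UC.ev (U' 0) (1 - x) + x * (-UC.ev (V' 0) (1 - x)))
      - 3 / 2 * L * (1 - x ^ 3) * UC.ev (U' 0) (1 - x) ^ 2) < 0 := by
    have hmono := (hB' 0 h00).hardy_strictMonoOn hL hα hσ
        hσα (by norm_num) le_rfl fun x hx hz hz' =>
      hnd' 0 (1 - x) ⟨by linarith [hx.2], by linarith [hx.1]⟩ hz (neg_eq_zero.mp hz')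
    intro x hx
    have hc : Continuous fun x => x ^ D * ((1 - x) * hPoly L 0 x * UC.ev (U' 0) (1 - x) *
      (σ * UC.ev (U' 0) (1 - x) + x * (-UC.ev (V' 0) (1 - x)))
      - 3 / 2 * L * (1 - x ^ 3) * UC.ev (U' 0) (1 - x) ^ 2) := by
      have := UC.continuous_ev (U' 0)
      have := UC.continuous_ev (V' 0)
      fun_prop
    have hlim := hc.continuousAt.continuousWithinAt (s := Iio 1) (x := 1)
    have hx2 : (x + 1) / 2 ∈ Ioo (1/4:ℝ) 1 := ⟨by linarith [hx.1, hx.2], by linarith [hx.2]⟩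
    refine lt_of_lt_of_le (hmono hx hx2 (by linarith [hx.2])) ?_
    have h1 := ge_of_tendsto hlim (b := _) (by
      filter_upwards [Ioo_mem_nhdsLT hx2.2] with y hy
      exact (hmono hx2 ⟨hx2.1.trans hy.1, hy.2⟩ hy.1).le)
    simpa using h1
  have hpL : ∀ t ∈ Icc (0:ℝ) (1/2), 0 < UC.ev (U 0) t := by
    refine pos_of_ne_zero_on
        (UC.continuous_ev _).continuousOn (by rw [h0]; norm_num) fun t ht hz => ?_
    rcases ht.1.eq_or_lt with h | h
    · rw [← h, h0] at hz; norm_num at hz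
    · have := hGL t ⟨h, by linarith [ht.2]⟩
      rw [hz] at this; norm_num at this
  have hpR : ∀ t ∈ Icc (0:ℝ) (1/2), 0 < UC.ev (U' 0) t := by
    refine pos_of_ne_zero_on
        (UC.continuous_ev _).continuousOn (by rw [h0']; norm_num) fun t ht hz => ?_
    rcases ht.1.eq_or_lt with h | h
    · rw [← h, h0'] at hz; norm_num at hz
    · have := hGR (1 - t) ⟨by linarith [ht.2], by linarith⟩
      rw [sub_sub_cancel, hz] at this; norm_num at this
  have hw : 0 < UC.ev (V 0) (1/2) * UC.ev (U' 0) (1/2) + UC.ev (V' 0) (1/2) * UC.ev (U 0)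
      (1/2) := by
    have h1 := hGL (1/2) (by norm_num)
    have h2 := hGR (1/2) (by norm_num)
    have h3 : (1 - 1/2 : ℝ) = 1/2 := by norm_num
    rw [h3] at h1 h2
    have hyD : (0:ℝ) < (1/2) ^ D := by positivity
    have h1 := pos_of_mul_pos_right h1 hyD.le
    have h2 := neg_of_mul_neg_right h2 hyD.le
    have hu := hpL (1/2) (by norm_num)
    have hu' := hpR (1/2) (by norm_num)
    have hn := hPoly_pos (e := 0) hL (by nlinarith) (x := 1/2) (by norm_num)
    set n := hPoly L 0 (1/2)
    set u := UC.ev (U 0) (1/2)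
    set u' := UC.ev (U' 0) (1/2)
    set v := UC.ev (V 0) (1/2)
    set v' := UC.ev (V' 0) (1/2)
    have h4 : 0 < u * (1/2 * n * (σ * u + 1/2 * v) - 3/2 * L * (1 - (1/2)^3) * u) := by linarith
    have h5 := pos_of_mul_pos_right h4 hu.le
    have h6 : 0 < u' * (3/2 * L * (1 - (1/2)^3) * u' - 1/2 * n * (σ * u' + 1/2 * (-v'))) := by
      linarith
    have h7 := pos_of_mul_pos_right h6 hu'.le
    have h8 : 0 < n * (v * u' + v' * u) := by nlinarith [mul_pos h5 hu', mul_pos h7 hu]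
    exact pos_of_mul_pos_right h8 hn.le
  have hbad : ¬ ∀ t ∈ Icc (0:ℝ) (1/2), 0 < UC.ev (U b) t := by
    intro h
    refine absurd (charge_bound_of_pos
        (W := fun x => x ^ σ * UC.ev (U b) x) hL hα0 hb2 hq (fun x hx =>
      (hB b hbb).isWave hL hb2 hσ hσα
          (Ioo_subset_Ioo le_rfl (by norm_num)) ⟨by linarith [hx.1], by linarith [hx.2]⟩)
      fun x hx => mul_pos (rpow_pos_of_pos
          (by linarith [hx.1]) _) (h x ⟨by linarith [hx.1], hx.2⟩)) (not_le.mpr hqb)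
  obtain ⟨a, ha, hp, hp', hm⟩ := UC.exists_matching hU hV hU' hV' h0 h0' hd hd'
    (fun e t ht => hnd e t (hsub ht)) (fun e t ht => hnd' e t (hsub ht)) hb hpL hpR hw hbad
  have haI : a ∈ Icc 0 b := ⟨ha.1.le, ha.2⟩
  have hu := hp (1/2) (by norm_num)
  have hu' := hp' (1/2) (by norm_num)
  set r := UC.ev (U' a) (1/2) / UC.ev (U a) (1/2)
  have hr : 0 < r := div_pos hu' hu
  have hhalf : (1 - 1/2 : ℝ) = 1/2 := by norm_num
  have hmU : r * UC.ev (U a) (1/2) = UC.ev (U' a) (1 - 1/2) := by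
    rw [hhalf]; exact div_mul_cancel₀ _ hu.ne'
  have hmV : r * UC.ev (V a) (1/2) = -UC.ev (V' a) (1 - 1/2) := by
    rw [hhalf]; simp only [r]; field_simp; linarith
  have hmP : r * P a (1/2) = -P' a (1 - 1/2) := by
    have hp₂ := (hB' a haI (1/2) (by norm_num)).2.2
    beta_reduce at hp₂
    rw [hp₂, (hB a haI (1/2) (by norm_num)).2.2, ← hmV]; ring
  have hH : Continuous fun x : ℝ =>
    if x ≤ 1/2 then r * UC.ev (U a) x else UC.ev (U' a) (1 - x) := by
    have := UC.continuous_ev (U a)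
    have := UC.continuous_ev (U' a)
    refine Continuous.if_le (by fun_prop) (by fun_prop) continuous_id continuous_const ?_
    rintro x rfl; exact hmU
  have hHx : Continuous fun x : ℝ =>
    if x ≤ 1/2 then r * UC.ev (V a) x else -UC.ev (V' a) (1 - x) := by
    have := UC.continuous_ev (V a)
    have := UC.continuous_ev (V' a)
    refine Continuous.if_le (by fun_prop) (by fun_prop) continuous_id continuous_const ?_
    rintro x rfl; exact hmV
  refine ⟨a, ha, UC.mk _ hH.continuousOn, UC.mk _ hHx.continuousOn,
    fun x => if x ≤ 1/2 then r * P a x else -P' a (1 - x), fun x hx => ?_, fun x hx => ?_, ?_⟩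
  · have hxI : x ∈ Icc (0:ℝ) 1 := ⟨hx.1.le, hx.2.le⟩
    have hL' : x ≤ 1/2 → x ∈ Ioo (0:ℝ) (3/4) := fun h => ⟨hx.1, by linarith⟩
    have hR' : 1/2 ≤ x → x ∈ Ioo (1/4:ℝ) 1 := fun h => ⟨by linarith, hx.2⟩
    rw [UC.ev_mk _ hxI, UC.ev_mk _ hxI]
    refine ⟨?_, ?_, ?_⟩
    · refine HasDerivAt.congr_of_eventuallyEq (hasDerivAt_ite (A' := fun x => r * UC.ev (V a) x)
        (B' := fun x => -UC.ev (V' a) (1 - x)) (fun h => (hB a haI x (hL' h)).1.const_mul r)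
        (fun h => (hB' a haI x (hR' h)).1) hmU hmV) ?_
      filter_upwards [Ioo_mem_nhds hx.1 hx.2] with y hy
      rw [UC.ev_mk _ ⟨hy.1.le, hy.2.le⟩]
    · refine (hasDerivAt_ite (A' := fun x => r * (x ^ (1 + D) * kgCoeff L α σ q a x * UC.ev (U a) x))
        (B' := fun x => x ^ (1 + D) * kgCoeff L α σ q a x * UC.ev (U' a) (1 - x))
        (fun h => (hB a haI x (hL' h)).2.1.const_mul r)
        (fun h => (hB' a haI x (hR' h)).2.1) hmP ?_).congr_deriv ?_
      · rw [← hmU]; ring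
      · split_ifs <;> ring
    · beta_reduce
      split_ifs with h
      · rw [(hB a haI x (hL' h)).2.2]; ring
      · exact (hB' a haI x (hR' (not_le.mp h).le)).2.2
  · rw [UC.ev_mk _ hx]
    split_ifs with h
    · exact mul_pos hr (hp x ⟨hx.1, h⟩)
    · exact hp' _ ⟨by linarith [hx.2], by linarith⟩
  · rw [UC.ev_mk _ (by simp)]
    norm_num
    exact h0' a
end

namespace UC

/-- The coordinate function on `[0,1]`. -/
def X : UC := mk (fun x => x) continuousOn_id

@[simp] lemma ev_X {x : ℝ} (hx : x ∈ Icc (0:ℝ) 1) : ev X x = x := ev_mk _ hx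

end UC

/-- A linear scalar ground state on a Reissner–Nordström–AdS background of charge `a`, in the
compactified radial variable, with the weighted averaging operators used to build hairy solutions. -/
structure Background where
  (L α q D σ a : ℝ)
  hL : 0 < L
  hq : 0 < q
  hD : 0 < D
  hσ : 2 * σ = 3 + D
  hσα : σ * (σ - 3) = α
  ha : 0 < a
  ha2 : a ^ 2 < 1 + 3 * L
  (h hx : UC)
  p : ℝ → ℝ
  branch : IsBranch L α D σ q a (UC.ev h) (UC.ev hx) p (Ioo 0 1)
  h_pos : ∀ x ∈ Icc (0:ℝ) 1, 0 < UC.ev h x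
  h_one : UC.ev h 1 = 1
  (massAvg chargeAvg avg : UC →L[ℝ] UC)
  massAvg_spec : ∀ f, ∀ x ∈ Icc (0:ℝ) 1,
    (1 - x) * UC.ev (massAvg f) x = ∫ y in x..1, y ^ (D - 1) * UC.ev f y
  massAvg_one : ∀ f, UC.ev (massAvg f) 1 = UC.ev f 1
  chargeAvg_spec : ∀ f, ∀ x ∈ Icc (0:ℝ) 1,
    (1 - x) * UC.ev (chargeAvg f) x = ∫ y in x..1, y ^ (1 + D) * UC.ev f y
  chargeAvg_one : ∀ f, UC.ev (chargeAvg f) 1 = UC.ev f 1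
  avg_spec : ∀ f, ∀ x ∈ Icc (0:ℝ) 1, (1 - x) * UC.ev (avg f) x = ∫ y in x..1, UC.ev f y
  avg_one : ∀ f, UC.ev (avg f) 1 = UC.ev f 1

namespace Background

variable (B : Background)

/-- `x ^ D` as an element of `UC`. -/
def xD : UC := UC.mk (fun x => x ^ B.D) (continuous_rpow_const B.hD.le).continuousOn

/-- The reduced background lapse. -/
def nh : UC := UC.mk (hPoly B.L B.a) (by unfold hPoly; fun_prop)

/-- The derivative of the background lapse `x ^ 2 Ω²`. -/
def dfh : UC := UC.mk (fun x => 2 * x - 3 * (1 + B.L + B.a ^ 2) * x ^ 2 + 4 * B.a ^ 2 * x ^ 3)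
    (by fun_prop)

/-- The logarithmic derivative `x W' / W` of the ground state. -/
def γ : UC := B.σ • (1 : UC) + UC.X * B.hx * Ring.inverse B.h

/-- Scalar parameter, charge parameter, scalar, lapse and potential corrections. -/
abbrev Var : Type := ℝ × ℝ × UC × UC × UC

def n (z : Var) : UC :=
  B.nh - (z.1 * z.2.1 * (2 * B.a + z.1 * z.2.1)) • UC.X ^ 3 + z.1 • (UC.X ^ 2 * z.2.2.2.1)

def ni (z : Var) : UC := Ring.inverse (B.n z)

def e (z : Var) : ℝ := B.a + z.1 * z.2.1

def β (z : Var) : UC := B.e z • (1 : UC) + z.1 • z.2.2.2.2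

def v (z : Var) : UC := 1 - z.1 • ((1 - UC.X) * B.avg z.2.2.1)

def s (z : Var) : UC := B.h * B.v z

def g (z : Var) : UC := B.h * (B.γ * B.v z + z.1 • (UC.X * z.2.2.1))

def P (z : Var) : UC := B.β z * B.ni z * B.s z ^ 2

def Q (z : Var) : UC := B.e z • (1 : UC) + (z.1 * B.q) • ((1 - UC.X) * B.chargeAvg (B.P z))

def E (z : Var) : UC :=
  (B.L * B.α / 2) • B.s z ^ 2 + (1 / 2 : ℝ) • ((1 - UC.X) * B.n z * B.g z ^ 2)
    + (B.q / 2) • (UC.X ^ 2 * (1 - UC.X) * B.β z ^ 2 * B.s z ^ 2 * B.ni z)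
    + B.q • (UC.X ^ 3 * B.Q z * B.P z)

def Y (z : Var) : UC := B.g z ^ 2 + B.q • (UC.X ^ 2 * B.β z ^ 2 * B.s z ^ 2 * B.ni z ^ 2)

def newη (z : Var) : UC :=
  B.q • (UC.X ^ 2 * B.chargeAvg (B.P z) * (B.Q z + B.e z • (1 : UC))) - (2 : ℝ) •
      (UC.X * B.massAvg (B.E z))

def newb (z : Var) : UC :=
  B.avg (B.q • ((1 - UC.X) * B.chargeAvg (B.P z)) - UC.X ^ 2 * B.xD * B.Y z * (1 - UC.X) * B.β z)

/-- The rescaled lapse perturbation. -/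
def no (z : Var) : UC := z.2.2.2.1 - (z.2.1 * (2 * B.a + z.1 * z.2.1)) • UC.X

def Z (z : Var) : UC :=
  (4 : ℝ) • (UC.X * (z.2.1 • (1 : UC) + B.q • ((1 - UC.X) * B.chargeAvg (B.P z))) *
      (B.Q z + B.a • (1 : UC)))
    - (6 : ℝ) • ((z.2.1 * (2 * B.a + z.1 * z.2.1) / 2) • (1 : UC) + (1 - UC.X) * B.massAvg (B.E z))
    + (2 : ℝ) • (B.xD * B.E z) - (2 * B.q) • (UC.X ^ 3 * B.xD * B.P z * B.Q z)

def T (z : Var) : UC :=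
  -((B.L * B.α) • (B.no z * Ring.inverse B.nh))
    - B.q • ((1 - UC.X) * ((z.2.1 • (1 : UC) + z.2.2.2.2) * B.nh - B.a • (UC.X ^ 2 * B.no z))
        * (B.β z * B.nh + B.a • B.n z) * B.ni z * Ring.inverse B.nh ^ 2)
    - B.γ * UC.X * (B.Z z - B.no z * B.dfh * Ring.inverse B.nh)
    + UC.X * B.xD * B.Y z * (1 - UC.X) * B.n z * B.γ

def S (z : Var) : UC :=
  B.T z * B.v z + z.1 • (UC.X ^ 2 * B.xD * B.Y z * (1 - UC.X) * B.n z * z.2.2.1)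

end Background

/-- Differentiability of inversion along a family of units. -/
lemma ContDiffAt.ringInverse' {E R : Type*} [NormedAddCommGroup E] [NormedSpace ℝ E] [NormedRing R]
    [NormedAlgebra ℝ R] [HasSummableGeomSeries R] {f : E → R} {z : E} {n : WithTop ℕ∞}
    (hf : ContDiffAt ℝ n f z) (hu : IsUnit (f z)) :
        ContDiffAt ℝ n (fun y => Ring.inverse (f y)) z := by
  obtain ⟨u, hu⟩ := hu
  have := contDiffAt_ringInverse ℝ u (n := n)
  rw [hu] at this
  exact this.comp z hf

namespace Background

variable (B : Background) {z : Var}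

lemma contDiff_n : ContDiff ℝ 1 B.n := by unfold n; fun_prop
lemma contDiff_v : ContDiff ℝ 1 B.v := by unfold v; fun_prop
lemma contDiff_e : ContDiff ℝ 1 B.e := by unfold e; fun_prop
lemma contDiff_β : ContDiff ℝ 1 B.β := by have := B.contDiff_e; unfold β; fun_prop
lemma contDiff_s : ContDiff ℝ 1 B.s := by have := B.contDiff_v; unfold s; fun_prop
lemma contDiff_g : ContDiff ℝ 1 B.g := by have := B.contDiff_v; unfold g; fun_prop
lemma contDiff_no : ContDiff ℝ 1 B.no := by unfold no; fun_prop

lemma contDiffAt_ni (hz : IsUnit (B.n z)) : ContDiffAt ℝ 1 B.ni z :=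
  B.contDiff_n.contDiffAt.ringInverse' hz

lemma contDiffAt_P (hz : IsUnit (B.n z)) : ContDiffAt ℝ 1 B.P z := by
  have := B.contDiff_β; have := B.contDiff_s; have := B.contDiffAt_ni hz
  unfold P; fun_prop

lemma contDiffAt_Q (hz : IsUnit (B.n z)) : ContDiffAt ℝ 1 B.Q z := by
  have := B.contDiff_e; have := B.contDiffAt_P hz
  unfold Q; fun_prop

lemma contDiffAt_E (hz : IsUnit (B.n z)) : ContDiffAt ℝ 1 B.E z := by
  have := B.contDiff_β; have := B.contDiff_s; have := B.contDiff_g; have := B.contDiff_n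
  have := B.contDiffAt_ni hz; have := B.contDiffAt_P hz; have := B.contDiffAt_Q hz
  unfold E; fun_prop

lemma contDiffAt_Y (hz : IsUnit (B.n z)) : ContDiffAt ℝ 1 B.Y z := by
  have := B.contDiff_β; have := B.contDiff_s; have := B.contDiff_g; have := B.contDiffAt_ni hz
  unfold Y; fun_prop

lemma contDiffAt_newη (hz : IsUnit (B.n z)) : ContDiffAt ℝ 1 B.newη z := by
  have := B.contDiff_e
  have := B.contDiffAt_P hz; have := B.contDiffAt_Q hz; have := B.contDiffAt_E hz
  unfold newη; fun_prop

lemma contDiffAt_newb (hz : IsUnit (B.n z)) : ContDiffAt ℝ 1 B.newb z := by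
  have := B.contDiff_β; have := B.contDiffAt_P hz; have := B.contDiffAt_Y hz
  unfold newb; fun_prop

lemma contDiffAt_Z (hz : IsUnit (B.n z)) : ContDiffAt ℝ 1 B.Z z := by
  have := B.contDiffAt_P hz; have := B.contDiffAt_Q hz; have := B.contDiffAt_E hz
  unfold Z; fun_prop

lemma contDiffAt_S (hz : IsUnit (B.n z)) : ContDiffAt ℝ 1 B.S z := by
  have := B.contDiff_β; have := B.contDiff_v; have := B.contDiff_n; have := B.contDiff_no
  have := B.contDiffAt_Z hz; have := B.contDiffAt_Y hz; have := B.contDiffAt_ni hz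
  unfold S T; fun_prop

end Background

namespace Background

variable (B : Background)

lemma ev_nh {x : ℝ} (hx : x ∈ Icc (0:ℝ) 1) : UC.ev B.nh x = hPoly B.L B.a x := UC.ev_mk _ hx

lemma ev_xD {x : ℝ} (hx : x ∈ Icc (0:ℝ) 1) : UC.ev B.xD x = x ^ B.D := UC.ev_mk _ hx

lemma ev_dfh {x : ℝ} (hx : x ∈ Icc (0:ℝ) 1) : UC.ev B.dfh x =
    2 * x - 3 * (1 + B.L + B.a ^ 2) * x ^ 2 + 4 * B.a ^ 2 * x ^ 3 := UC.ev_mk _ hx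

lemma nh_pos {x : ℝ} (hx : x ∈ Icc (0:ℝ) 1) : 0 < UC.ev B.nh x := by
  rw [B.ev_nh hx]; exact hPoly_pos B.hL B.ha2 hx

lemma isUnit_nh : IsUnit B.nh := UC.isUnit_of_ev fun _ hx => (B.nh_pos hx).ne'

lemma isUnit_h : IsUnit B.h := UC.isUnit_of_ev fun x hx => ne_of_gt (B.h_pos x hx)

/-- The weight of the linearised flux equation. -/
def ρ (x : ℝ) : ℝ := x ^ (1 + B.D) * UC.ev B.h x ^ 2

lemma continuous_ρ : Continuous B.ρ :=
  (continuous_rpow_const (by linarith [B.hD])).mul ((UC.continuous_ev _).pow 2)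

lemma ρ_pos {x : ℝ} (hx : x ∈ Ioc (0:ℝ) 1) : 0 < B.ρ x :=
  mul_pos (rpow_pos_of_pos hx.1 _) (pow_pos (B.h_pos _ ⟨hx.1.le, hx.2⟩) 2)

lemma exists_ρ_le : ∃ K, ∀ y ∈ Ioc (0:ℝ) 1, ∀ z ∈ Icc 0 y, B.ρ z ≤ K * B.ρ y := by
  refine ⟨‖B.h‖ ^ 2 * ‖Ring.inverse B.h‖ ^ 2, fun y hy z hz => ?_⟩
  have h1 : z ^ (1 + B.D) ≤ y ^ (1 + B.D) := rpow_le_rpow hz.1 hz.2 (by linarith [B.hD])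
  have hyp : 0 ≤ y ^ (1 + B.D) := rpow_nonneg hy.1.le _
  have h2 : UC.ev B.h z ^ 2 ≤ ‖B.h‖ ^ 2 :=
    sq_le_sq' (by linarith [neg_abs_le (UC.ev B.h z), UC.abs_ev_le B.h z])
    (le_trans (le_abs_self _) (UC.abs_ev_le _ _))
  have hy0 := B.h_pos y ⟨hy.1.le, hy.2⟩
  have h3 : 1 ≤ ‖Ring.inverse B.h‖ * UC.ev B.h y := by
    have := (le_abs_self _).trans (UC.abs_ev_le (Ring.inverse B.h) y)
    rw [UC.ev_inverse B.isUnit_h] at this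
    calc 1 = (UC.ev B.h y)⁻¹ * UC.ev B.h y := (inv_mul_cancel₀ hy0.ne').symm
      _ ≤ _ := mul_le_mul_of_nonneg_right this hy0.le
  have h4 : 1 ≤ (‖Ring.inverse B.h‖ * UC.ev B.h y) ^ 2 := one_le_pow₀ h3
  unfold ρ
  calc z ^ (1 + B.D) * UC.ev B.h z ^ 2 ≤ y ^ (1 + B.D) * ‖B.h‖ ^ 2 := mul_le_mul h1 h2 (sq_nonneg _) hyp
    _ ≤ (y ^ (1 + B.D) * ‖B.h‖ ^ 2) * (‖Ring.inverse B.h‖ * UC.ev B.h y) ^ 2 :=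
      le_mul_of_one_le_right (by positivity) h4
    _ = _ := by ring

lemma ev_γ {x : ℝ} (hx : x ∈ Icc (0:ℝ) 1) :
    UC.ev B.γ x = B.σ + x * UC.ev B.hx x / UC.ev B.h x := by
  unfold γ
  rw [UC.ev_add, UC.ev_smul, UC.ev_one, UC.ev_mul, UC.ev_mul, UC.ev_X hx, UC.ev_inverse B.isUnit_h]
  ring

/-- The ground state. -/
def W (x : ℝ) : ℝ := x ^ B.σ * UC.ev B.h x

/-- The flux of the ground state. -/
def flux (x : ℝ) : ℝ := (1 - x) * UC.ev B.nh x * UC.ev B.γ x * B.W x / x ^ 3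

lemma W_pos {x : ℝ} (hx : x ∈ Ioc (0:ℝ) 1) : 0 < B.W x :=
  mul_pos (rpow_pos_of_pos hx.1 _) (B.h_pos _ ⟨hx.1.le, hx.2⟩)

lemma ρ_eq {x : ℝ} (hx : 0 < x) : B.ρ x = B.W x ^ 2 / x ^ 2 := by
  unfold ρ W
  have h1 : x ^ (1 + B.D) * x ^ 2 = x ^ B.σ * x ^ B.σ := by
    rw [← rpow_natCast x 2, ← rpow_add hx, ← rpow_add hx]
    congr 1; push_cast; linarith [B.hσ]
  field_simp
  linear_combination (UC.ev B.h x ^ 2) * h1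

lemma hasDerivAt_W_flux {x : ℝ} (hx : x ∈ Ioo (0:ℝ) 1) :
    HasDerivAt B.W (UC.ev B.γ x * B.W x / x) x ∧
    HasDerivAt B.flux ((B.L * B.α - B.q * x ^ 2 * (1 - x) * B.a ^ 2 / UC.ev B.nh x) / x ^ 4 * B.W
        x) x := by
  have hxI : x ∈ Icc (0:ℝ) 1 := ⟨hx.1.le, hx.2.le⟩
  have h1 := B.branch.isWave B.hL B.ha2 B.hσ B.hσα subset_rfl hx
  have hP : ∀ y ∈ Ioo (0:ℝ) 1, B.σ * y ^ (B.σ - 3) * ((1 - y) * hPoly B.L B.a y) * UC.ev B.h y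
      + y ^ (-B.σ) * B.p y = B.flux y := by
    intro y hy
    have hyI : y ∈ Icc (0:ℝ) 1 := ⟨hy.1.le, hy.2.le⟩
    have hh := B.h_pos y hyI
    have h3 : y ^ (-B.σ) * y ^ (1 + B.D) = y ^ B.σ / y ^ 2 := by
      rw [← rpow_natCast y 2, ← rpow_add hy.1, ← rpow_sub hy.1]
      congr 1; push_cast; linarith [B.hσ]
    have h4 : y ^ (B.σ - 3) = y ^ B.σ / y ^ 3 := by
      rw [rpow_sub hy.1]; norm_cast
    rw [(B.branch y hy).2.2, flux, B.ev_γ hyI, W, B.ev_nh hyI, h4]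
    have hy0 := hy.1.ne'
    calc _ = B.σ * (y ^ B.σ / y ^ 3) * ((1 - y) * hPoly B.L B.a y) * UC.ev B.h y +
        (y ^ (-B.σ) * y ^ (1 + B.D)) * ((1 - y) * hPoly B.L B.a y) * UC.ev B.hx y := by ring
      _ = _ := by rw [h3]; field_simp
  have hev : B.flux =ᶠ[nhds x] fun y =>
    B.σ * y ^ (B.σ - 3) * ((1 - y) * hPoly B.L B.a y) * UC.ev B.h y
      + y ^ (-B.σ) * B.p y := by
    filter_upwards [Ioo_mem_nhds hx.1 hx.2] with y hy using (hP y hy).symm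
  refine ⟨h1.1.congr_deriv ?_, ?_⟩
  · beta_reduce
    rw [hP x hx, flux, B.ev_nh hxI]
    have h2 := hPoly_pos B.hL B.ha2 hxI
    have := hx.1.ne'
    have : 1 - x ≠ 0 := by linarith [hx.2]
    field_simp
  · rw [B.ev_nh hxI]
    exact h1.2.congr_of_eventuallyEq hev

variable (w : ℝ × UC × UC × UC)

@[simp] lemma n_zero : B.n (0, w) = B.nh := by simp [n]
@[simp] lemma ni_zero : B.ni (0, w) = Ring.inverse B.nh := by simp [ni]
@[simp] lemma e_zero : B.e (0, w) = B.a := by simp [e]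
@[simp] lemma β_zero : B.β (0, w) = B.a • (1 : UC) := by simp [β]
@[simp] lemma v_zero : B.v (0, w) = 1 := by simp [v]
@[simp] lemma s_zero : B.s (0, w) = B.h := by simp [s]
@[simp] lemma g_zero : B.g (0, w) = B.h * B.γ := by simp [g]
@[simp] lemma Q_zero : B.Q (0, w) = B.a • (1 : UC) := by simp [Q]
lemma P_zero : B.P (0, w) = B.P 0 := by
  rw [P, P, ← Prod.mk_zero_zero]; simp only [β_zero, ni_zero, s_zero]
lemma E_zero : B.E (0, w) = B.E 0 := by
  rw [E, E, ← Prod.mk_zero_zero]; simp only [β_zero, ni_zero, s_zero, n_zero, g_zero, Q_zero, P_zero]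
lemma Y_zero : B.Y (0, w) = B.Y 0 := by
  rw [Y, Y, ← Prod.mk_zero_zero]; simp only [β_zero, ni_zero, s_zero, g_zero]
lemma newη_zero : B.newη (0, w) = B.newη 0 := by
  rw [newη, newη, ← Prod.mk_zero_zero]; simp only [Q_zero, P_zero, E_zero, e_zero]
lemma newb_zero : B.newb (0, w) = B.newb 0 := by
  rw [newb, newb, ← Prod.mk_zero_zero]; simp only [P_zero, Y_zero, β_zero]

/-- The response of the flux source to a change of the horizon charge. -/
def s0 : UC :=
  (2 * B.a * B.L * B.α) • (UC.X * Ring.inverse B.nh)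
    - B.q • ((1 - UC.X) *
        ((2 * B.a) • Ring.inverse B.nh + (4 * B.a ^ 3) • (UC.X ^ 3 * Ring.inverse B.nh ^ 2)))
    - B.γ * UC.X * ((8 * B.a) • UC.X - (6 * B.a) • (1 : UC) + (2 * B.a) •
        (UC.X * B.dfh * Ring.inverse B.nh))

lemma S_zero (ξ : ℝ) (k η b : UC) : B.S (0, ξ, k, η, b) = ξ • B.s0 + B.S (0, 0, 0, η, b) := by
  refine UC.ext_ev fun x hx => ?_
  have hn := (B.nh_pos hx).ne'
  simp only [S, T, Z, no, s0, n_zero, ni_zero, β_zero, v_zero, Q_zero, P_zero, E_zero, Y_zero,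
      UC.ev_add,
    UC.ev_sub, UC.ev_mul, UC.ev_smul, UC.ev_one, UC.ev_neg, UC.ev_pow, UC.ev_zero,
        UC.ev_inverse B.isUnit_nh,
    UC.ev_X hx]
  field_simp
  ring

end Background

namespace Background

variable (B : Background)

lemma integral_ρ_s0_neg : ∫ x in (0:ℝ)..1, B.ρ x * UC.ev B.s0 x < 0 := by
  set N : ℝ → ℝ := fun x =>
    B.q * (1 - x) * (2 * B.a / UC.ev B.nh x + 2 * B.a ^ 3 * x ^ 3 / UC.ev B.nh x ^ 2)
    + 2 * B.a * x * (1 - x) * UC.ev B.γ x ^ 2 with hN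
  have hNc : ContinuousOn (fun x => B.ρ x * N x) (Icc 0 1) := by
    have h1 := B.continuous_ρ
    have h2 := UC.continuous_ev B.γ
    have h3 := UC.continuous_ev B.nh
    refine h1.continuousOn.mul (ContinuousOn.add (ContinuousOn.mul (by fun_prop) (ContinuousOn.add
      (ContinuousOn.div (by fun_prop) (by fun_prop) ?_)
        (ContinuousOn.div (by fun_prop) (by fun_prop) ?_)))
      (by fun_prop))
    · exact fun x hx => (B.nh_pos hx).ne'
    · exact fun x hx => (pow_pos (B.nh_pos hx) 2).ne'
  have hS : Continuous fun x => B.ρ x * UC.ev B.s0 x := B.continuous_ρ.mul (UC.continuous_ev _)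
  have hNi : IntervalIntegrable (fun x => B.ρ x * N x) MeasureTheory.volume 0 1 :=
    ContinuousOn.intervalIntegrable (by rwa [uIcc_of_le zero_le_one])
  have hpos : 0 < ∫ x in (0:ℝ)..1, B.ρ x * N x := by
    refine intervalIntegral.intervalIntegral_pos_of_pos_on hNi (fun x hx => ?_) one_pos
    have hxI : x ∈ Icc (0:ℝ) 1 := ⟨hx.1.le, hx.2.le⟩
    have := B.nh_pos hxI
    have := B.ha
    have := B.hq
    have := B.ρ_pos ⟨hx.1, hx.2.le⟩
    have hx0 := hx.1
    have hx1 : 0 < 1 - x := by linarith [hx.2]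
    simp only [N]
    positivity
  have hFTC : ∫ x in (0:ℝ)..1, (B.ρ x * UC.ev B.s0 x + B.ρ x * N x) =
      2 * B.a * (1 - 1) * UC.ev B.γ 1 * 1 ^ 2 * B.ρ 1 - 2 * B.a *
          (1 - 0) * UC.ev B.γ 0 * 0 ^ 2 * B.ρ 0 := by
    refine intervalIntegral.integral_eq_sub_of_hasDerivAt_of_le
      (f := fun x => 2 * B.a * (1 - x) * UC.ev B.γ x * x ^ 2 * B.ρ x) zero_le_one
          ?_ (fun x hx => ?_) ?_
    · have := B.continuous_ρ
      have := UC.continuous_ev B.γ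
      fun_prop
    · have hxI : x ∈ Icc (0:ℝ) 1 := ⟨hx.1.le, hx.2.le⟩
      have hx0 := hx.1.ne'
      have hx1 : 1 - x ≠ 0 := by linarith [hx.2]
      have hn := (B.nh_pos hxI).ne'
      obtain ⟨hW, hF⟩ := B.hasDerivAt_W_flux hx
      have hnd : HasDerivAt (fun y => hPoly B.L B.a y)
          (B.L + (1 + B.L) * (2 * x) - B.a ^ 2 * (3 * x ^ 2)) x := by
        unfold hPoly
        have h := ((((hasDerivAt_id x).const_mul B.L).const_add B.L).add
          (((hasDerivAt_id x).pow 2).const_mul (1 + B.L))).sub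
              (((hasDerivAt_id x).pow 3).const_mul (B.a ^ 2))
        refine h.congr_deriv ?_
        simp
      have hnx : hPoly B.L B.a x ≠ 0 := by rwa [← B.ev_nh hxI]
      have h1 := (((hasDerivAt_id x).pow 3).const_mul (2 * B.a)).mul ((hF.mul hW).div hnd hnx)
      have h2 : HasDerivAt (fun x => 2 * B.a * (1 - x) * UC.ev B.γ x * x ^ 2 * B.ρ x) _ x :=
        h1.congr_of_eventuallyEq (by
          filter_upwards [Ioo_mem_nhds hx.1 hx.2] with y hy
          have hyI : y ∈ Icc (0:ℝ) 1 := ⟨hy.1.le, hy.2.le⟩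
          have := hy.1.ne'
          have := B.nh_pos hyI
          have hnn : hPoly B.L B.a y ≠ 0 := by rw [← B.ev_nh hyI]; exact this.ne'
          rw [B.ρ_eq hy.1]
          simp only [Pi.mul_apply, Pi.div_apply, Pi.pow_apply, id, flux, B.ev_nh hyI]
          field_simp)
      refine h2.congr_deriv ?_
      simp only [Pi.mul_apply, Pi.div_apply, Pi.pow_apply, id, flux, s0, UC.ev_add,
        UC.ev_sub, UC.ev_mul, UC.ev_smul, UC.ev_one, UC.ev_pow, UC.ev_inverse B.isUnit_nh,
        UC.ev_X hxI, B.ev_dfh hxI, B.ρ_eq hx.1, N, B.ev_nh hxI]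
      have hP : hPoly B.L B.a x = B.L + B.L * x + (1 + B.L) * x ^ 2 - B.a ^ 2 * x ^ 3 := rfl
      field_simp
      rw [hP]
      ring
    · exact (hS.intervalIntegrable _ _).add hNi
  rw [intervalIntegral.integral_add (hS.intervalIntegrable _ _) hNi] at hFTC
  norm_num at hFTC
  linarith

/-- The rescaled scalar perturbation equations of a hairy solution. -/
def IsHairy (z : Var) : Prop :=
  (∀ x ∈ Icc (0:ℝ) 1, 0 < UC.ev (B.n z) x) ∧ z.2.2.2.1 = B.newη z ∧ z.2.2.2.2 = B.newb z ∧
    ∀ x ∈ Icc (0:ℝ) 1, B.ρ x * (1 - x) * (UC.ev (B.n z) x * UC.ev z.2.2.1 x) =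
      ∫ y in (0:ℝ)..x, B.ρ y * UC.ev (B.S z) y

theorem exists_isHairy : ∃ ζ : ℝ → ℝ × UC × UC × UC, ∃ z₀, Tendsto ζ (nhds 0) (nhds z₀) ∧
    ∀ᶠ δ in nhds (0:ℝ), B.IsHairy (δ, ζ δ) := by
  obtain ⟨K, hK⟩ := B.exists_ρ_le
  obtain ⟨c, H, hc, hH⟩ := UC.exists_neumann B.continuous_ρ.continuousOn (fun y hy => B.ρ_pos hy) hK
  have hcs : c B.s0 ≠ 0 := by
    intro h
    have h1 := hc B.s0
    rw [h, zero_mul] at h1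
    exact B.integral_ρ_s0_neg.ne h1.symm
  let z₁ : Var → Var := fun z => (z.1, z.2.1, z.2.2.1, B.newη z, B.newb z)
  let z₂ : Var → Var := fun z =>
    (z.1, z.2.1 - c (B.S (z₁ z)) / c B.s0, z.2.2.1, B.newη z, B.newb z)
  let Φ : Var → ℝ × UC × UC × UC := fun z =>
    ((z₂ z).2.1, B.ni z * H (B.S (z₂ z)), B.newη z, B.newb z)
  have hz₁ : ∀ w, z₁ (0, w) = (0, w.1, w.2.1, B.newη 0, B.newb 0) := fun w => by
    simp only [z₁, newη_zero, newb_zero]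
  let ξ₀ : ℝ := -(c (B.S (0, 0, 0, B.newη 0, B.newb 0)) / c B.s0)
  have hz₂ : ∀ w, z₂ (0, w) = (0, ξ₀, w.2.1, B.newη 0, B.newb 0) := fun w => by
    simp only [z₂, hz₁, newη_zero, newb_zero]
    rw [B.S_zero, map_add, map_smul, smul_eq_mul]
    congr 2
    simp only [ξ₀]
    field_simp
    ring
  let w₀ : ℝ × UC × UC × UC :=
    (ξ₀, Ring.inverse B.nh * H (B.S (0, ξ₀, 0, B.newη 0, B.newb 0)), B.newη 0, B.newb 0)
  have hΦ0 : ∀ w, Φ (0, w) = w₀ := fun w => by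
    simp only [Φ, hz₂, newη_zero, newb_zero, ni_zero, w₀]
    rw [B.S_zero ξ₀ w.2.1, B.S_zero ξ₀ 0]
  have hu : ∀ w, IsUnit (B.n (0, w)) := fun w => by rw [n_zero]; exact B.isUnit_nh
  have hΦ : ContDiffAt ℝ 1 Φ (0, w₀) := by
    have h1 := B.contDiffAt_newη (hu w₀)
    have h2 := B.contDiffAt_newb (hu w₀)
    have h3 := B.contDiffAt_ni (hu w₀)
    have h4 : ContDiffAt ℝ 1 z₁ (0, w₀) := by fun_prop
    have h5 : ContDiffAt ℝ 1 (fun z => B.S (z₁ z)) (0, w₀) :=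
      ContDiffAt.comp (g := B.S) _ (B.contDiffAt_S (by rw [hz₁]; exact hu _)) h4
    have h6 : ContDiffAt ℝ 1 z₂ (0, w₀) := by fun_prop (disch := exact hcs)
    have h7 : ContDiffAt ℝ 1 (fun z => B.S (z₂ z)) (0, w₀) :=
      ContDiffAt.comp (g := B.S) _ (B.contDiffAt_S (by rw [hz₂]; exact hu _)) h6
    fun_prop
  obtain ⟨ζ, hζ, hfix⟩ := exists_fixedPoint_branch hΦ hΦ0
  refine ⟨ζ, w₀, hζ, ?_⟩
  have hn : Tendsto (fun δ => B.n (δ, ζ δ)) (nhds 0) (nhds B.nh) := by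
    have h1 := (B.contDiff_n.continuous.tendsto (0, w₀)).comp (tendsto_id.prodMk_nhds hζ)
    rwa [n_zero] at h1
  have hopen : IsOpen {f : UC | ∀ x, f x ∈ Ioi (0:ℝ)} := by
    have := ContinuousMap.isOpen_setOfPred_mapsTo (X := Icc (0:ℝ) 1) (Y := ℝ) isCompact_univ
        (isOpen_Ioi (a := (0:ℝ)))
    simpa [MapsTo] using this
  have hmem : B.nh ∈ {f : UC | ∀ x, f x ∈ Ioi (0:ℝ)} := fun ⟨x, hx⟩ => by
    have := B.nh_pos hx
    rwa [UC.ev_of_mem _ hx] at this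
  filter_upwards [hfix, hn.eventually (hopen.mem_nhds hmem)] with δ hδ hpos
  set w := ζ δ
  have hnpos : ∀ x ∈ Icc (0:ℝ) 1, 0 < UC.ev (B.n (δ, w)) x := fun x hx => by
    rw [UC.ev_of_mem _ hx]; exact hpos _
  have hunit := UC.isUnit_of_ev fun x hx => (hnpos x hx).ne'
  simp only [Φ, Prod.ext_iff] at hδ
  obtain ⟨h1, h2, h3, h4⟩ := hδ
  have hz : z₁ (δ, w) = (δ, w) := by simp only [z₁, h3, h4]
  have h5 : c (B.S (δ, w)) = 0 := by
    simp only [z₂, hz] at h1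
    have h6 : c (B.S (δ, w)) / c B.s0 = 0 := by linarith
    exact (div_eq_zero_iff.mp h6).resolve_right hcs
  have hz' : z₂ (δ, w) = (δ, w) := by simp only [z₂, hz, h5, zero_div, sub_zero, h3, h4]
  rw [hz'] at h2
  refine ⟨hnpos, h3.symm, h4.symm, fun x hx => ?_⟩
  have h6 := hH (B.S (δ, w)) x hx
  simp only [h5, sub_zero] at h6
  rw [← h6]
  have h7 : B.n (δ, w) * w.2.1 = H (B.S (δ, w)) := by
    rw [← h2, ni, ← mul_assoc, Ring.mul_inverse_cancel _ hunit, one_mul]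
  rw [← UC.ev_mul, h7]

end Background

/-- The static system in the compactified radial variable `x = r₊ / r`, for rescaled unknowns. -/
structure ReducedSystem (L α q : ℝ) (κ N μ Q A u du : ℝ → ℝ) : Prop where
  contDiff_κ : ContDiffOn ℝ 2 κ (Ioo 0 1)
  contDiff_N : ContDiffOn ℝ 2 N (Ioo 0 1)
  contDiff_μ : ContDiffOn ℝ 2 μ (Ioo 0 1)
  contDiff_Q : ContDiffOn ℝ 2 Q (Ioo 0 1)
  contDiff_A : ContDiffOn ℝ 2 A (Ioo 0 1)
  contDiff_u : ContDiffOn ℝ 2 u (Ioo 0 1)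
  κ_pos : ∀ x ∈ Ioo (0:ℝ) 1, 0 < κ x
  N_pos : ∀ x ∈ Ioo (0:ℝ) 1, 0 < N x
  hasDerivAt_u : ∀ x ∈ Ioo (0:ℝ) 1, HasDerivAt u (du x) x
  hasDerivAt_κ : ∀ x ∈ Ioo (0:ℝ) 1, HasDerivAt κ
    (-(κ x * (x * du x ^ 2 + q * A x ^ 2 * u x ^ 2 / (x ^ 3 * κ x ^ 2 * N x ^ 2)))) x
  N_eq : ∀ x ∈ Ioo (0:ℝ) 1, N x = 1 - 2 * μ x * x + Q x ^ 2 * x ^ 2 + L / x ^ 2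
  hasDerivAt_μ : ∀ x ∈ Ioo (0:ℝ) 1, HasDerivAt μ
    (-(L * α * u x ^ 2 / (2 * x ^ 4) + du x ^ 2 * N x / 2 + q * A x ^ 2 * u x ^ 2 /
        (2 * x ^ 4 * κ x ^ 2 * N x)
      + q * Q x * A x * u x ^ 2 / (x ^ 3 * κ x * N x))) x
  hasDerivAt_Q : ∀ x ∈ Ioo (0:ℝ) 1, HasDerivAt Q (-(q * A x * u x ^ 2 / (x ^ 4 * κ x * N x))) x
  hasDerivAt_A : ∀ x ∈ Ioo (0:ℝ) 1, HasDerivAt A (-(κ x * Q x)) x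
  hasDerivAt_flux : ∀ x ∈ Ioo (0:ℝ) 1, HasDerivAt (fun y => N y * du y)
    ((x * du x ^ 2 + q * A x ^ 2 * u x ^ 2 / (x ^ 3 * κ x ^ 2 * N x ^ 2)) * (N x * du x)
      + (L * α - q * A x ^ 2 / (κ x ^ 2 * N x)) * u x / x ^ 4) x

lemma div_mem_Ioo_of_lt {rp r : ℝ} (hrp : 0 < rp) (hr : rp < r) : rp / r ∈ Ioo (0:ℝ) 1 :=
  ⟨div_pos hrp (hrp.trans hr), (div_lt_one (hrp.trans hr)).mpr hr⟩

lemma HasDerivAt.comp_const_div {rp r u' : ℝ} {u : ℝ → ℝ} (hr : r ≠ 0)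
    (hu : HasDerivAt u u' (rp / r)) :
    HasDerivAt (fun r => u (rp / r)) (-(rp / r ^ 2 * u')) r := by
  have h : HasDerivAt (fun r : ℝ => rp / r) (-(rp / r ^ 2)) r := by
    have := (hasDerivAt_inv hr).const_mul rp
    refine this.congr_deriv ?_
    field_simp
  exact (hu.comp r h).congr_deriv (by ring)

lemma ContDiffOn.comp_const_div {rp : ℝ} {u : ℝ → ℝ} (hrp : 0 < rp) {n : WithTop ℕ∞}
    (hu : ContDiffOn ℝ n u (Ioo 0 1)) : ContDiffOn ℝ n (fun r => u (rp / r)) (Ioi rp) := by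
  refine hu.comp (t := Ioo 0 1) (f := fun r => rp / r) ?_ fun r hr => div_mem_Ioo_of_lt hrp hr
  exact contDiffOn_const.div contDiffOn_id fun r hr => (hrp.trans hr).ne'

theorem StaticSystem.of_reduced {Λ α q0 rp : ℝ} {κ N μ Q A u du : ℝ → ℝ} (hrp : 0 < rp)
    (h : ReducedSystem (-Λ / 3 * rp ^ 2) α ((q0 * rp) ^ 2) κ N μ Q A u du) :
    StaticSystem Λ α q0 rp (fun r => κ (rp / r)) (fun r => κ (rp / r) ^ 2 * N (rp / r))
      (fun r => rp * μ (rp / r)) (fun r => rp * Q (rp / r)) (fun r => A (rp / r))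
          (fun r => u (rp / r)) := by
  have hx : ∀ r ∈ Ioi rp, rp / r ∈ Ioo (0:ℝ) 1 := fun r hr => div_mem_Ioo_of_lt hrp hr
  have hr0 : ∀ r ∈ Ioi rp, r ≠ 0 := fun r hr => (hrp.trans hr).ne'
  have du' : ∀ r ∈ Ioi rp, deriv (fun r => u (rp / r)) r = -(rp / r ^ 2 * du (rp / r)) :=
    fun r hr =>
    ((h.hasDerivAt_u _ (hx r hr)).comp_const_div (hr0 r hr)).deriv
  have dκ := fun r hr => ((h.hasDerivAt_κ _ (hx r hr)).comp_const_div (hr0 r hr)).deriv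
  refine ⟨h.contDiff_κ.comp_const_div hrp,
      ((h.contDiff_κ.comp_const_div hrp).pow 2).mul (h.contDiff_N.comp_const_div hrp),
    contDiffOn_const.mul (h.contDiff_μ.comp_const_div hrp),
        contDiffOn_const.mul (h.contDiff_Q.comp_const_div hrp),
    h.contDiff_A.comp_const_div hrp, h.contDiff_u.comp_const_div hrp, fun r hr =>
      h.κ_pos _ (hx r hr),
    fun r hr => mul_pos (pow_pos (h.κ_pos _ (hx r hr)) 2) (h.N_pos _ (hx r hr)),
    fun r hr => ?_, fun r hr => ?_, fun r hr => ?_, fun r hr => ?_, fun r hr => ?_, fun r hr => ?_⟩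
  all_goals
    have hxr := hx r hr
    have hκ := (h.κ_pos _ hxr).ne'
    have hN := (h.N_pos _ hxr).ne'
    have hr1 := hr0 r hr
    have hrp' := hrp.ne'
    beta_reduce
  · rw [dκ r hr, du' r hr]
    generalize κ (rp / r) = K at *
    generalize N (rp / r) = N₁ at *
    field_simp
  · have h1 := h.N_eq _ hxr
    rw [mul_div_cancel_left₀ _ (pow_ne_zero 2 hκ), h1]
    field_simp
  · rw [((h.hasDerivAt_μ _ hxr).comp_const_div hr1 |>.const_mul rp).deriv, du' r hr]
    generalize κ (rp / r) = K at *
    generalize N (rp / r) = N₁ at *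
    field_simp
  · rw [((h.hasDerivAt_Q _ hxr).comp_const_div hr1 |>.const_mul rp).deriv]
    generalize κ (rp / r) = K at *
    generalize N (rp / r) = N₁ at *
    field_simp
  · rw [((h.hasDerivAt_A _ hxr).comp_const_div hr1).deriv]
    field_simp
  · have h1 : HasDerivAt (fun s => s ^ 2 * (κ (rp / s) ^ 2 * N (rp / s) / κ (rp / s) ^ 2)
        * deriv (fun r => u (rp / r)) s) _ r :=
      (((h.hasDerivAt_flux _ hxr).comp_const_div hr1).const_mul (-rp)).congr_of_eventuallyEq (by
        filter_upwards [Ioi_mem_nhds hr] with s hs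
        rw [du' s hs, mul_div_cancel_left₀ _ (pow_ne_zero 2 (h.κ_pos _ (hx s hs)).ne')]
        have := hr0 s hs
        field_simp)
    rw [h1.deriv, dκ r hr, du' r hr]
    generalize κ (rp / r) = K at *
    generalize N (rp / r) = N₁ at *
    field_simp
    ring

lemma hasDerivAt_of_eq_tail {F g : ℝ → ℝ} (hg : ContinuousOn g (Ioo 0 1))
    (hi : IntervalIntegrable g MeasureTheory.volume 0 1)
    (hF : ∀ x ∈ Icc (0:ℝ) 1, F x = ∫ y in x..1, g y) {x : ℝ} (hx : x ∈ Ioo (0:ℝ) 1) :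
    HasDerivAt F (-g x) x := by
  have hc : ContinuousAt g x := hg.continuousAt (Ioo_mem_nhds hx.1 hx.2)
  have h1 : HasDerivAt (fun x => ∫ y in x..1, g y) (-g x) x :=
    intervalIntegral.integral_hasDerivAt_left
      (hi.mono_set (by
        rw [uIcc_of_le hx.2.le, uIcc_of_le zero_le_one]; exact Icc_subset_Icc_left hx.1.le))
      (hg.stronglyMeasurableAtFilter isOpen_Ioo x hx) hc
  refine h1.congr_of_eventuallyEq ?_
  filter_upwards [Ioo_mem_nhds hx.1 hx.2] with y hy using hF y ⟨hy.1.le, hy.2.le⟩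

/-- The Klein–Gordon equation for a perturbed scalar in terms of the rescaled flux of the perturbation. -/
lemma kleinGordon_identity
    {x W γ δ a nh n no b β k v Y xD L α q fh' Z ξ fl fl' f fh f' F F' S T : ℝ}
    (hx : x ≠ 0) (h1x : 1 - x ≠ 0) (hW : W ≠ 0) (hnh : nh ≠ 0) (hnn : n ≠ 0)
    (hn : n = nh + δ * x ^ 2 * no) (hβ : β = a + δ * (ξ + b)) (hfh : fh = (1 - x) * nh)
        (hf : f = (1 - x) * n)
    (hfl : fl = (1 - x) * nh * γ * W / x ^ 3)
    (hfl' : fl' = (L * α - q * x ^ 2 * (1 - x) * a ^ 2 / nh) / x ^ 4 * W)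
    (hf' : f' = fh' + δ * x ^ 2 * Z) (hF : F = W ^ 2 / x ^ 2 * (1 - x) * (n * k))
        (hF' : F' = W ^ 2 / x ^ 2 * S)
    (hT : T = -(L * α * (no * nh⁻¹)) - q *
        ((1 - x) * ((ξ + b) * nh - a * (x ^ 2 * no)) * (β * nh + a * n)
      * n⁻¹ * nh⁻¹ ^ 2) - γ * x * (Z - no * fh' * nh⁻¹) + x * xD * Y * (1 - x) * n * γ)
    (hS : S = T * v + δ * (x ^ 2 * xD * Y * (1 - x) * n * k)) :
    ((f' * fh - f * fh') / fh ^ 2 * fl + f / fh * fl') * v + f / fh * fl * (δ * k)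
        + (δ * F' * W - δ * F * (γ * W / x)) / W ^ 2
      = δ * (x ^ 2 * xD) * Y * (f / fh * fl * v + δ * F / W)
        + (L * α - q * x ^ 2 * (1 - x) * β ^ 2 / n) / x ^ 4 * (W * v) := by
  subst hF' hF hfl hfl' hS hT hf' hfh hf hβ
  field_simp
  subst hn
  ring

namespace Background

variable (B : Background) {z : Var} {x : ℝ}

lemma ev_n (hx : x ∈ Icc (0:ℝ) 1) : UC.ev (B.n z) x = UC.ev B.nh x
    - z.1 * z.2.1 * (2 * B.a + z.1 * z.2.1) * x ^ 3 + z.1 * (x ^ 2 * UC.ev z.2.2.2.1 x) := by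
  simp only [n, UC.ev_add, UC.ev_sub, UC.ev_mul, UC.ev_smul, UC.ev_pow, UC.ev_X hx]

lemma ev_no (hx : x ∈ Icc (0:ℝ) 1) : UC.ev (B.no z) x = UC.ev z.2.2.2.1 x
    - z.2.1 * (2 * B.a + z.1 * z.2.1) * x := by
  simp only [no, UC.ev_sub, UC.ev_smul, UC.ev_X hx]

lemma ev_n_eq_add (hx : x ∈ Icc (0:ℝ) 1) :
    UC.ev (B.n z) x = UC.ev B.nh x + z.1 * x ^ 2 * UC.ev (B.no z) x := by
  rw [B.ev_n hx, B.ev_no hx]; ring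

lemma ev_β : UC.ev (B.β z) x = B.e z + z.1 * UC.ev z.2.2.2.2 x := by
  simp only [β, UC.ev_add, UC.ev_smul, UC.ev_one, mul_one]

lemma ev_v (hx : x ∈ Icc (0:ℝ) 1) :
    UC.ev (B.v z) x = 1 - z.1 * ((1 - x) * UC.ev (B.avg z.2.2.1) x) := by
  simp only [v, UC.ev_sub, UC.ev_smul, UC.ev_one, UC.ev_mul, UC.ev_X hx]

lemma ev_s : UC.ev (B.s z) x = UC.ev B.h x * UC.ev (B.v z) x := rfl

lemma ev_g (hx : x ∈ Icc (0:ℝ) 1) : UC.ev (B.g z) x =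
    UC.ev B.h x * (UC.ev B.γ x * UC.ev (B.v z) x + z.1 * (x * UC.ev z.2.2.1 x)) := by
  simp only [g, UC.ev_add, UC.ev_smul, UC.ev_mul, UC.ev_X hx]

lemma ev_Q (hx : x ∈ Icc (0:ℝ) 1) : UC.ev (B.Q z) x =
    B.e z + z.1 * B.q * ((1 - x) * UC.ev (B.chargeAvg (B.P z)) x) := by
  simp only [Q, UC.ev_add, UC.ev_sub, UC.ev_mul, UC.ev_smul, UC.ev_one, mul_one, UC.ev_X hx]

lemma hasDerivAt_massAvg (f : UC) (hx : x ∈ Ioo (0:ℝ) 1) :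
    HasDerivAt (fun x => (1 - x) * UC.ev (B.massAvg f) x) (-(x ^ (B.D - 1) * UC.ev f x)) x := by
  have := UC.continuous_ev f
  refine hasDerivAt_of_eq_tail (g := fun x => x ^ (B.D - 1) * UC.ev f x) ?_ ?_ (B.massAvg_spec f) hx
  · exact ContinuousOn.mul (fun x hx => (continuousAt_rpow_const _ _ (.inl hx.1.ne')).continuousWithinAt)
      this.continuousOn
  · exact (intervalIntegral.intervalIntegrable_rpow' (by linarith [B.hD])).mul_continuousOn this.continuousOn

lemma hasDerivAt_chargeAvg (f : UC) (hx : x ∈ Ioo (0:ℝ) 1) :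
    HasDerivAt (fun x => (1 - x) * UC.ev (B.chargeAvg f) x) (-(x ^ (1 + B.D) * UC.ev f x)) x := by
  have h1 := UC.continuous_ev f
  have h2 : Continuous fun x : ℝ => x ^ (1 + B.D) * UC.ev f x :=
    (continuous_rpow_const (by linarith [B.hD])).mul h1
  exact hasDerivAt_of_eq_tail h2.continuousOn (h2.intervalIntegrable _ _) (B.chargeAvg_spec f) hx

lemma hasDerivAt_avg (f : UC) (hx : x ∈ Ioo (0:ℝ) 1) :
    HasDerivAt (fun x => (1 - x) * UC.ev (B.avg f) x) (-UC.ev f x) x := by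
  have h2 := UC.continuous_ev f
  exact hasDerivAt_of_eq_tail h2.continuousOn (h2.intervalIntegrable _ _) (B.avg_spec f) hx

lemma hasDerivAt_v (hx : x ∈ Ioo (0:ℝ) 1) :
    HasDerivAt (UC.ev (B.v z)) (z.1 * UC.ev z.2.2.1 x) x := by
  have h := ((B.hasDerivAt_avg z.2.2.1 hx).const_mul z.1).const_sub 1
  refine (h.congr_of_eventuallyEq ?_).congr_deriv (by ring)
  filter_upwards [Ioo_mem_nhds hx.1 hx.2] with y hy using B.ev_v ⟨hy.1.le, hy.2.le⟩

lemma hasDerivAt_Q (hx : x ∈ Ioo (0:ℝ) 1) :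
    HasDerivAt (UC.ev (B.Q z)) (-(z.1 * B.q * (x ^ (1 + B.D) * UC.ev (B.P z) x))) x := by
  have h := ((B.hasDerivAt_chargeAvg (B.P z) hx).const_mul (z.1 * B.q)).const_add (B.e z)
  refine (h.congr_of_eventuallyEq ?_).congr_deriv (by ring)
  filter_upwards [Ioo_mem_nhds hx.1 hx.2] with y hy using B.ev_Q ⟨hy.1.le, hy.2.le⟩

/-- Rescaled Hawking mass. -/
def mass (z : Var) (x : ℝ) : ℝ :=
  (1 + B.L + B.e z ^ 2) / 2 + z.1 * ((1 - x) * UC.ev (B.massAvg (B.E z)) x)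

lemma hasDerivAt_mass (hx : x ∈ Ioo (0:ℝ) 1) :
    HasDerivAt (B.mass z) (-(z.1 * (x ^ (B.D - 1) * UC.ev (B.E z) x))) x :=
  (((B.hasDerivAt_massAvg (B.E z) hx).const_mul z.1).const_add _).congr_deriv (by ring)

variable (hz : B.IsHairy z)
include hz

lemma one_sub_mul_η (hx : x ∈ Icc (0:ℝ) 1) : (1 - x) * UC.ev z.2.2.2.1 x =
    B.q * x ^ 2 * ((1 - x) * UC.ev (B.chargeAvg (B.P z)) x) * (UC.ev (B.Q z) x + B.e z)
      - 2 * x * ((1 - x) * UC.ev (B.massAvg (B.E z)) x) := by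
  rw [hz.2.1]
  simp only [newη, UC.ev_add, UC.ev_sub, UC.ev_mul, UC.ev_smul, UC.ev_one, UC.ev_pow, UC.ev_X hx]
  ring

lemma lapse_eq (hx : x ∈ Icc (0:ℝ) 1) : (1 - x) * UC.ev (B.n z) x =
    B.L + x ^ 2 - 2 * B.mass z x * x ^ 3 + UC.ev (B.Q z) x ^ 2 * x ^ 4 := by
  have h := B.one_sub_mul_η hz hx
  rw [B.ev_n hx, B.ev_nh hx, mass, hPoly]
  have hQ := B.ev_Q (z := z) hx
  have he : B.e z = B.a + z.1 * z.2.1 := rfl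
  rw [hQ] at h ⊢
  linear_combination z.1 * x ^ 2 * h + (x ^ 3 - x ^ 4) * (B.a + z.1 * z.2.1 + B.e z) * he

lemma hasDerivAt_lapse (hx : x ∈ Ioo (0:ℝ) 1) :
    HasDerivAt (fun x => (1 - x) * UC.ev (B.n z) x)
        (UC.ev B.dfh x + z.1 * x ^ 2 * UC.ev (B.Z z) x) x := by
  have hxI : x ∈ Icc (0:ℝ) 1 := ⟨hx.1.le, hx.2.le⟩
  have h1 := ((((hasDerivAt_id x).pow 2).const_add B.L).sub
    (((B.hasDerivAt_mass (z := z) hx).const_mul 2).mul ((hasDerivAt_id x).pow 3))).add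
    (((B.hasDerivAt_Q (z := z) hx).pow 2).mul ((hasDerivAt_id x).pow 4))
  refine (h1.congr_of_eventuallyEq ?_).congr_deriv ?_
  · filter_upwards [Ioo_mem_nhds hx.1 hx.2] with y hy
    rw [B.lapse_eq hz ⟨hy.1.le, hy.2.le⟩]; rfl
  · have hQ := B.ev_Q (z := z) hxI
    have he : B.e z = B.a + z.1 * z.2.1 := rfl
    have hxD : x ^ (1 + B.D) = x * x ^ B.D := by rw [rpow_add hx.1, rpow_one]
    have hxD' : x ^ (B.D - 1) = x ^ B.D / x := by rw [rpow_sub hx.1, rpow_one]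
    have hx0 := hx.1.ne'
    simp only [Z, UC.ev_add, UC.ev_sub, UC.ev_mul, UC.ev_smul, UC.ev_one, UC.ev_pow, UC.ev_X hxI,
        B.ev_dfh hxI,
      B.ev_xD hxI, Pi.pow_apply, id, mass, hxD, hxD', hQ, he]
    field_simp
    ring

lemma hasDerivAt_F (hx : x ∈ Ioo (0:ℝ) 1) :
    HasDerivAt (fun x => B.ρ x * (1 - x) * (UC.ev (B.n z) x * UC.ev z.2.2.1 x))
        (B.ρ x * UC.ev (B.S z) x) x := by
  have hc : Continuous fun y => B.ρ y * UC.ev (B.S z) y := B.continuous_ρ.mul (UC.continuous_ev _)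
  refine (hc.integral_hasStrictDerivAt 0 x).hasDerivAt.congr_of_eventuallyEq ?_
  filter_upwards [Ioo_mem_nhds hx.1 hx.2] with y hy using hz.2.2.2 y ⟨hy.1.le, hy.2.le⟩

lemma ev_ni : UC.ev (B.ni z) x = (UC.ev (B.n z) x)⁻¹ :=
  UC.ev_inverse (UC.isUnit_of_ev fun x hx => (hz.1 x hx).ne') x

omit hz in
/-- The rescaled scalar field. -/
def profile (z : Var) (x : ℝ) : ℝ := x ^ B.σ * UC.ev (B.s z) x

omit hz in
/-- The derivative of the rescaled scalar field. -/
def dprofile (z : Var) (x : ℝ) : ℝ := x ^ (B.σ - 1) * UC.ev (B.g z) x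

end Background

lemma contDiffOn_succ_of_hasDerivAt {f f' : ℝ → ℝ} {n : ℕ} {s : Set ℝ} (hs : IsOpen s)
    (hf : ∀ x ∈ s, HasDerivAt f (f' x) x) (hf' : ContDiffOn ℝ n f' s) :
        ContDiffOn ℝ (n + 1) f s := by
  rw [contDiffOn_succ_iff_deriv_of_isOpen hs]
  refine ⟨fun x hx => (hf x hx).differentiableAt.differentiableWithinAt, ?_,
    hf'.congr fun x hx => (hf x hx).deriv⟩
  intro h
  exact absurd h (by simp)

lemma contDiffOn_one_of_hasDerivAt {f f' : ℝ → ℝ} {s : Set ℝ} (hs : IsOpen s)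
    (hf : ∀ x ∈ s, HasDerivAt f (f' x) x) (hf' : ContinuousOn f' s) : ContDiffOn ℝ 1 f s := by
  have := contDiffOn_succ_of_hasDerivAt (n := 0) hs hf (by simpa using hf')
  simpa using this

lemma contDiffOn_two_of_hasDerivAt {f f' : ℝ → ℝ} {s : Set ℝ} (hs : IsOpen s)
    (hf : ∀ x ∈ s, HasDerivAt f (f' x) x) (hf' : ContDiffOn ℝ 1 f' s) : ContDiffOn ℝ 2 f s := by
  have := contDiffOn_succ_of_hasDerivAt (n := 1) hs hf (by simpa using hf')
  norm_num at this
  exact this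

namespace Background

variable (B : Background) {z : Var} {x : ℝ}

/-- The logarithm of the normalised redshift factor. -/
def logκ (z : Var) (x : ℝ) : ℝ := z.1 * ((1 - x) * UC.ev (B.avg (UC.X ^ 2 * B.xD * B.Y z)) x)

lemma ev_Y_mul (hx : x ∈ Icc (0:ℝ) 1) :
    UC.ev (UC.X ^ 2 * B.xD * B.Y z) x = x ^ 2 * x ^ B.D * UC.ev (B.Y z) x := by
  simp only [UC.ev_mul, UC.ev_pow, UC.ev_X hx, B.ev_xD hx]

lemma hasDerivAt_logκ (hx : x ∈ Ioo (0:ℝ) 1) :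
    HasDerivAt (B.logκ z) (-(z.1 * (x ^ 2 * x ^ B.D * UC.ev (B.Y z) x))) x := by
  refine ((B.hasDerivAt_avg (UC.X ^ 2 * B.xD * B.Y z) hx).const_mul z.1).congr_deriv ?_
  rw [B.ev_Y_mul ⟨hx.1.le, hx.2.le⟩]; ring

lemma hasDerivAt_profile (hx : x ∈ Ioo (0:ℝ) 1) : HasDerivAt (B.profile z) (B.dprofile z x) x := by
  have hxI : x ∈ Icc (0:ℝ) 1 := ⟨hx.1.le, hx.2.le⟩
  have h := (B.hasDerivAt_W_flux hx).1.mul (B.hasDerivAt_v (z := z) hx)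
  refine (h.congr_of_eventuallyEq (Eventually.of_forall fun y => ?_)).congr_deriv ?_
  · simp only [profile, ev_s, W, Pi.mul_apply]; ring
  · rw [dprofile, B.ev_g hxI, rpow_sub hx.1, rpow_one, W]
    have := hx.1.ne'
    field_simp

variable (hz : B.IsHairy z)
include hz

lemma hasDerivAt_pot (hx : x ∈ Ioo (0:ℝ) 1) : HasDerivAt (fun x => (1 - x) * UC.ev (B.β z) x)
    (-(UC.ev (B.Q z) x - z.1 * (x ^ 2 * x ^ B.D * UC.ev (B.Y z) x) *
        ((1 - x) * UC.ev (B.β z) x))) x := by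
  have hxI : x ∈ Icc (0:ℝ) 1 := ⟨hx.1.le, hx.2.le⟩
  have h1 := (((hasDerivAt_id x).const_sub 1).mul_const (B.e z)).add
    ((B.hasDerivAt_avg (B.q • ((1 - UC.X) * B.chargeAvg (B.P z)) - UC.X ^ 2 * B.xD * B.Y z *
        (1 - UC.X) * B.β z)
      hx).const_mul z.1)
  refine (h1.congr_of_eventuallyEq (Eventually.of_forall fun y => ?_)).congr_deriv ?_
  · have : UC.ev z.2.2.2.2 y = UC.ev (B.newb z) y := by rw [← hz.2.2.1]
    simp only [Pi.add_apply, ev_β, id, this, newb]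
    ring
  · simp only [UC.ev_sub, UC.ev_smul, UC.ev_mul, UC.ev_one, UC.ev_pow, UC.ev_X hxI, B.ev_xD hxI, B.ev_Q hxI]
    ring

lemma hasDerivAt_scalarFlux (hx : x ∈ Ioo (0:ℝ) 1) :
    HasDerivAt (fun y => (1 - y) * UC.ev (B.n z) y / y ^ 2 * B.dprofile z y)
      (z.1 * (x ^ 2 * x ^ B.D) * UC.ev (B.Y z) x *
          ((1 - x) * UC.ev (B.n z) x / x ^ 2 * B.dprofile z x)
        + (B.L * B.α - B.q * x ^ 2 * (1 - x) * UC.ev (B.β z) x ^ 2 / UC.ev (B.n z) x) / x ^ 4 *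
            B.profile z x) x := by
  have hxI : x ∈ Icc (0:ℝ) 1 := ⟨hx.1.le, hx.2.le⟩
  have hx0 := hx.1.ne'
  have hx1 : 1 - x ≠ 0 := by linarith [hx.2]
  have hnh := (B.nh_pos hxI).ne'
  have hn := (hz.1 x hxI).ne'
  have hW := (B.W_pos ⟨hx.1, hx.2.le⟩).ne'
  have hfh : HasDerivAt (fun x => (1 - x) * UC.ev B.nh x) (UC.ev B.dfh x) x := by
    have h := ((((hasDerivAt_id x).pow 2).const_add B.L).sub
      (((hasDerivAt_id x).pow 3).const_mul (1 + B.L + B.a ^ 2))).add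
          (((hasDerivAt_id x).pow 4).const_mul (B.a ^ 2))
    refine (h.congr_of_eventuallyEq ?_).congr_deriv ?_
    · filter_upwards [Ioo_mem_nhds hx.1 hx.2] with y hy
      simp only [B.ev_nh ⟨hy.1.le, hy.2.le⟩, Pi.add_apply, Pi.sub_apply, Pi.pow_apply, id, hPoly]
      ring
    · rw [B.ev_dfh hxI]; simp; ring
  have hf := B.hasDerivAt_lapse hz hx
  have hF := B.hasDerivAt_F hz hx
  obtain ⟨hWd, hfl⟩ := B.hasDerivAt_W_flux hx
  have heq : ∀ y ∈ Ioo (0:ℝ) 1, (1 - y) * UC.ev (B.n z) y / y ^ 2 * B.dprofile z y =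
      (1 - y) * UC.ev (B.n z) y / ((1 - y) * UC.ev B.nh y) * B.flux y * UC.ev (B.v z) y +
        z.1 * (B.ρ y * (1 - y) * (UC.ev (B.n z) y * UC.ev z.2.2.1 y)) / B.W y := by
    intro y hy
    have hyI : y ∈ Icc (0:ℝ) 1 := ⟨hy.1.le, hy.2.le⟩
    have hy0 := hy.1.ne'
    have hy1 : 1 - y ≠ 0 := by linarith [hy.2]
    have hnh := (B.nh_pos hyI).ne'
    have hhy := (B.h_pos y hyI).ne'
    have hyσ := (rpow_pos_of_pos hy.1 B.σ).ne'
    rw [B.ρ_eq hy.1, dprofile, flux, B.ev_g hyI, rpow_sub hy.1, rpow_one, W]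
    field_simp
  have hfhne : (1 - x) * UC.ev B.nh x ≠ 0 := mul_ne_zero hx1 hnh
  have h := (((hf.div hfh hfhne).mul hfl).mul (B.hasDerivAt_v (z := z) hx)).add
      ((hF.const_mul z.1).div hWd hW)
  refine (h.congr_of_eventuallyEq ?_).congr_deriv ?_
  · filter_upwards [Ioo_mem_nhds hx.1 hx.2] with y hy using heq y hy
  · have hprof : B.profile z x = B.W x * UC.ev (B.v z) x := by
      simp only [profile, ev_s, W]; ring
    rw [heq x hx, hprof]
    have hρ := B.ρ_eq hx.1
    refine (kleinGordon_identity (T := UC.ev (B.T z) x) (S := UC.ev (B.S z) x)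
        (b := UC.ev z.2.2.2.2 x)
      (no := UC.ev (B.no z) x) (ξ := z.2.1) (γ := UC.ev B.γ x) (a := B.a) (Z := UC.ev (B.Z z) x)
      (fh' := UC.ev B.dfh x) (xD := x ^ B.D) (k := UC.ev z.2.2.1 x)
      hx0 hx1 hW hnh hn (B.ev_n_eq_add hxI) ?_ rfl rfl rfl rfl rfl ?_ ?_ ?_ ?_)
    · rw [ev_β]; simp only [e]; ring
    · rw [hρ]
    · rw [hρ]
    · simp only [T, UC.ev_add, UC.ev_sub, UC.ev_mul, UC.ev_smul, UC.ev_one, UC.ev_neg, UC.ev_pow,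
        UC.ev_inverse B.isUnit_nh, B.ev_ni hz, UC.ev_X hxI, B.ev_xD hxI]
      ring
    · simp only [S, UC.ev_add, UC.ev_mul, UC.ev_smul, UC.ev_sub, UC.ev_one, UC.ev_pow, UC.ev_X hxI, B.ev_xD hxI]

end Background

namespace Background

variable (B : Background) {z : Var} {x : ℝ}

lemma profile_sq (hx : 0 < x) : B.profile z x ^ 2 = x ^ 3 * x ^ B.D * UC.ev (B.s z) x ^ 2 := by
  have : (x ^ B.σ) ^ 2 = x ^ 3 * x ^ B.D := by
    rw [← rpow_natCast (x ^ B.σ), ← rpow_mul hx.le, ← rpow_natCast x 3, ← rpow_add hx]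
    congr 1
    push_cast
    linarith [B.hσ]
  rw [profile, mul_pow, this]

lemma dprofile_sq (hx : 0 < x) : B.dprofile z x ^ 2 = x * x ^ B.D * UC.ev (B.g z) x ^ 2 := by
  have : (x ^ (B.σ - 1)) ^ 2 = x * x ^ B.D := by
    rw [← rpow_natCast (x ^ (B.σ - 1)), ← rpow_mul hx.le]
    conv_rhs => rw [← rpow_one_add' hx.le (by linarith [B.hD])]
    congr 1
    push_cast
    linarith [B.hσ]
  rw [dprofile, mul_pow, this]

lemma contDiffOn_rpow (c : ℝ) {n : WithTop ℕ∞} : ContDiffOn ℝ n (fun x : ℝ => x ^ c) (Ioo 0 1) :=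
  fun _ hx => (contDiffAt_rpow_const_of_ne hx.1.ne').contDiffWithinAt

variable (hz : B.IsHairy z)
include hz

lemma ev_P (x : ℝ) : UC.ev (B.P z) x =
    UC.ev (B.β z) x * (UC.ev (B.n z) x)⁻¹ * UC.ev (B.s z) x ^ 2 := by
  simp only [P, UC.ev_mul, UC.ev_pow, B.ev_ni hz]

lemma ev_Y (hx : x ∈ Icc (0:ℝ) 1) : UC.ev (B.Y z) x = UC.ev (B.g z) x ^ 2
    + B.q * (x ^ 2 * UC.ev (B.β z) x ^ 2 * UC.ev (B.s z) x ^ 2 * (UC.ev (B.n z) x)⁻¹ ^ 2) := by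
  simp only [Y, UC.ev_add, UC.ev_smul, UC.ev_mul, UC.ev_pow, B.ev_ni hz, UC.ev_X hx]

lemma ev_E (hx : x ∈ Icc (0:ℝ) 1) : UC.ev (B.E z) x = B.L * B.α / 2 * UC.ev (B.s z) x ^ 2
    + 1 / 2 * ((1 - x) * UC.ev (B.n z) x * UC.ev (B.g z) x ^ 2)
    + B.q / 2 * (x ^ 2 * (1 - x) * UC.ev (B.β z) x ^ 2 * UC.ev (B.s z) x ^ 2 * (UC.ev (B.n z) x)⁻¹)
    + B.q * (x ^ 3 * UC.ev (B.Q z) x * UC.ev (B.P z) x) := by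
  simp only [E, UC.ev_add, UC.ev_sub, UC.ev_one, UC.ev_smul, UC.ev_mul, UC.ev_pow, B.ev_ni hz,
      UC.ev_X hx]

lemma contDiffOn_ev_n {m : ℕ} (hm : ContDiffOn ℝ m (B.mass z) (Ioo 0 1))
    (hQ : ContDiffOn ℝ m (UC.ev (B.Q z)) (Ioo 0 1)) : ContDiffOn ℝ m (UC.ev (B.n z)) (Ioo 0 1) := by
  have hX : ContDiffOn ℝ m (fun x : ℝ => x) (Ioo 0 1) := contDiffOn_id
  have h : ContDiffOn ℝ
      m (fun x => (B.L + x ^ 2 - 2 * B.mass z x * x ^ 3 + UC.ev (B.Q z) x ^ 2 * x ^ 4) / (1 - x))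
      (Ioo 0 1) :=
    (((contDiffOn_const.add (hX.pow 2)).sub ((contDiffOn_const.mul hm).mul (hX.pow 3))).add
      ((hQ.pow 2).mul (hX.pow 4))).div (contDiffOn_const.sub hX) fun x hx => by linarith [hx.2]
  refine h.congr fun x hx => ?_
  rw [← B.lapse_eq hz ⟨hx.1.le, hx.2.le⟩, mul_div_cancel_left₀]
  linarith [hx.2]

/-- The functions from which a hairy solution is built are twice continuously differentiable. -/
lemma contDiffOn_of_isHairy :
    ContDiffOn ℝ 2 (UC.ev (B.Q z)) (Ioo 0 1) ∧ ContDiffOn ℝ 2 (B.mass z) (Ioo 0 1) ∧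
    ContDiffOn ℝ 2 (B.logκ z) (Ioo 0 1) ∧
        ContDiffOn ℝ 2 (fun x => (1 - x) * UC.ev (B.β z) x) (Ioo 0 1) ∧
    ContDiffOn ℝ 2 (B.profile z) (Ioo 0 1) := by
  have hI : ∀ x ∈ Ioo (0:ℝ) 1, x ∈ Icc (0:ℝ) 1 := fun x hx => ⟨hx.1.le, hx.2.le⟩
  have hc : ∀ (f : UC) , ContinuousOn (UC.ev f) (Ioo 0 1) := fun f =>
    (UC.continuous_ev f).continuousOn
  have hp : ∀ c : ℝ, ContinuousOn (fun x : ℝ => x ^ c) (Ioo 0 1) := fun c =>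
    (contDiffOn_rpow c (n := 0)).continuousOn
  have hn0 : ∀ x ∈ Ioo (0:ℝ) 1, UC.ev (B.n z) x ≠ 0 := fun x hx => (hz.1 x (hI x hx)).ne'
  have hx0 : ∀ x ∈ Ioo (0:ℝ) 1, x ≠ 0 := fun x hx => hx.1.ne'
  have h1x : ∀ x ∈ Ioo (0:ℝ) 1, 1 - x ≠ 0 := fun x hx => by linarith [hx.2]
  have hX : ContDiffOn ℝ 1 (fun x : ℝ => x) (Ioo 0 1) := contDiffOn_id
  have hX1 : ContDiffOn ℝ 1 (fun x : ℝ => 1 - x) (Ioo 0 1) := contDiffOn_const.sub hX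
  have hk : ∀ c : ℝ, ContDiffOn ℝ 1 (fun _ : ℝ => c) (Ioo 0 1) := fun c => contDiffOn_const
  have Q1 : ContDiffOn ℝ 1 (UC.ev (B.Q z)) (Ioo 0 1) :=
    contDiffOn_one_of_hasDerivAt isOpen_Ioo (fun x hx => B.hasDerivAt_Q hx)
      (continuousOn_const.mul ((hp _).mul (hc _))).neg
  have m1 : ContDiffOn ℝ 1 (B.mass z) (Ioo 0 1) :=
    contDiffOn_one_of_hasDerivAt isOpen_Ioo (fun x hx => B.hasDerivAt_mass hx)
      (continuousOn_const.mul ((hp _).mul (hc _))).neg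
  have n1 : ContDiffOn ℝ 1 (UC.ev (B.n z)) (Ioo 0 1) := by
    simpa using B.contDiffOn_ev_n hz (m := 1) (by simpa using m1) (by simpa using Q1)
  have v1 : ContDiffOn ℝ 1 (UC.ev (B.v z)) (Ioo 0 1) :=
    contDiffOn_one_of_hasDerivAt isOpen_Ioo (fun x hx => B.hasDerivAt_v hx)
        (continuousOn_const.mul (hc _))
  have a1 : ContDiffOn ℝ 1 (fun x => (1 - x) * UC.ev (B.β z) x) (Ioo 0 1) := by
    refine contDiffOn_one_of_hasDerivAt isOpen_Ioo (fun x hx => B.hasDerivAt_pot hz hx) ?_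
    have := hc (B.Q z); have := hc (B.Y z); have := hc (B.β z); have := hp B.D
    fun_prop
  have β1 : ContDiffOn ℝ 1 (UC.ev (B.β z)) (Ioo 0 1) := by
    refine (a1.div hX1 h1x).congr fun x hx => ?_
    rw [Pi.div_apply, mul_div_cancel_left₀ _ (h1x x hx)]
  have u1 : ContDiffOn ℝ 1 (B.profile z) (Ioo 0 1) := by
    refine contDiffOn_one_of_hasDerivAt isOpen_Ioo (fun x hx => B.hasDerivAt_profile hx) ?_
    exact (hp _).mul (hc _)
  have s1 : ContDiffOn ℝ 1 (UC.ev (B.s z)) (Ioo 0 1) := by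
    refine (u1.div (contDiffOn_rpow B.σ) fun x hx => (rpow_pos_of_pos hx.1 _).ne').congr fun
        x hx => ?_
    rw [Pi.div_apply, profile, mul_div_cancel_left₀ _ (rpow_pos_of_pos hx.1 _).ne']
  have F1 : ContDiffOn ℝ 1 (fun y => (1 - y) * UC.ev (B.n z) y / y ^ 2 * B.dprofile z y)
      (Ioo 0 1) := by
    refine contDiffOn_one_of_hasDerivAt isOpen_Ioo (fun x hx => B.hasDerivAt_scalarFlux hz hx) ?_
    have := hc (B.n z); have := hc (B.Y z); have := hc (B.β z); have := hp B.D
    have hdp : ContinuousOn (B.dprofile z) (Ioo 0 1) := (hp _).mul (hc _)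
    have := u1.continuousOn
    have h1 : ContinuousOn (fun x : ℝ => (1 - x) * UC.ev (B.n z) x / x ^ 2) (Ioo 0 1) :=
      ContinuousOn.div (by fun_prop) (by fun_prop) fun x hx => pow_ne_zero 2 (hx0 x hx)
    have h2 : ContinuousOn
        (fun x : ℝ => B.q * x ^ 2 * (1 - x) * UC.ev (B.β z) x ^ 2 / UC.ev (B.n z) x) (Ioo 0 1) :=
      ContinuousOn.div (by fun_prop) (by fun_prop) hn0
    have h3 : ContinuousOn
        (fun x : ℝ => (B.L * B.α - B.q * x ^ 2 * (1 - x) * UC.ev (B.β z) x ^ 2 / UC.ev (B.n z) x)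
        / x ^ 4) (Ioo 0 1) :=
      ContinuousOn.div (continuousOn_const.sub h2)
          (by fun_prop) fun x hx => pow_ne_zero 4 (hx0 x hx)
    fun_prop
  have du1 : ContDiffOn ℝ 1 (B.dprofile z) (Ioo 0 1) := by
    have h1 : ContDiffOn ℝ 1 (fun x : ℝ => (1 - x) * UC.ev (B.n z) x / x ^ 2) (Ioo 0 1) :=
      (hX1.mul n1).div (hX.pow 2) fun x hx => pow_ne_zero 2 (hx0 x hx)
    have h1n : ∀ x ∈ Ioo (0:ℝ) 1, (1 - x) * UC.ev (B.n z) x / x ^ 2 ≠ 0 := fun x hx =>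
      div_ne_zero (mul_ne_zero (h1x x hx) (hn0 x hx)) (pow_ne_zero 2 (hx0 x hx))
    refine (F1.div h1 h1n).congr fun x hx => ?_
    rw [Pi.div_apply, mul_div_cancel_left₀ _ (h1n x hx)]
  have g1 : ContDiffOn ℝ 1 (UC.ev (B.g z)) (Ioo 0 1) := by
    refine (du1.div (contDiffOn_rpow (B.σ - 1)) fun x hx => (rpow_pos_of_pos hx.1 _).ne').congr fun
        x hx => ?_
    rw [Pi.div_apply, dprofile, mul_div_cancel_left₀ _ (rpow_pos_of_pos hx.1 _).ne']
  have ni1 : ContDiffOn ℝ 1 (fun x => (UC.ev (B.n z) x)⁻¹) (Ioo 0 1) := n1.inv hn0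
  have P1 : ContDiffOn ℝ 1 (UC.ev (B.P z)) (Ioo 0 1) :=
    ((β1.mul ni1).mul (s1.pow 2)).congr fun x hx => B.ev_P hz x
  have Y1 : ContDiffOn ℝ 1 (UC.ev (B.Y z)) (Ioo 0 1) :=
    ((g1.pow 2).add ((hk _).mul
        ((((hX.pow 2).mul (β1.pow 2)).mul (s1.pow 2)).mul (ni1.pow 2)))).congr
      fun x hx => B.ev_Y hz (hI x hx)
  have E1 : ContDiffOn ℝ 1 (UC.ev (B.E z)) (Ioo 0 1) :=
    (((((hk _).mul (s1.pow 2)).add ((hk _).mul ((hX1.mul n1).mul (g1.pow 2)))).add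
      ((hk _).mul (((((hX.pow 2).mul hX1).mul (β1.pow 2)).mul (s1.pow 2)).mul ni1))).add
      ((hk _).mul (((hX.pow 3).mul Q1).mul P1))).congr fun x hx => B.ev_E hz (hI x hx)
  refine ⟨?_, ?_, ?_, ?_, ?_⟩
  · exact contDiffOn_two_of_hasDerivAt isOpen_Ioo (fun x hx => B.hasDerivAt_Q hx)
      ((hk _).mul ((contDiffOn_rpow _).mul P1)).neg
  · exact contDiffOn_two_of_hasDerivAt isOpen_Ioo (fun x hx => B.hasDerivAt_mass hx)
      ((hk _).mul ((contDiffOn_rpow _).mul E1)).neg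
  · exact contDiffOn_two_of_hasDerivAt isOpen_Ioo (fun x hx => B.hasDerivAt_logκ hx)
      ((hk _).mul (((hX.pow 2).mul (contDiffOn_rpow _)).mul Y1)).neg
  · exact contDiffOn_two_of_hasDerivAt isOpen_Ioo (fun x hx => B.hasDerivAt_pot hz hx)
      (Q1.sub (((hk _).mul (((hX.pow 2).mul (contDiffOn_rpow _)).mul Y1)).mul (hX1.mul β1))).neg
  · exact contDiffOn_two_of_hasDerivAt isOpen_Ioo (fun x hx => B.hasDerivAt_profile hx) du1

/-- A hairy solution of the fixed-point problem solves the reduced static system. -/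
theorem reducedSystem {ε K : ℝ} (hε : z.1 = ε ^ 2) (hK : 0 < K) :
    ReducedSystem B.L B.α
        B.q (fun x => K * exp (B.logκ z x)) (fun x => (1 - x) * UC.ev (B.n z) x / x ^ 2)
      (B.mass z) (UC.ev (B.Q z)) (fun x => K * exp (B.logκ z x) * ((1 - x) * UC.ev (B.β z) x))
      (fun x => ε * B.profile z x) (fun x => ε * B.dprofile z x) := by
  have hI : ∀ x ∈ Ioo (0:ℝ) 1, x ∈ Icc (0:ℝ) 1 := fun x hx => ⟨hx.1.le, hx.2.le⟩
  obtain ⟨Q2, m2, k2, a2, u2⟩ := B.contDiffOn_of_isHairy hz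
  have hX : ContDiffOn ℝ 2 (fun x : ℝ => x) (Ioo 0 1) := contDiffOn_id
  have n2 : ContDiffOn ℝ 2 (UC.ev (B.n z)) (Ioo 0 1) := by
    simpa using B.contDiffOn_ev_n hz (m := 2) (by simpa using m2) (by simpa using Q2)
  have κ2 : ContDiffOn ℝ 2 (fun x => K * exp (B.logκ z x)) (Ioo 0 1) := contDiffOn_const.mul k2.exp
  have hdκ : ∀ x ∈ Ioo (0:ℝ) 1, HasDerivAt (fun x => K * exp (B.logκ z x))
      (-(K * exp (B.logκ z x) * (z.1 * (x ^ 2 * x ^ B.D * UC.ev (B.Y z) x)))) x := fun x hx =>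
    ((B.hasDerivAt_logκ (z := z) hx).exp.const_mul K).congr_deriv (by ring)
  have hY : ∀ x ∈ Ioo (0:ℝ) 1, x * (ε * B.dprofile z x) ^ 2 +
      B.q * (K * exp (B.logκ z x) * ((1 - x) * UC.ev (B.β z) x)) ^ 2 * (ε * B.profile z x) ^ 2 /
        (x ^ 3 * (K * exp (B.logκ z x)) ^ 2 * ((1 - x) * UC.ev (B.n z) x / x ^ 2) ^ 2)
      = z.1 * (x ^ 2 * x ^ B.D * UC.ev (B.Y z) x) := by
    intro x hx
    have hx0 := hx.1.ne'
    have hx1 : 1 - x ≠ 0 := by linarith [hx.2]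
    have hn := (hz.1 x (hI x hx)).ne'
    have hκ := (mul_pos hK (exp_pos (B.logκ z x))).ne'
    generalize K * exp (B.logκ z x) = k at *
    rw [mul_pow, mul_pow ε, B.profile_sq hx.1, B.dprofile_sq hx.1, B.ev_Y hz (hI x hx), hε]
    field_simp
  refine ⟨κ2, ((contDiffOn_const.sub hX).mul n2).div (hX.pow 2) fun x hx =>
    pow_ne_zero 2 hx.1.ne', m2, Q2,
    κ2.mul a2, contDiffOn_const.mul u2, fun x _ => mul_pos hK (exp_pos _),
    fun x hx => div_pos (mul_pos (by linarith [hx.2]) (hz.1 x (hI x hx))) (pow_pos hx.1 2),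
    fun x hx => (B.hasDerivAt_profile hx).const_mul ε, fun x hx => ?_, fun x hx =>
      ?_, fun x hx => ?_,
    fun x hx => ?_, fun x hx => ?_, fun x hx => ?_⟩
  all_goals
    have hx0 := hx.1.ne'
    have hx1 : 1 - x ≠ 0 := by linarith [hx.2]
    have hn := (hz.1 x (hI x hx)).ne'
    have hκ := (mul_pos hK (exp_pos (B.logκ z x))).ne'
  · rw [hY x hx]; exact hdκ x hx
  · rw [B.lapse_eq hz (hI x hx)]
    field_simp
    ring
  · refine (B.hasDerivAt_mass (z := z) hx).congr_deriv ?_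
    have hxD' : x ^ (B.D - 1) = x ^ B.D / x := by rw [rpow_sub hx.1, rpow_one]
    generalize K * exp (B.logκ z x) = k at *
    rw [mul_pow, mul_pow ε, B.profile_sq hx.1, B.dprofile_sq hx.1, B.ev_E hz (hI x hx), B.ev_P hz,
        hε, hxD']
    field_simp
  · refine (B.hasDerivAt_Q (z := z) hx).congr_deriv ?_
    have hxD : x ^ (1 + B.D) = x * x ^ B.D := by rw [rpow_add hx.1, rpow_one]
    generalize K * exp (B.logκ z x) = k at *
    rw [mul_pow ε, B.profile_sq hx.1, B.ev_P hz, hε, hxD]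
    field_simp
  · exact ((hdκ x hx).mul (B.hasDerivAt_pot hz hx)).congr_deriv (by ring)
  · rw [hY x hx]
    refine (((B.hasDerivAt_scalarFlux hz hx).const_mul ε).congr_of_eventuallyEq
      (Eventually.of_forall fun y => ?_)).congr_deriv ?_
    · ring
    · generalize K * exp (B.logκ z x) = k at *
      field_simp

end Background

/-- The limiting derivative of a function vanishing at `1` is minus the value of its quotient by `1 - x`. -/
lemma eq_neg_of_hasDerivAt_one_sub_mul {G F' : ℝ → ℝ} {l : ℝ}
    (hG : Tendsto G (nhdsWithin 1 (Iio 1)) (nhds (G 1)))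
    (hd : ∀ x ∈ Ioo (0:ℝ) 1, HasDerivAt (fun x => (1 - x) * G x) (F' x) x)
    (hl : Tendsto F' (nhdsWithin 1 (Iio 1)) (nhds l)) : l = -G 1 := by
  have hm : Ioo (0:ℝ) 1 ∈ nhdsWithin (1:ℝ) (Iio 1) := Ioo_mem_nhdsLT zero_lt_one
  have hc : Tendsto (fun x => (1 - x) * G x) (nhdsWithin 1 (Iio 1)) (nhds ((1 - 1) * G 1)) :=
    ((tendsto_const_nhds.sub tendsto_id).mono_left nhdsWithin_le_nhds).mul hG
  have h1 : HasDerivWithinAt (fun x => (1 - x) * G x) l (Iic 1) 1 := by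
    refine hasDerivWithinAt_Iic_of_tendsto_deriv (s := Ioo 0 1)
      (fun x hx => (hd x hx).differentiableAt.differentiableWithinAt) ?_ hm (hl.congr' ?_)
    · exact hc.mono_left (nhdsWithin_mono _ Ioo_subset_Iio_self)
    · filter_upwards [hm] with x hx using (hd x hx).deriv.symm
  have h2 := (hasDerivWithinAt_iff_tendsto_slope' (by simp)).mp (h1.mono Iio_subset_Iic_self)
  refine tendsto_nhds_unique h2 (hG.neg.congr' ?_)
  filter_upwards [self_mem_nhdsWithin] with x hx
  have : x - 1 ≠ 0 := by have : x < 1 := hx; linarith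
  rw [slope_def_field]
  field_simp
  ring

lemma tendsto_const_div_nhdsGT {rp : ℝ} (hrp : 0 < rp) :
    Tendsto (fun r => rp / r) (nhdsWithin rp (Ioi rp)) (nhdsWithin 1 (Iio 1)) := by
  refine tendsto_nhdsWithin_iff.mpr ⟨?_, ?_⟩
  · have : ContinuousAt (fun r : ℝ => rp / r) rp := continuousAt_const.div continuousAt_id hrp.ne'
    have h := this.tendsto.mono_left (nhdsWithin_le_nhds (s := Ioi rp))
    rwa [div_self hrp.ne'] at h
  · filter_upwards [self_mem_nhdsWithin] with r hr using (div_mem_Ioo_of_lt hrp hr).2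

lemma tendsto_deriv_comp_const_div {rp l : ℝ} {u u' : ℝ → ℝ} (hrp : 0 < rp)
    (hu : ∀ x ∈ Ioo (0:ℝ) 1, HasDerivAt u (u' x) x)
        (hl : Tendsto u' (nhdsWithin 1 (Iio 1)) (nhds l)) :
    Tendsto (deriv fun r => u (rp / r)) (nhdsWithin rp (Ioi rp)) (nhds (-(l / rp))) := by
  have h1 : Tendsto (fun r : ℝ => rp / r ^ 2) (nhdsWithin rp (Ioi rp)) (nhds (rp / rp ^ 2)) :=
    (ContinuousAt.div continuousAt_const (continuousAt_id.pow 2)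
        (pow_ne_zero 2 hrp.ne')).tendsto.mono_left
      nhdsWithin_le_nhds
  have h2 := (h1.mul (hl.comp (tendsto_const_div_nhdsGT hrp))).neg
  have h3 : -(rp / rp ^ 2 * l) = -(l / rp) := by field_simp
  rw [h3] at h2
  refine h2.congr' ?_
  filter_upwards [self_mem_nhdsWithin] with r hr
  exact ((hu _ (div_mem_Ioo_of_lt hrp hr)).comp_const_div (hrp.trans hr).ne').deriv.symm

namespace Background

variable (B : Background) {z : Var} {x : ℝ}

/-- The redshift factor, normalised by the horizon data. -/
def κ (z : Var) (x : ℝ) : ℝ := (1 + 3 * B.L - B.e z ^ 2) / UC.ev (B.n z) 1 * exp (B.logκ z x)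

/-- The lapse divided by the square of the redshift factor. -/
def N (z : Var) (x : ℝ) : ℝ := (1 - x) * UC.ev (B.n z) x / x ^ 2

/-- The electric potential. -/
def pot (z : Var) (x : ℝ) : ℝ := B.κ z x * ((1 - x) * UC.ev (B.β z) x)

lemma continuous_logκ : Continuous (B.logκ z) := by
  have := UC.continuous_ev (B.avg (UC.X ^ 2 * B.xD * B.Y z))
  unfold logκ; fun_prop

lemma continuous_κ : Continuous (B.κ z) := by
  have := B.continuous_logκ (z := z)
  unfold κ; fun_prop

lemma κ_one : B.κ z 1 = (1 + 3 * B.L - B.e z ^ 2) / UC.ev (B.n z) 1 := by simp [κ, logκ]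

lemma ev_nh_one : UC.ev B.nh 1 = 1 + 3 * B.L - B.a ^ 2 := by
  rw [B.ev_nh ⟨zero_le_one, le_rfl⟩, hPoly]; ring

lemma ev_s_one : UC.ev (B.s z) 1 = 1 := by
  rw [ev_s, B.ev_v ⟨zero_le_one, le_rfl⟩, B.h_one]; ring

lemma ev_Q_one : UC.ev (B.Q z) 1 = B.e z := by
  rw [B.ev_Q ⟨zero_le_one, le_rfl⟩]; ring

lemma mass_one : B.mass z 1 = (1 + B.L + B.e z ^ 2) / 2 := by rw [mass]; ring

lemma continuousAt_profile : ContinuousAt (B.profile z) 1 :=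
  (continuousAt_rpow_const _ _ (.inl one_ne_zero)).mul (UC.continuous_ev _).continuousAt

lemma continuousAt_dprofile : ContinuousAt (B.dprofile z) 1 :=
  (continuousAt_rpow_const _ _ (.inl one_ne_zero)).mul (UC.continuous_ev _).continuousAt

variable (hz : B.IsHairy z)
include hz

lemma ev_β_one : UC.ev (B.β z) 1 = B.e z := by
  have h1 : (1:ℝ) ∈ Icc (0:ℝ) 1 := ⟨zero_le_one, le_rfl⟩
  rw [ev_β, hz.2.2.1, newb, B.avg_one]
  simp [UC.ev_X h1]

lemma ev_n_one : UC.ev (B.n z) 1 = 1 + 3 * B.L - B.e z ^ 2 - z.1 * (B.L * B.α) := by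
  have h1 : (1:ℝ) ∈ Icc (0:ℝ) 1 := ⟨zero_le_one, le_rfl⟩
  have hη : UC.ev z.2.2.2.1 1 = -(B.L * B.α) := by
    rw [hz.2.1]
    simp only [newη, UC.ev_add, UC.ev_sub, UC.ev_mul, UC.ev_smul, UC.ev_one, UC.ev_pow, UC.ev_X h1,
      B.massAvg_one, B.chargeAvg_one, B.ev_E hz h1, B.ev_s_one, B.ev_Q_one]
    ring
  rw [B.ev_n h1, hη, B.ev_nh_one, e]
  ring

lemma ev_n_one_mul_g : UC.ev (B.n z) 1 * UC.ev (B.g z) 1 = -(B.L * B.α) := by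
  have hn := (hz.1 1 ⟨zero_le_one, le_rfl⟩).ne'
  have hdp := B.continuousAt_dprofile (z := z)
  have hp := B.continuousAt_profile (z := z)
  have hcn := (UC.continuous_ev (B.n z)).continuousAt (x := 1)
  have hcβ := (UC.continuous_ev (B.β z)).continuousAt (x := 1)
  have hcY := (UC.continuous_ev (B.Y z)).continuousAt (x := 1)
  have hcD : ContinuousAt (fun x : ℝ => x ^ B.D) 1 := continuousAt_rpow_const _ _ (.inl one_ne_zero)
  have hG : ContinuousAt (fun x => UC.ev (B.n z) x / x ^ 2 * B.dprofile z x) 1 :=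
    (hcn.div (continuousAt_id.pow 2) (by simp)).mul hdp
  have hF : ContinuousAt (fun x => z.1 * (x ^ 2 * x ^ B.D) * UC.ev (B.Y z) x
        * ((1 - x) * UC.ev (B.n z) x / x ^ 2 * B.dprofile z x)
      + (B.L * B.α - B.q * x ^ 2 * (1 - x) * UC.ev (B.β z) x ^ 2 / UC.ev (B.n z) x) / x ^ 4 *
          B.profile z x) 1 := by
    have h1 : ContinuousAt (fun x => (1 - x) * UC.ev (B.n z) x / x ^ 2) 1 :=
      ContinuousAt.div (by fun_prop) (by fun_prop) (by simp)
    have h2 : ContinuousAt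
        (fun x => (B.L * B.α - B.q * x ^ 2 * (1 - x) * UC.ev (B.β z) x ^ 2 / UC.ev (B.n z) x)
        / x ^ 4) 1 :=
      ContinuousAt.div (continuousAt_const.sub
          (ContinuousAt.div (by fun_prop) hcn hn)) (by fun_prop) (by simp)
    fun_prop
  have h := eq_neg_of_hasDerivAt_one_sub_mul (hG.tendsto.mono_left nhdsWithin_le_nhds)
    (fun x hx => (B.hasDerivAt_scalarFlux hz hx).congr_of_eventuallyEq
        (Eventually.of_forall fun y => by ring))
    (hF.tendsto.mono_left nhdsWithin_le_nhds)
  simp only [profile, dprofile, one_rpow, one_pow, B.ev_s_one] at h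
  linear_combination h

lemma hasDerivAt_N (hx : x ∈ Ioo (0:ℝ) 1) : HasDerivAt (B.N z)
    ((UC.ev B.dfh x + z.1 * x ^ 2 * UC.ev (B.Z z) x) / x ^ 2 - 2 *
        ((1 - x) * UC.ev (B.n z) x) / x ^ 3) x := by
  have hx0 := hx.1.ne'
  refine ((B.hasDerivAt_lapse hz hx).div ((hasDerivAt_id x).pow 2)
      (pow_ne_zero 2 hx0)).congr_deriv ?_
  simp
  field_simp

lemma ev_dfh_add_Z_one : UC.ev B.dfh 1 + z.1 * UC.ev (B.Z z) 1 = -UC.ev (B.n z) 1 := by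
  have h1 := UC.continuous_ev B.dfh
  have h2 := UC.continuous_ev (B.Z z)
  have hF : ContinuousAt (fun x => UC.ev B.dfh x + z.1 * x ^ 2 * UC.ev (B.Z z) x) 1 := by fun_prop
  have h := eq_neg_of_hasDerivAt_one_sub_mul
      ((UC.continuous_ev (B.n z)).continuousAt.tendsto.mono_left
    nhdsWithin_le_nhds) (fun x hx =>
      B.hasDerivAt_lapse hz hx) (hF.tendsto.mono_left nhdsWithin_le_nhds)
  simpa using h

theorem horizonData {Λ ε rp : ℝ} (hrp : 0 < rp) (hΛ : B.L = -Λ / 3 * rp ^ 2) (hε : z.1 = ε ^ 2)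
    (he : B.e z ^ 2 < 1 + 3 * B.L) :
    HorizonData Λ B.α rp (rp * ((1 + B.L + B.e z ^ 2) / 2)) (rp * B.e z) ε (fun r => B.κ z (rp / r))
      (fun r => B.κ z (rp / r) ^ 2 * B.N z (rp / r)) (fun r => rp * B.mass z (rp / r))
      (fun r => rp * UC.ev (B.Q z) (rp / r)) (fun r => B.pot z (rp / r))
          (fun r => ε * B.profile z (rp / r)) := by
  have hn1 := hz.1 1 ⟨zero_le_one, le_rfl⟩
  have hn := B.ev_n_one hz
  have hng := B.ev_n_one_mul_g hz
  have hd : 0 < 1 + 3 * B.L - B.e z ^ 2 := by linarith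
  have hΛ' : -Λ / 3 = B.L / rp ^ 2 := by rw [hΛ]; field_simp
  have hrp0 := hrp.ne'
  have hK : rp * ((1 + B.L + B.e z ^ 2) / 2) / rp ^ 2 - (rp * B.e z) ^ 2 / rp ^ 3 + -Λ / 3 * rp
      = (1 + 3 * B.L - B.e z ^ 2) / (2 * rp) := by
    rw [hΛ']; field_simp; ring
  have hx := tendsto_const_div_nhdsGT hrp
  have lim : ∀ {u : ℝ → ℝ} {l : ℝ}, ContinuousAt u 1 → u 1 = l →
      Tendsto (fun r => u (rp / r)) (nhdsWithin rp (Ioi rp)) (nhds l) := fun hu hl =>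
    hl ▸ (hu.tendsto.mono_left nhdsWithin_le_nhds).comp hx
  have hκ1 := B.κ_one (z := z)
  have hκ1' : B.κ z 1 ≠ 0 := by rw [hκ1]; exact (div_pos hd hn1).ne'
  have hcn := (UC.continuous_ev (B.n z)).continuousAt (x := 1)
  have hcβ := (UC.continuous_ev (B.β z)).continuousAt (x := 1)
  have hcκ := (B.continuous_κ (z := z)).continuousAt (x := 1)
  refine ⟨(1 + 3 * B.L - B.e z ^ 2) / (2 * rp), B.κ z 1, hK.symm,
      by positivity, ?_, ?_, ?_, ?_, ?_, ?_, ?_, ?_⟩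
  · rw [hκ1, hΛ', hn, ← inv_div]
    congr 1
    rw [hε]
    field_simp
  · refine (lim (u := B.mass z) ?_ B.mass_one).const_mul rp
    have := UC.continuous_ev (B.massAvg (B.E z))
    unfold mass
    fun_prop
  · exact (lim (UC.continuous_ev (B.Q z)).continuousAt B.ev_Q_one).const_mul rp
  · exact ((lim (B.continuousAt_profile (z := z)) (by rw [profile, one_rpow, B.ev_s_one, mul_one])).const_mul ε).trans_eq
      (by rw [mul_one])
  · exact lim hcκ rfl
  · have h := tendsto_deriv_comp_const_div hrp (u := fun x => ε * B.profile z x)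
      (fun x hx => (B.hasDerivAt_profile (z := z) hx).const_mul ε)
      ((B.continuousAt_dprofile.tendsto.mono_left nhdsWithin_le_nhds).const_mul ε)
    refine h.trans_eq ?_
    congr 1
    rw [hκ1, hΛ', dprofile, one_rpow, one_mul]
    have hg : UC.ev (B.g z) 1 = -(B.L * B.α) / UC.ev (B.n z) 1 := by rw [← hng]; field_simp
    rw [hg]
    have hd0 := hd.ne'
    generalize 1 + 3 * B.L - B.e z ^ 2 = d at *
    field_simp
  · have h := lim (u := fun x => UC.ev (B.β z) x * x ^ 2 / (B.κ z x * UC.ev (B.n z) x))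
      (ContinuousAt.div (by fun_prop) (by fun_prop) (mul_ne_zero hκ1' hn1.ne')) rfl
    refine (h.congr' ?_).trans_eq ?_
    · filter_upwards [self_mem_nhdsWithin] with r hr
      have hxr := div_mem_Ioo_of_lt hrp hr
      have h1 : 1 - rp / r ≠ 0 := by linarith [hxr.2]
      have h0 := hxr.1.ne'
      rw [pot, N]
      have := (hz.1 _ ⟨hxr.1.le, hxr.2.le⟩).ne'
      have : B.κ z (rp / r) ≠ 0 := by
        unfold κ; exact (mul_pos (div_pos hd hn1) (exp_pos _)).ne'
      generalize rp / r = y at *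
      field_simp
    · congr 1
      rw [hκ1, B.ev_β_one hz]
      field_simp
  · have hDκ : ∀ x ∈ Ioo (0:ℝ) 1, HasDerivAt (B.κ z)
        (-(B.κ z x * (z.1 * (x ^ 2 * x ^ B.D * UC.ev (B.Y z) x)))) x := fun x hx =>
      ((B.hasDerivAt_logκ (z := z) hx).exp.const_mul _).congr_deriv (by rw [κ]; ring)
    have hcY := (UC.continuous_ev (B.Y z)).continuousAt (x := 1)
    have hcZ := (UC.continuous_ev (B.Z z)).continuousAt (x := 1)
    have hcf := (UC.continuous_ev B.dfh).continuousAt (x := 1)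
    have hcD : ContinuousAt (fun x : ℝ => x ^ B.D) 1 :=
      continuousAt_rpow_const _ _ (.inl one_ne_zero)
    have hcN : ContinuousAt (B.N z) 1 := by
      unfold N; exact ContinuousAt.div (by fun_prop) (by fun_prop) (by simp)
    have hd1 : ContinuousAt (fun x => (UC.ev B.dfh x + z.1 * x ^ 2 * UC.ev (B.Z z) x) / x ^ 2) 1 :=
      ContinuousAt.div (by fun_prop) (by fun_prop) (by simp)
    have hd2 : ContinuousAt (fun x => 2 * ((1 - x) * UC.ev (B.n z) x) / x ^ 3) 1 :=
      ContinuousAt.div (by fun_prop) (by fun_prop) (by simp)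
    have hc : ContinuousAt
        (fun x => 2 * B.κ z x * (-(B.κ z x * (z.1 * (x ^ 2 * x ^ B.D * UC.ev (B.Y z) x))))
        * B.N z x + B.κ z x ^ 2 * ((UC.ev B.dfh x + z.1 * x ^ 2 * UC.ev (B.Z z) x) / x ^ 2
          - 2 * ((1 - x) * UC.ev (B.n z) x) / x ^ 3)) 1 := by fun_prop
    have h := tendsto_deriv_comp_const_div hrp (u := fun x => B.κ z x ^ 2 * B.N z x)
      (fun x hx => (((hDκ x hx).pow 2).mul (B.hasDerivAt_N hz hx)).congr_deriv (by
        simp only [Nat.cast_ofNat, Nat.reduceSub, pow_one, Pi.pow_apply]))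
      (hc.tendsto.mono_left nhdsWithin_le_nhds)
    refine h.trans_eq ?_
    congr 1
    have hZ := B.ev_dfh_add_Z_one hz
    simp only [one_pow, one_rpow, mul_one, div_one, N, sub_self, zero_mul, mul_zero, sub_zero,
        zero_add, hZ]
    rw [hκ1]
    field_simp

end Background

namespace Background

variable (B : Background) {z : Var} {x : ℝ}

lemma κ_pos (hz : B.IsHairy z) (he : B.e z ^ 2 < 1 + 3 * B.L) (x : ℝ) : 0 < B.κ z x :=
  mul_pos (div_pos (by linarith) (hz.1 1 ⟨zero_le_one, le_rfl⟩)) (exp_pos _)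

/-- A function `x ^ σ f` with `f` bounded satisfies the Dirichlet condition at infinity. -/
lemma tendsto_dirichlet {rp Δ : ℝ} (hrp : 0 < rp) (hΔ : B.D = 2 * Δ) (c : ℝ) (f : UC) :
    Tendsto (fun r => r ^ ((3:ℝ) / 2 - Δ) * (c * ((rp / r) ^ B.σ * UC.ev f (rp / r)))) atTop
        (nhds 0) := by
  have h1 : Tendsto (fun r : ℝ => |c| * rp ^ B.σ * ‖f‖ * r ^ (-B.D)) atTop (nhds 0) := by
    simpa using (tendsto_rpow_neg_atTop B.hD).const_mul (|c| * rp ^ B.σ * ‖f‖)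
  refine squeeze_zero_norm' ?_ h1
  filter_upwards [eventually_gt_atTop 0] with r hr
  have h2 : r ^ (-B.D) = r ^ ((3:ℝ) / 2 - Δ) / r ^ B.σ := by
    rw [← rpow_sub hr]; congr 1; linarith [B.hσ]
  have h3 := rpow_pos_of_pos hr B.σ
  have h4 := rpow_pos_of_pos hrp B.σ
  have h5 := rpow_pos_of_pos hr ((3:ℝ) / 2 - Δ)
  rw [h2, div_rpow hrp.le hr.le, norm_eq_abs, abs_mul, abs_mul, abs_mul, abs_of_pos h5,
      abs_of_pos (div_pos h4 h3)]
  calc r ^ ((3:ℝ) / 2 - Δ) * (|c| * (rp ^ B.σ / r ^ B.σ * |UC.ev f (rp / r)|))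
      ≤ r ^ ((3:ℝ) / 2 - Δ) * (|c| * (rp ^ B.σ / r ^ B.σ * ‖f‖)) := by gcongr; exact f.abs_ev_le _
    _ = _ := by ring

section RN

variable {Λ rp r : ℝ} (hrp : 0 < rp) (hΛ : B.L = -Λ / 3 * rp ^ 2)
include hrp hΛ

lemma RNpot_eq (hr : rp < r) : RNpot Λ (rp * ((1 + B.L + B.a ^ 2) / 2)) (rp * B.a) r =
    (1 - rp / r) * UC.ev B.nh (rp / r) / (rp / r) ^ 2 := by
  have hx := div_mem_Ioo_of_lt hrp hr
  have hr0 := (hrp.trans hr).ne'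
  rw [B.ev_nh ⟨hx.1.le, hx.2.le⟩, RNpot, hPoly, hΛ]
  field_simp
  ring

lemma hasDerivAt_RNpot (hr : rp < r) :
    HasDerivAt (RNpot Λ (rp * ((1 + B.L + B.a ^ 2) / 2)) (rp * B.a))
    (-(rp / r ^ 2 * (UC.ev B.dfh (rp / r) / (rp / r) ^ 2
      - 2 * ((1 - rp / r) * UC.ev B.nh (rp / r)) / (rp / r) ^ 3))) r := by
  have hx := div_mem_Ioo_of_lt hrp hr
  have hxI : rp / r ∈ Icc (0:ℝ) 1 := ⟨hx.1.le, hx.2.le⟩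
  have hr0 := (hrp.trans hr).ne'
  have h := ((((hasDerivAt_id r).inv hr0).const_mul
      (2 * (rp * ((1 + B.L + B.a ^ 2) / 2)))).const_sub 1
    |>.add ((((hasDerivAt_id r).pow 2).inv (pow_ne_zero 2 hr0)).const_mul ((rp * B.a) ^ 2))).add
    (((hasDerivAt_id r).pow 2).const_mul (-Λ / 3))
  refine (h.congr_of_eventuallyEq (Eventually.of_forall fun s => ?_)).congr_deriv ?_
  · simp only [RNpot, Pi.add_apply, Pi.inv_apply, Pi.pow_apply, id]
    ring
  · rw [B.ev_nh hxI, B.ev_dfh hxI, hPoly, hΛ]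
    simp
    field_simp
    ring

lemma abs_N_sub_RNpot_le (hr : rp < r) :
    |B.N z (rp / r) - RNpot Λ (rp * ((1 + B.L + B.a ^ 2) / 2)) (rp * B.a) r| ≤
        |z.1| * ‖B.no z‖ := by
  have hx := div_mem_Ioo_of_lt hrp hr
  rw [B.RNpot_eq hrp hΛ hr, N, B.ev_n_eq_add ⟨hx.1.le, hx.2.le⟩]
  have h0 := hx.1.ne'
  have h1 : (1 - rp / r) * (UC.ev B.nh (rp / r) + z.1 * (rp / r) ^ 2 * UC.ev (B.no z) (rp / r)) /
      (rp / r) ^ 2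
      - (1 - rp / r) * UC.ev B.nh (rp / r) / (rp / r) ^ 2 =
          z.1 * ((1 - rp / r) * UC.ev (B.no z) (rp / r)) := by
    generalize rp / r = y at *
    field_simp
    ring
  rw [h1, abs_mul, abs_mul, abs_of_pos (by linarith [hx.2] : 0 < 1 - rp / r)]
  gcongr
  calc (1 - rp / r) * |UC.ev (B.no z) (rp / r)| ≤ 1 * ‖B.no z‖ :=
        mul_le_mul (by linarith [hx.1]) (UC.abs_ev_le _ _) (abs_nonneg _) zero_le_one
    _ = _ := one_mul _

lemma abs_deriv_N_sub_RNpot_le (hz : B.IsHairy z) (hr : rp < r) :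
    |deriv (fun s => B.N z (rp / s)) r - deriv
        (RNpot Λ (rp * ((1 + B.L + B.a ^ 2) / 2)) (rp * B.a)) r|
      ≤ |z.1| * ((‖B.Z z‖ + 2 * ‖B.no z‖) / rp) := by
  have hx := div_mem_Ioo_of_lt hrp hr
  have hr0 := (hrp.trans hr).ne'
  rw [((B.hasDerivAt_N hz hx).comp_const_div hr0).deriv, (B.hasDerivAt_RNpot hrp hΛ hr).deriv,
    B.ev_n_eq_add ⟨hx.1.le, hx.2.le⟩]
  have h2 : rp / r ^ 2 = (rp / r) ^ 2 / rp := by field_simp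
  rw [h2]
  have h0 := hx.1.ne'
  have hrp' := hrp.ne'
  set y := rp / r with hy
  have h1 : -(y ^ 2 / rp * ((UC.ev B.dfh y + z.1 * y ^ 2 * UC.ev (B.Z z) y) / y ^ 2
        - 2 * ((1 - y) * (UC.ev B.nh y + z.1 * y ^ 2 * UC.ev (B.no z) y)) / y ^ 3))
      - -(y ^ 2 / rp * (UC.ev B.dfh y / y ^ 2 - 2 * ((1 - y) * UC.ev B.nh y) / y ^ 3))
      = z.1 * ((-(y ^ 2 * UC.ev (B.Z z) y) + 2 * (y * (1 - y) * UC.ev (B.no z) y)) / rp) := by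
    clear_value y
    field_simp
    ring
  rw [h1, abs_mul, abs_div, abs_of_pos hrp]
  gcongr
  refine (abs_add_le _ _).trans (add_le_add ?_ ?_)
  · rw [abs_neg, abs_mul, abs_of_pos (pow_pos hx.1 2)]
    calc y ^ 2 * |UC.ev (B.Z z) y| ≤ 1 * ‖B.Z z‖ :=
          mul_le_mul (pow_le_one₀ hx.1.le hx.2.le) (UC.abs_ev_le _ _) (abs_nonneg _) zero_le_one
      _ = _ := one_mul _
  · have h3 : 0 < 1 - y := by linarith [hx.2]
    rw [abs_mul, abs_of_pos two_pos, abs_mul, abs_of_pos (mul_pos hx.1 h3)]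
    gcongr
    calc y * (1 - y) * |UC.ev (B.no z) y| ≤ 1 * ‖B.no z‖ :=
          mul_le_mul (by nlinarith [hx.1, hx.2]) (UC.abs_ev_le _ _) (abs_nonneg _) zero_le_one
      _ = _ := one_mul _

/-- The ground state solves the charged Klein–Gordon equation on the Reissner–Nordström–AdS background. -/
lemma linear_kleinGordon {q0 : ℝ} (hq : B.q = (q0 * rp) ^ 2) (hr : rp < r) :
    deriv (fun s => s ^ 2 * RNpot Λ (rp * ((1 + B.L + B.a ^ 2) / 2)) (rp * B.a) s
        * deriv (fun s => B.W (rp / s)) s) r =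
      ((-Λ / 3) * B.α - q0 ^ 2 * (rp * B.a * (1 / rp - 1 / r)) ^ 2
        / RNpot Λ (rp * ((1 + B.L + B.a ^ 2) / 2)) (rp * B.a) r) * r ^ 2 * B.W (rp / r) := by
  have hx := div_mem_Ioo_of_lt hrp hr
  have hr0 := (hrp.trans hr).ne'
  have hrp' := hrp.ne'
  have hΛ' : -Λ / 3 = B.L / rp ^ 2 := by rw [hΛ]; field_simp
  have heq : (fun s => s ^ 2 * RNpot Λ (rp * ((1 + B.L + B.a ^ 2) / 2)) (rp * B.a) s
      * deriv (fun s => B.W (rp / s)) s) =ᶠ[nhds r] fun s => -rp * B.flux (rp / s) := by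
    filter_upwards [Ioi_mem_nhds hr] with s hs
    have hxs := div_mem_Ioo_of_lt hrp hs
    have hs0 := (hrp.trans hs).ne'
    rw [B.RNpot_eq hrp hΛ hs, ((B.hasDerivAt_W_flux hxs).1.comp_const_div hs0).deriv, flux]
    field_simp
  rw [heq.deriv_eq, (((B.hasDerivAt_W_flux hx).2.comp_const_div hr0).const_mul (-rp)).deriv,
    B.RNpot_eq hrp hΛ hr, hΛ', hq]
  have hn := (B.nh_pos ⟨hx.1.le, hx.2.le⟩).ne'
  have h1 : r - rp ≠ 0 := by linarith
  have h2 : 1 - rp / r = (r - rp) / r := by field_simp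
  have h3 : 1 / rp - 1 / r = (r - rp) / (r * rp) := by field_simp
  rw [h2, h3]
  generalize UC.ev B.nh (rp / r) = m at *
  generalize B.W (rp / r) = w at *
  field_simp

end RN

end Background

namespace Background

variable (B : Background)

/-- Hairy solutions near a ground state, with the properties uniform in the scalar parameter. -/
lemma exists_hairy_branch {m : ℝ} (hm : (1 + B.L + B.a ^ 2) / 2 < m) :
    ∃ ζ : ℝ → ℝ × UC × UC × UC, ∃ C₁ C₂ ε₀ : ℝ, 0 ≤ C₁ ∧ 0 ≤ C₂ ∧ 0 < ε₀ ∧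
      (∀ ε, 0 ≤ ε → ε < ε₀ → B.IsHairy (ε ^ 2, ζ (ε ^ 2)) ∧ 0 < B.e (ε ^ 2, ζ (ε ^ 2)) ∧
        B.e (ε ^ 2, ζ (ε ^ 2)) ^ 2 < 1 + 3 * B.L ∧ (1 + B.L + B.e (ε ^ 2, ζ (ε ^ 2)) ^ 2) / 2 < m ∧
        ‖B.no (ε ^ 2, ζ (ε ^ 2))‖ ≤ C₁ ∧ ‖B.Z (ε ^ 2, ζ (ε ^ 2))‖ ≤ C₂) ∧
      ∀ x, Tendsto (fun ε : ℝ => B.profile (ε ^ 2, ζ (ε ^ 2)) x) (nhds 0) (nhds (B.W x)) := by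
  obtain ⟨ζ, z₀, hζ, hh⟩ := B.exists_isHairy
  have hpair : Tendsto (fun δ => (δ, ζ δ)) (nhds 0) (nhds ((0 : ℝ), z₀)) := by
    rw [nhds_prod_eq]; exact tendsto_id.prodMk hζ
  have hu : IsUnit (B.n (0, z₀)) := by rw [n_zero]; exact B.isUnit_nh
  have he : Tendsto (fun δ => B.e (δ, ζ δ)) (nhds 0) (nhds B.a) := by
    have := (B.contDiff_e.continuous.tendsto (0, z₀)).comp hpair
    rwa [e_zero] at this
  have hno := ((B.contDiff_no.continuous.tendsto (0, z₀)).comp hpair).norm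
  have hZ := ((B.contDiffAt_Z hu).continuousAt.tendsto.comp hpair).norm
  have hs : Tendsto (fun δ => B.s (δ, ζ δ)) (nhds 0) (nhds B.h) := by
    have := (B.contDiff_s.continuous.tendsto (0, z₀)).comp hpair
    rwa [s_zero] at this
  have hsq : Tendsto (fun ε : ℝ => ε ^ 2) (nhds 0) (nhds 0) := by
    have := (continuous_pow 2 (M := ℝ)).tendsto 0
    rwa [zero_pow two_ne_zero] at this
  have hev := hh.and ((he.eventually_const_lt B.ha).and (((he.pow 2).eventually_lt_const B.ha2).and
    (((((he.pow 2).const_add (1 + B.L)).div_const 2).eventually_lt_const hm).and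
    ((hno.eventually_le_const (lt_add_one _)).and (hZ.eventually_le_const (lt_add_one _))))))
  obtain ⟨ε₀, hε₀, hball⟩ := Metric.eventually_nhds_iff.mp (hsq.eventually hev)
  refine ⟨ζ, ‖B.no (0, z₀)‖ + 1, ‖B.Z (0, z₀)‖ + 1, ε₀,
      by positivity, by positivity, hε₀, fun ε h0 h1 => ?_, fun x => ?_⟩
  · exact hball (by rwa [Real.dist_eq, sub_zero, abs_of_nonneg h0])
  · exact ((((UC.evL x).continuous.tendsto _).comp hs).const_mul (x ^ B.σ)).comp hsq

end Background

/-- Existence of a ground state background with mass below a given bound, for large scalar charge. -/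
lemma exists_background {L α D q b : ℝ} (hL : 0 < L) (hα : -(9 / 4) < α) (hα0 : α < 0) (hD : 0 < D)
    (hDα : D ^ 2 = 9 + 4 * α) (hb : 0 < b) (hb2 : b ^ 2 < 1 + 3 * L) (hq : 0 < q)
    (hqb : 3840 * (1 + 3 * L) ^ 2 < q * b ^ 2) :
    ∃ B : Background, B.L = L ∧ B.α = α ∧ B.q = q ∧ B.D = D ∧ B.a ≤ b := by
  have hσ : 2 * ((3 + D) / 2) = 3 + D := by ring
  have hσα : (3 + D) / 2 * ((3 + D) / 2 - 3) = α := by linear_combination hDα / 4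
  obtain ⟨a, ha, h, hx, p, hbr, hpos, hone⟩ :=
    exists_ground_state hL hα hα0 hD hσ hσα hb hb2 hq.le hqb
  obtain ⟨T₁, h1, h1'⟩ := UC.exists_tailAvg (w := fun y => y ^ (D - 1))
    (intervalIntegral.intervalIntegrable_rpow' (by linarith))
    (fun x hx => (continuousAt_rpow_const _ _ (.inl hx.1.ne')).continuousWithinAt)
  obtain ⟨T₂, h2, h2'⟩ := UC.exists_tailAvg (w := fun y => y ^ (1 + D))
    (intervalIntegral.intervalIntegrable_rpow' (by linarith))
    (fun x hx => (continuousAt_rpow_const _ _ (.inl hx.1.ne')).continuousWithinAt)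
  obtain ⟨T₃, h3, h3'⟩ := UC.exists_tailAvg (w := fun _ => 1) (_root_.intervalIntegrable_const)
    continuousOn_const
  refine ⟨⟨L, α, q, D, (3 + D) / 2, a, hL, hq, hD, hσ, hσα, ha.1,
    (pow_le_pow_left₀ ha.1.le ha.2 2).trans_lt hb2, h, hx, p, hbr, hpos, hone, T₁, T₂, T₃, h1, ?_,
        h2, ?_, ?_, ?_⟩,
    rfl, rfl, rfl, rfl, ha.2⟩
  · intro f; simpa using h1' f
  · intro f; simpa using h2' f
  · intro f x hx; simpa using h3 f x hx
  · intro f; simpa using h3' f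

theorem stmt_9 (Λ rp α Δ Me0 M0 Mb : ℝ) (hΛ : Λ < 0) (hrp : 0 < rp)
    (hα : α ∈ Ioo (-(9:ℝ)/4) 0) (hΔ : Δ = Real.sqrt (9/4 + α))
    (hMe0 : Me0 = rp/2 * (1 + (-Λ/3)*rp^2))
    (hM0 : M0 = rp * (1 + 2*(-Λ/3)*rp^2))
    (eM : ℝ → ℝ) (heM : ∀ M, eM M = Real.sqrt (2*M*rp - rp^2 - (-Λ/3)*rp^4))
    (hMb : Mb ∈ Ioo Me0 M0) :
    ∃ qmax > (0:ℝ), ∀ q0 : ℝ, qmax < |q0| →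
    ∃ ε₀ > (0:ℝ), ∃ Mc : ℝ → ℝ, ∃ κ Ω2 ϖ Q A φ : ℝ → ℝ → ℝ,
    ∃ C > (0:ℝ), ∃ φhat : ℝ → ℝ,
      (∀ ε : ℝ, 0 ≤ ε → ε < ε₀ →
        Mc ε ∈ Ioo Me0 Mb ∧
        StaticSystem Λ α q0 rp (κ ε) (Ω2 ε) (ϖ ε) (Q ε) (A ε) (φ ε) ∧
        HorizonData Λ α rp (Mc ε) (eM (Mc ε)) ε
          (κ ε) (Ω2 ε) (ϖ ε) (Q ε) (A ε) (φ ε) ∧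
        -- Dirichlet boundary condition
        Tendsto (fun r => r ^ ((3:ℝ)/2 - Δ) * φ ε r) atTop (nhds 0) ∧
        -- the scalar hair is nontrivial for ε > 0
        (0 < ε → ¬ ∀ r ∈ Ioi rp, φ ε r = 0) ∧
        -- quantitative closeness to the Reissner–Nordström–AdS with mass Mc 0
        (∀ r ∈ Ioi rp,
          |Ω2 ε r/(κ ε r)^2 - RNpot Λ (Mc 0) (eM (Mc 0)) r| ≤ C*ε^2 ∧
          |deriv (fun s => Ω2 ε s/(κ ε s)^2) r
            - deriv (fun s => RNpot Λ (Mc 0) (eM (Mc 0)) s) r| ≤ C*ε^2)) ∧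
      -- the linear hair φhat
      ContDiffOn ℝ 2 φhat (Ioi rp) ∧
      (¬ ∀ r ∈ Ioi rp, φhat r = 0) ∧
      (∀ r ∈ Ioi rp,
        deriv (fun s => s^2 * RNpot Λ (Mc 0) (eM (Mc 0)) s * deriv φhat s) r
          = ((-Λ/3)*α
              - q0^2*(eM (Mc 0)*(1/rp - 1/r))^2 / RNpot Λ (Mc 0) (eM (Mc 0)) r)
            * r^2 * φhat r) ∧
      Tendsto (fun r => r ^ ((3:ℝ)/2 - Δ) * φhat r) atTop (nhds 0) ∧
      -- differentiability of the family at ε = 0: ε⁻¹ φ_ε → φhat pointwise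
      (∀ r ∈ Ioi rp,
        Tendsto (fun ε => φ ε r / ε) (nhdsWithin 0 (Ioi (0:ℝ))) (nhds (φhat r))) := by
  set L := -Λ / 3 * rp ^ 2 with hL
  have hL0 : 0 < L := mul_pos (by linarith) (pow_pos hrp 2)
  obtain ⟨hMb1, hMb2⟩ := hMb
  have hα1 : 0 < 9 / 4 + α := by have := hα.1; linarith
  have hΔ0 : 0 < Δ := hΔ ▸ Real.sqrt_pos.mpr hα1
  have hΔ2 : Δ ^ 2 = 9 / 4 + α := by rw [hΔ, Real.sq_sqrt hα1.le]
  -- the square of the largest admissible charge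
  set c := 2 * Mb / rp - 1 - L with hc
  have hMbc : Mb = rp * ((1 + L + c) / 2) := by rw [hc]; field_simp; ring
  have hc0 : 0 < c := by
    rw [hMe0, hMbc] at hMb1
    nlinarith [hMb1]
  have hc1 : c < 1 + 3 * L := by
    rw [hM0, hMbc] at hMb2
    nlinarith [hMb2]
  set b := √c / 2 with hb
  have hb0 : 0 < b := half_pos (Real.sqrt_pos.mpr hc0)
  have hb2 : b ^ 2 = c / 4 := by rw [hb, div_pow, Real.sq_sqrt hc0.le]; norm_num
  refine ⟨√3840 * (1 + 3 * L) / (rp * b), by positivity, fun q0 hq0 => ?_⟩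
  have hq : 3840 * (1 + 3 * L) ^ 2 < (q0 * rp) ^ 2 * b ^ 2 := by
    rw [div_lt_iff₀ (by positivity)] at hq0
    have h1 := pow_lt_pow_left₀ hq0 (by positivity) two_ne_zero
    rw [mul_pow, Real.sq_sqrt (by norm_num), mul_pow |q0|, sq_abs] at h1
    linarith
  have hq' : 0 < (q0 * rp) ^ 2 :=
    pos_of_mul_pos_left ((by positivity : (0:ℝ) < _).trans hq) (sq_nonneg b)
  obtain ⟨B, hBL, rfl, hBq, hBD, hBa⟩ :=
    exists_background hL0 (by linarith) hα.2 (mul_pos two_pos hΔ0)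
    (by rw [mul_pow, hΔ2]; ring) hb0 (by linarith) hq' hq
  have hBL' : B.L = -Λ / 3 * rp ^ 2 := hBL
  have hBa2 : B.a ^ 2 < c := by
    have := pow_le_pow_left₀ B.ha.le hBa 2
    linarith
  obtain ⟨ζ, C₁, C₂, ε₀, hC₁, hC₂, hε₀, hfam, hprof⟩ :=
    B.exists_hairy_branch (m := (1 + L + c) / 2) (by linarith)
  set z : ℝ → Background.Var := fun ε => (ε ^ 2, ζ (ε ^ 2)) with hzdef
  have heM' : ∀ e : ℝ, 0 < e → eM (rp * ((1 + B.L + e ^ 2) / 2)) = rp * e := by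
    intro e he
    rw [heM, hBL, ← Real.sqrt_sq (mul_pos hrp he).le]
    congr 1
    rw [hL]; ring
  have he0 : B.e (z 0) = B.a := by simp [hzdef]
  refine ⟨ε₀, hε₀, fun ε => rp * ((1 + B.L + B.e (z ε) ^ 2) / 2), fun ε r => B.κ (z ε) (rp / r),
    fun ε r => B.κ (z ε) (rp / r) ^ 2 * B.N (z ε) (rp / r), fun ε r => rp * B.mass (z ε) (rp / r),
    fun ε r => rp * UC.ev (B.Q (z ε)) (rp / r), fun ε r => B.pot (z ε) (rp / r),
    fun ε r => ε * B.profile (z ε) (rp / r), C₁ + (C₂ + 2 * C₁) / rp + 1, by positivity,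
    fun r => B.W (rp / r), ?_, ?_, ?_, ?_, ?_, ?_⟩
  · intro ε h0 h1
    obtain ⟨hz, hepos, helt, hem, hno, hZ⟩ := hfam ε h0 h1
    have hκ := B.κ_pos hz helt
    have hHD := B.horizonData hz hrp hBL' rfl helt
    beta_reduce
    rw [heM' _ hepos, he0, heM' _ B.ha]
    refine ⟨⟨?_, ?_⟩, ?_, hHD, ?_, ?_, ?_⟩
    · rw [hMe0, hBL, hL]
      have : 0 < rp * B.e (z ε) ^ 2 := by positivity
      linarith
    · rw [hMbc, hBL]
      rw [hBL] at hem
      exact mul_lt_mul_of_pos_left hem hrp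
    · refine StaticSystem.of_reduced (κ := B.κ (z ε)) (N := B.N (z ε)) (μ := B.mass (z ε)) (Q := UC.ev (B.Q (z ε)))
        (A := B.pot (z ε)) (u := fun x => ε * B.profile (z ε) x)
            (du := fun x => ε * B.dprofile (z ε) x) hrp ?_
      rw [← hBL', ← hBq]
      exact B.reducedSystem hz (ε := ε) rfl
          (div_pos (sub_pos.mpr helt) (hz.1 1 ⟨zero_le_one, le_rfl⟩))
    · exact B.tendsto_dirichlet hrp hBD ε (B.s (z ε))
    · intro hε hall
      obtain ⟨_, _, _, _, _, _, _, hφ, _⟩ := hHD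
      refine hε.ne' (tendsto_nhds_unique hφ (tendsto_const_nhds.congr' ?_))
      filter_upwards [self_mem_nhdsWithin] with r hr using (hall r hr).symm
    · have hfun : (fun s => B.κ (z ε) (rp / s) ^ 2 * B.N (z ε) (rp / s) / B.κ (z ε) (rp / s) ^ 2)
          = fun s => B.N (z ε) (rp / s) := funext fun s =>
            mul_div_cancel_left₀ _ (pow_ne_zero 2 (hκ _).ne')
      intro r hr
      rw [hfun, mul_div_cancel_left₀ _ (pow_ne_zero 2 (hκ _).ne')]
      have hε2 : |(z ε).1| = ε ^ 2 := abs_of_nonneg (sq_nonneg ε)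
      have h3 : 0 ≤ (C₂ + 2 * C₁) / rp := by positivity
      refine ⟨(B.abs_N_sub_RNpot_le hrp hBL' hr).trans ?_,
          (B.abs_deriv_N_sub_RNpot_le hrp hBL' hz hr).trans ?_⟩
      · rw [hε2, mul_comm]
        gcongr
        linarith
      · rw [hε2, mul_comm]
        gcongr
        have : (‖B.Z (z ε)‖ + 2 * ‖B.no (z ε)‖) / rp ≤ (C₂ + 2 * C₁) / rp := by gcongr
        linarith
  · obtain ⟨hz, -⟩ := hfam 0 le_rfl hε₀
    have h := (B.contDiffOn_of_isHairy hz).2.2.2.2.comp_const_div hrp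
    have hW : B.profile (0 ^ 2, ζ (0 ^ 2)) = B.W := by
      funext x
      rw [Background.profile, zero_pow two_ne_zero, Background.s_zero, Background.W]
    rwa [hW] at h
  · intro hall
    have hr : rp < 2 * rp := by linarith
    have hx := div_mem_Ioo_of_lt hrp hr
    exact (B.W_pos ⟨hx.1, hx.2.le⟩).ne' (hall _ hr)
  · intro r hr
    beta_reduce
    rw [he0, heM' _ B.ha]
    exact B.linear_kleinGordon hrp hBL' hBq hr
  · simpa [Background.W] using B.tendsto_dirichlet hrp hBD 1 B.h
  · intro r hr
    refine ((hprof (rp / r)).mono_left nhdsWithin_le_nhds).congr' ?_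
    filter_upwards [self_mem_nhdsWithin] with ε hε
    have : ε ≠ 0 := ne_of_gt hε
    exact (mul_div_cancel_left₀ _ this).symm
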